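/- Let a ≥ 1 and ℓ ≥ 1 be integers, and let k ≥ 2 be a power of 2 with k(a−1) ≤ 2^ℓ − 1. Then every continuous map f : ℂP^{2^ℓ−a} → ℝ^{2^{ℓ+1}−3} admits a local k-multiplicity: there exists a point x₀ ∈ ℂP^{2^ℓ−a} such that every neighborhood of x₀ contains k pairwise distinct points x_1, …, x_k with f(x_1) = ⋯ = f(x_k). -/

import Mathlib

/-- The projectivization of a topological vector space carries the quotient topology
coming from the nonzero vectors. -/
instance projectivizationTopology (K V : Type*) [DivisionRing K] [AddCommGroup V]
    [Module K V] [TopologicalSpace V] : TopologicalSpace (Projectivization K V) :=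
  inferInstanceAs (TopologicalSpace (Quotient (projectivizationSetoid K V)))

/-- A continuous map `f : X → Y` admits a local `k`-multiplicity if there is a point
`x₀` such that every neighborhood of `x₀` contains `k` pairwise distinct points with
equal images under `f`. -/
def AdmitsLocalMultiplicity {X Y : Type*} [TopologicalSpace X] [TopologicalSpace Y]
    (f : X → Y) (k : ℕ) : Prop :=
  ∃ x₀ : X, ∀ U ∈ nhds x₀, ∃ x : Fin k → X,
    Function.Injective x ∧ (∀ i, x i ∈ U) ∧ ∀ i j, f (x i) = f (x j)

section
open Finset

/-- `0` is a nontrivial nonnegative combination of the vectors `q v`, `v ∈ s`. -/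
def ZeroIn {Q V : Type*} [AddCommGroup V] [Module ℝ V] (q : Q → V) (s : Finset Q) : Prop :=
  ∃ c : Q → ℝ, (∀ v ∈ s, 0 ≤ c v) ∧ (∃ v ∈ s, 0 < c v) ∧ ∑ v ∈ s, c v • q v = 0

variable {Q V : Type*} [AddCommGroup V] [Module ℝ V] {q : Q → V} {s : Finset Q}

theorem not_zeroIn_of_pos (φ : V →ₗ[ℝ] ℝ) (h : ∀ v ∈ s, 0 < φ (q v)) : ¬ ZeroIn q s := by
  rintro ⟨c, hc, ⟨v, hv, hcv⟩, h0⟩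
  have h1 : ∑ v ∈ s, c v * φ (q v) = 0 := by
    simpa using congrArg φ h0
  have h2 : 0 < ∑ v ∈ s, c v * φ (q v) :=
    Finset.sum_pos' (fun w hw => mul_nonneg (hc w hw) (h w hw).le) ⟨v, hv, mul_pos hcv (h v hv)⟩
  exact h2.ne' h1

theorem zeroIn_image_iff {Q' : Type*} [DecidableEq Q] {s : Finset Q'} {g : Q' → Q}
    (hg : Set.InjOn g s) : ZeroIn q (s.image g) ↔ ZeroIn (fun v => q (g v)) s := by
  constructor
  · rintro ⟨c, hc, ⟨v, hv, hcv⟩, h0⟩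
    obtain ⟨u, hu, rfl⟩ := mem_image.1 hv
    refine ⟨fun u => c (g u), fun u hu => hc _ (mem_image_of_mem _ hu), ⟨u, hu, hcv⟩, ?_⟩
    rw [← h0, sum_image hg]
  · rintro ⟨c, hc, ⟨v, hv, hcv⟩, h0⟩
    have : Nonempty Q' := ⟨v⟩
    have hl : ∀ u ∈ s, Function.invFunOn g s (g u) = u := fun u hu => hg.leftInvOn_invFunOn hu
    refine ⟨fun w => c (Function.invFunOn g s w), ?_,
      ⟨g v, mem_image_of_mem _ hv, by simpa [hl v hv]⟩, ?_⟩
    · simp only [mem_image, forall_exists_index, and_imp, forall_apply_eq_imp_iff₂]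
      exact fun u hu => by rw [hl u hu]; exact hc u hu
    · rw [sum_image hg, ← h0]
      exact sum_congr rfl fun u hu => by simp only [hl u hu]

theorem ZeroIn.map {W : Type*} [AddCommGroup W] [Module ℝ W] (h : ZeroIn q s) (L : V →ₗ[ℝ] W) :
    ZeroIn (fun v => L (q v)) s := by
  obtain ⟨c, hc, h1, h0⟩ := h
  refine ⟨c, hc, h1, ?_⟩
  simp only [← map_smul, ← map_sum, h0, map_zero]

theorem ZeroIn.congr {q' : Q → V} (h : ZeroIn q s) (hq : ∀ v ∈ s, q v = q' v) : ZeroIn q' s := by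
  obtain ⟨c, hc, h1, h0⟩ := h
  refine ⟨c, hc, h1, ?_⟩
  rw [← h0]
  exact sum_congr rfl fun v hv => by rw [hq v hv]

theorem even_card_zeroIn_erase [DecidableEq Q] [FiniteDimensional ℝ V] (T : Finset Q)
    (hT : T.card = Module.finrank ℝ V + 2)
    (hgp : ∀ S ⊆ T, S.card = Module.finrank ℝ V → LinearIndepOn ℝ q (S : Set Q))
    [DecidablePred fun c => ZeroIn q (T.erase c)] :
    Even (T.filter fun c => ZeroIn q (T.erase c)).card := by
  have K1 : ∀ c : Q → ℝ, ∑ v ∈ T, c v • q v = 0 → ∀ x ∈ T, ∀ y ∈ T, x ≠ y → c x = 0 → c y = 0 →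
      ∀ v ∈ T, c v = 0 := by
    intro c hc x hx y hy hxy hcx hcy v hv
    have hy' : y ∈ T.erase x := mem_erase.2 ⟨hxy.symm, hy⟩
    have hli := hgp ((T.erase x).erase y) ((erase_subset _ _).trans (erase_subset _ _))
      (by rw [card_erase_of_mem hy', card_erase_of_mem hx, hT]; omega)
    rw [← add_sum_erase _ _ hx, ← add_sum_erase _ _ hy', hcx, hcy] at hc
    simp only [zero_smul, zero_add] at hc
    rw [linearIndepOn_finset_iff] at hli
    by_cases hvx : v = x
    · rw [hvx, hcx]
    by_cases hvy : v = y
    · rw [hvy, hcy]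
    exact hli c hc v (by simp [hvx, hvy, hv])
  have K2 : ∀ x ∈ T, ∃ u : Q → ℝ, u x = 1 ∧ ∑ v ∈ T, u v • q v = 0 := by
    intro x hx
    obtain ⟨y, hy'⟩ : (T.erase x).Nonempty := by
      rw [← card_pos, card_erase_of_mem hx, hT]; omega
    have hcard : ((T.erase x).erase y).card = Module.finrank ℝ V := by
      rw [card_erase_of_mem hy', card_erase_of_mem hx, hT]; omega
    have hli := hgp ((T.erase x).erase y) ((erase_subset _ _).trans (erase_subset _ _)) hcard
    have hsp : Submodule.span ℝ (q '' (((T.erase x).erase y : Finset Q) : Set Q)) = ⊤ := by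
      have := LinearIndependent.span_eq_top_of_card_eq_finrank' hli
        ((Fintype.card_coe _).trans hcard)
      rw [← this, Set.image_eq_range]
    have hxs : -q x ∈ Submodule.span ℝ (q '' (((T.erase x).erase y : Finset Q) : Set Q)) := by
      rw [hsp]; trivial
    rw [Submodule.mem_span_image_finset_iff_exists_fun'] at hxs
    obtain ⟨c, hc⟩ := hxs
    refine ⟨fun v => if v = x then 1 else if v = y then 0 else c v, by simp, ?_⟩
    rw [← add_sum_erase _ _ hx, ← add_sum_erase _ _ hy']
    have hyx : y ≠ x := (mem_erase.1 hy').1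
    have : ∑ v ∈ (T.erase x).erase y, (if v = x then 1 else if v = y then 0 else c v) • q v
        = -q x := by
      rw [← hc]
      refine sum_congr rfl fun v hv => ?_
      simp only [mem_erase] at hv
      rw [if_neg hv.2.1, if_neg hv.1]
    rw [this]; simp [hyx]
  -- a `ZeroIn` witness vanishes only at the erased point
  have K3 : ∀ x ∈ T, ZeroIn q (T.erase x) → ∃ w : Q → ℝ, w x = 0 ∧ (∀ v ∈ T, v ≠ x → 0 < w v) ∧
      ∑ v ∈ T, w v • q v = 0 := by
    rintro x hx ⟨c, hc, ⟨v, hv, hcv⟩, h0⟩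
    have h0' : ∑ v ∈ T, (Function.update c x 0) v • q v = 0 := by
      rw [← add_sum_erase _ _ hx, ← h0]
      simp only [Function.update_self, zero_smul, zero_add]
      exact sum_congr rfl fun v hv => by rw [Function.update_of_ne (mem_erase.1 hv).1]
    refine ⟨Function.update c x 0, by simp, ?_, h0'⟩
    intro u hu hux
    rw [Function.update_of_ne hux]
    refine lt_of_le_of_ne (hc u (mem_erase.2 ⟨hux, hu⟩)) fun hcu => ?_
    have := K1 _ h0' x hx u hu hux.symm (by simp) (by rw [Function.update_of_ne hux, ← hcu]) v
      (mem_erase.1 hv).2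
    rw [Function.update_of_ne (mem_erase.1 hv).1] at this
    exact hcv.ne' this
  by_cases hex : ∃ x ∈ T, ZeroIn q (T.erase x)
  swap
  · have : T.filter (fun c => ZeroIn q (T.erase c)) = ∅ := by
      rw [filter_eq_empty_iff]; push Not at hex; exact hex
    simp [this]
  obtain ⟨x, hx, hzx⟩ := hex
  obtain ⟨w, hwx, hw, hw0⟩ := K3 x hx hzx
  obtain ⟨u, hux, hu0⟩ := K2 x hx
  have hne : (T.erase x).Nonempty := by
    rw [← card_pos, card_erase_of_mem hx, hT]; omega
  obtain ⟨y, hy, hmax⟩ := exists_max_image (T.erase x) (fun v => - u v / w v) hne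
  obtain ⟨hyx, hyT⟩ := mem_erase.1 hy
  have hcomb : ∀ r : ℝ, ∑ v ∈ T, (u v + r * w v) • q v = 0 := by
    intro r
    simp only [add_smul, sum_add_distrib, hu0, mul_smul, ← smul_sum, hw0, smul_zero, add_zero]
  have hset : T.filter (fun c => ZeroIn q (T.erase c)) = {x, y} := by
    ext z
    simp only [mem_filter, mem_insert, mem_singleton]
    constructor
    · rintro ⟨hz, hzz⟩
      by_contra! hcon
      obtain ⟨w', hw'z, hw', hw'0⟩ := K3 z hz hzz
      have hwz := hw z hz hcon.1
      have hwy := hw y hyT hyx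
      have hw'x := hw' x hx hcon.1.symm
      have hw'y := hw' y hyT hcon.2.symm
      have h2 := K1 (fun v => (u v + (- u z / w z) * w v) - (w' x)⁻¹ * w' v) (by
          simp only [sub_smul, sum_sub_distrib, hcomb, mul_smul, ← smul_sum, hw'0]; simp)
        x hx z hz hcon.1.symm (by simp [hux, hwx, hw'x.ne']) (by simp [hw'z, hwz.ne']) y hyT
      have h3 := hmax z (mem_erase.2 ⟨hcon.1, hz⟩)
      have h4 : 0 < (w' x)⁻¹ * w' y := by positivity
      rw [le_div_iff₀ hwy] at h3
      linarith
    · rintro (rfl | rfl)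
      · exact ⟨hx, hzx⟩
      · refine ⟨hyT, fun v => u v + (- u z / w z) * w v, ?_, ⟨x, ?_, ?_⟩, ?_⟩
        · intro v hv
          by_cases hvx : v = x
          · simp [hvx, hux, hwx]
          · have hwv := hw v (mem_erase.1 hv).2 hvx
            have := hmax v (mem_erase.2 ⟨hvx, (mem_erase.1 hv).2⟩)
            rw [div_le_iff₀ hwv] at this
            linarith
        · exact mem_erase.2 ⟨hyx.symm, hx⟩
        · simp [hux, hwx]
        · have := hcomb (- u z / w z)
          rw [← add_sum_erase _ _ hyT] at this
          rw [← this]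
          simp [(hw z hyT hyx).ne']
  rw [hset, card_pair hyx.symm]
  exact even_two
end

section
open Finset

theorem exists_mem_ball_forall_notMem {V I : Type*} [NormedAddCommGroup V] [NormedSpace ℝ V]
    [FiniteDimensional ℝ V] [Finite I] (p : I → Submodule ℝ V) (hp : ∀ i, p i ≠ ⊤) (x : V)
    {η : ℝ} (hη : 0 < η) : ∃ v ∈ Metric.ball x η, ∀ i, v ∉ p i := by
  have : CompleteSpace V := FiniteDimensional.complete ℝ V
  have hd : Dense (⋂ i, ((p i : Set V)ᶜ)) := by
    refine dense_iInter_of_isOpen (fun i => ?_) fun i => ?_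
    · exact (Submodule.closed_of_finiteDimensional (p i)).isOpen_compl
    · rw [← interior_eq_empty_iff_dense_compl]
      by_contra h
      exact hp i ((p i).eq_top_of_nonempty_interior' (Set.nonempty_iff_ne_empty.2 h))
  obtain ⟨v, hv, hv'⟩ := hd.exists_mem_open Metric.isOpen_ball ⟨x, Metric.mem_ball_self hη⟩
  exact ⟨v, hv', by simpa using hv⟩

theorem exists_forall_linearIndepOn {V R Γ : Type*} [NormedAddCommGroup V] [NormedSpace ℝ V]
    [FiniteDimensional ℝ V] [Finite R] [Group Γ] [Finite Γ] (rep : Representation ℝ Γ V)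
    (k₀ : R → V) {η : ℝ} (hη : 0 < η) :
    ∃ k : R → V, (∀ r, ‖k r - k₀ r‖ < η) ∧ ∀ T : Finset R, T.card ≤ Module.finrank ℝ V →
      ∀ γ : R → Γ, LinearIndepOn ℝ (fun r => rep (γ r) (k r)) (T : Set R) := by
  classical
  have := Fintype.ofFinite R
  suffices H : ∀ A : Finset R, ∃ k : R → V, (∀ r, ‖k r - k₀ r‖ < η) ∧
      ∀ T : Finset R, T ⊆ A → T.card ≤ Module.finrank ℝ V →
      ∀ γ : R → Γ, LinearIndepOn ℝ (fun r => rep (γ r) (k r)) (T : Set R) by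
    obtain ⟨k, hk, h⟩ := H univ
    exact ⟨k, hk, fun T => h T (subset_univ T)⟩
  intro A
  induction A using Finset.induction_on with
  | empty =>
    refine ⟨k₀, by simpa using fun _ => hη, fun T hT _ γ => ?_⟩
    rw [subset_empty.1 hT, coe_empty]
    exact linearIndepOn_empty ℝ _
  | insert r₀ A hr₀ ih =>
    obtain ⟨k, hk, h⟩ := ih
    let p : ({T : Finset R // T.card < Module.finrank ℝ V} × (R → Γ)) → Submodule ℝ V := fun i =>
      (Submodule.span ℝ ((fun r => rep (i.2 r) (k r)) '' (i.1.1 : Set R))).comap (rep (i.2 r₀))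
    have hp : ∀ i, p i ≠ ⊤ := by
      intro i hi
      have h1 : Submodule.span ℝ ((fun r => rep (i.2 r) (k r)) '' (i.1.1 : Set R)) = ⊤ := by
        rw [eq_top_iff]
        intro v _
        have : rep (i.2 r₀)⁻¹ v ∈ p i := by rw [hi]; trivial
        simpa [p] using this
      have h2 := finrank_span_finset_le_card (R := ℝ) (i.1.1.image (fun r => rep (i.2 r) (k r)))
      rw [coe_image, Set.finrank, h1] at h2
      have h3 : Module.finrank ℝ (⊤ : Submodule ℝ V) = Module.finrank ℝ V := finrank_top ℝ V
      have h4 := card_image_le (s := i.1.1) (f := fun r => rep (i.2 r) (k r))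
      have := i.1.2
      omega
    obtain ⟨v, hv, hvp⟩ := exists_mem_ball_forall_notMem p hp (k₀ r₀) hη
    refine ⟨Function.update k r₀ v, fun r => ?_, fun T hT hTc γ => ?_⟩
    · by_cases hr : r = r₀
      · subst hr; simpa [← dist_eq_norm] using hv
      · simpa [Function.update_of_ne hr] using hk r
    · have hcongr : ∀ T' : Finset R, r₀ ∉ T' →
          Set.EqOn (fun r => rep (γ r) (k r)) (fun r => rep (γ r) (Function.update k r₀ v r))
            (T' : Set R) := by
        intro T' hr r hrT
        have : r ≠ r₀ := by rintro rfl; exact hr hrT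
        simp [Function.update_of_ne this]
      by_cases hr : r₀ ∈ T
      · have hTe : T.erase r₀ ⊆ A := by
          rw [← erase_insert hr₀]; exact erase_subset_erase _ hT
        have hc : (T.erase r₀).card < Module.finrank ℝ V := by
          rw [card_erase_of_mem hr]; have := card_pos.2 ⟨r₀, hr⟩; omega
        rw [← insert_erase hr, coe_insert, linearIndepOn_insert (by simp)]
        refine ⟨(h _ hTe hc.le γ).congr (hcongr _ (by simp)), ?_⟩
        rw [← (hcongr (T.erase r₀) (by simp)).image_eq]
        simpa [p] using hvp ⟨⟨T.erase r₀, hc⟩, γ⟩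
      · refine (h T (fun r hrT => ?_) hTc γ).congr (hcongr T hr)
        exact (mem_insert.1 (hT hrT)).resolve_left fun h => hr (h ▸ hrT)

theorem exists_equivariant_linearIndepOn {V Q Γ : Type*} [NormedAddCommGroup V] [NormedSpace ℝ V]
    [FiniteDimensional ℝ V] [Finite Q] [Group Γ] [Finite Γ] [MulAction Γ Q]
    (hfree : ∀ (γ : Γ) (q : Q), γ • q = q → γ = 1) (rep : Representation ℝ Γ V)
    (K₀ : Q → V) (hK₀ : ∀ γ q, K₀ (γ • q) = rep γ (K₀ q)) {η : ℝ} (hη : 0 < η) :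
    ∃ K : Q → V, (∀ γ q, K (γ • q) = rep γ (K q)) ∧ (∀ q, ‖K q - K₀ q‖ < η) ∧
      ∀ S : Finset Q, S.card ≤ Module.finrank ℝ V →
        (∀ x ∈ S, ∀ y ∈ S, ∀ γ : Γ, γ • x = y → x = y) → LinearIndepOn ℝ K (S : Set Q) := by
  classical
  have := Fintype.ofFinite Γ
  let R := MulAction.orbitRel.Quotient Γ Q
  have : Finite R := Quotient.finite _
  have hrep : ∀ q : Q, ∃ γ : Γ, γ • (Quotient.mk'' q : R).out = q := by
    intro q
    have h : (MulAction.orbitRel Γ Q) q (Quotient.mk'' q : R).out :=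
      (MulAction.orbitRel Γ Q).symm (Quotient.mk_out q)
    exact h
  choose γ hγ using hrep
  have hγg : ∀ (g : Γ) (q : Q), γ (g • q) = g * γ q := by
    intro g q
    have h1 := hγ (g • q)
    have h2 : (Quotient.mk'' (g • q) : R) = Quotient.mk'' q :=
      Quotient.sound (s := MulAction.orbitRel Γ Q) ⟨g, rfl⟩
    rw [h2] at h1
    have h3 : (g * γ q)⁻¹ * γ (g • q) = 1 := by
      apply hfree _ (Quotient.mk'' q : R).out
      rw [mul_smul, h1, inv_smul_eq_iff, mul_smul, hγ]
    exact (inv_mul_eq_one.1 h3).symm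
  -- a bound for the finitely many operators of the representation
  obtain ⟨C, hC0, hC⟩ : ∃ C : ℝ, 0 < C ∧ ∀ (g : Γ) (v : V), ‖rep g v‖ ≤ C * ‖v‖ := by
    refine ⟨1 + ∑ g : Γ, ‖LinearMap.toContinuousLinearMap (rep g)‖,
      add_pos_of_pos_of_nonneg one_pos (sum_nonneg fun _ _ => norm_nonneg _), fun g v => ?_⟩
    refine (LinearMap.toContinuousLinearMap (rep g)).le_of_opNorm_le ?_ v
    have := single_le_sum (f := fun g : Γ => ‖LinearMap.toContinuousLinearMap (rep g)‖)
      (fun _ _ => norm_nonneg _) (mem_univ g)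
    linarith
  obtain ⟨k, hk, hli⟩ := exists_forall_linearIndepOn rep (fun r : R => K₀ r.out) (div_pos hη hC0)
  refine ⟨fun q => rep (γ q) (k (Quotient.mk'' q)), fun g q => ?_, fun q => ?_, fun S hS hSo => ?_⟩
  · have h2 : (Quotient.mk'' (g • q) : R) = Quotient.mk'' q :=
      Quotient.sound (s := MulAction.orbitRel Γ Q) ⟨g, rfl⟩
    simp only [hγg, h2, map_mul, Module.End.mul_apply]
  · have h1 : K₀ q = rep (γ q) (K₀ (Quotient.mk'' q : R).out) := by rw [← hK₀, hγ]
    rw [h1, ← map_sub]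
    refine (hC _ _).trans_lt ?_
    have := hk (Quotient.mk'' q)
    rwa [lt_div_iff₀' hC0] at this
  · let f : Q → R := fun q => Quotient.mk'' q
    have hinj : Set.InjOn f (S : Set Q) := by
      intro x hx y hy hxy
      obtain ⟨g, hg⟩ := Quotient.exact (s := MulAction.orbitRel Γ Q) hxy
      exact (hSo y hy x hx g hg).symm
    let γ' : R → Γ := fun r => if h : ∃ q ∈ S, f q = r then γ h.choose else 1
    have hγ' : ∀ q ∈ S, γ' (f q) = γ q := by
      intro q hq
      have h : ∃ q' ∈ S, f q' = f q := ⟨q, hq, rfl⟩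
      simp only [γ', dif_pos h]
      rw [hinj h.choose_spec.1 hq h.choose_spec.2]
    have h1 := hli (S.image f) (card_image_le.trans hS) γ'
    rw [coe_image] at h1
    have h2 := h1.comp_of_image hinj
    refine h2.congr fun q hq => ?_
    simp only [Function.comp, hγ' q hq, f]
end

section
open Finset

/-- A pure simplicial complex, given by its set of `D`-dimensional facets, with a free
facet-preserving group action, such that every interior wall lies in evenly many facets. -/
structure FreeComplex (Γ Vx : Type*) [Group Γ] [MulAction Γ Vx] [DecidableEq Vx] (D : ℕ)
    (𝓕 : Finset (Finset Vx)) : Prop where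
  card_eq : ∀ s ∈ 𝓕, s.card = D + 1
  image_mem : ∀ (γ : Γ), ∀ s ∈ 𝓕, s.image (γ • ·) ∈ 𝓕
  free : ∀ s ∈ 𝓕, ∀ u ∈ s, ∀ γ : Γ, γ • u ∈ s → γ = 1
  even : ∀ s ∈ 𝓕, ∀ v ∈ s, ∀ w ∈ s, v ≠ w → Even (𝓕.filter fun s' => s.erase w ⊆ s').card

variable {Γ Vx V : Type*} [Group Γ] [MulAction Γ Vx] [DecidableEq Vx] [NormedAddCommGroup V]
  [NormedSpace ℝ V] {𝓕 : Finset (Finset Vx)} {D : ℕ}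

theorem zeroIn_smul_iff (rep : Representation ℝ Γ V) {F : Vx → V}
    (hF : ∀ γ v, F (γ • v) = rep γ (F v)) (γ : Γ) (s : Finset Vx) :
    ZeroIn F (s.image (γ • ·)) ↔ ZeroIn F s := by
  rw [zeroIn_image_iff (MulAction.injective γ).injOn]
  simp only [hF]
  refine ⟨fun h => ?_, fun h => h.map _⟩
  have := h.map (rep γ⁻¹)
  simpa using this

/-- Zero facets meeting the orbit of `v₀`, counted through those containing `v₀`. -/
theorem FreeComplex.card_filter_orbit [Fintype Γ] (h𝓕 : FreeComplex Γ Vx D 𝓕)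
    (rep : Representation ℝ Γ V) {F : Vx → V} (hF : ∀ γ v, F (γ • v) = rep γ (F v)) (v₀ : Vx)
    [DecidablePred (ZeroIn F)] [DecidablePred fun s : Finset Vx => ∃ γ : Γ, γ • v₀ ∈ s] :
    (𝓕.filter fun s => (∃ γ : Γ, γ • v₀ ∈ s) ∧ ZeroIn F s).card =
      Fintype.card Γ * (𝓕.filter fun s => v₀ ∈ s ∧ ZeroIn F s).card := by
  have h1 : ∀ γ : Γ, (𝓕.filter fun s => γ • v₀ ∈ s ∧ ZeroIn F s).card =
      (𝓕.filter fun s => v₀ ∈ s ∧ ZeroIn F s).card := by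
    intro γ
    symm
    refine card_bij' (fun s _ => s.image (γ • ·)) (fun s _ => s.image (γ⁻¹ • ·)) ?_ ?_ ?_ ?_
    · intro s hs
      simp only [mem_filter] at hs ⊢
      exact ⟨h𝓕.image_mem γ s hs.1, mem_image_of_mem _ hs.2.1, (zeroIn_smul_iff rep hF γ s).2 hs.2.2⟩
    · intro s hs
      simp only [mem_filter] at hs ⊢
      refine ⟨h𝓕.image_mem _ s hs.1, ?_, (zeroIn_smul_iff rep hF _ s).2 hs.2.2⟩
      simpa using mem_image_of_mem (γ⁻¹ • ·) hs.2.1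
    · intro s _; simp [image_image, Function.comp_def]
    · intro s _; simp [image_image, Function.comp_def]
  calc _ = ∑ s ∈ 𝓕.filter (fun s => (∃ γ : Γ, γ • v₀ ∈ s) ∧ ZeroIn F s),
        (univ.filter fun γ : Γ => γ • v₀ ∈ s).card := by
        rw [card_eq_sum_ones]
        refine sum_congr rfl fun s hs => ?_
        simp only [mem_filter] at hs
        obtain ⟨hs, ⟨γ, hγ⟩, -⟩ := hs
        symm
        rw [card_eq_one]
        refine ⟨γ, ?_⟩
        ext γ'
        simp only [mem_filter, mem_univ, true_and, mem_singleton]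
        refine ⟨fun h => ?_, fun h => h ▸ hγ⟩
        have := h𝓕.free s hs _ hγ (γ' * γ⁻¹) (by simpa [mul_smul] using h)
        rwa [mul_inv_eq_one] at this
    _ = ∑ γ : Γ, (𝓕.filter fun s => γ • v₀ ∈ s ∧ ZeroIn F s).card := by
        simp only [card_filter]
        rw [sum_comm]
        refine sum_congr rfl fun γ _ => ?_
        rw [sum_filter]
        refine sum_congr rfl fun s _ => ?_
        by_cases h : γ • v₀ ∈ s
        · have : ∃ γ : Γ, γ • v₀ ∈ s := ⟨γ, h⟩
          simp [h, this]
        · simp [h]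
    _ = _ := by simp [h1]

theorem FreeComplex.star_parity [FiniteDimensional ℝ V] (h𝓕 : FreeComplex Γ Vx D 𝓕)
    (hD : D = Module.finrank ℝ V) (v₀ : Vx) (q : Option Vx → V)
    (hq : ∀ s ∈ 𝓕, v₀ ∈ s → ∀ S ⊆ insertNone s, S.card = D → LinearIndepOn ℝ q (S : Set (Option Vx)))
    {F F' : Vx → V} (hF : ∀ u, F u = q (some u))
    (hF' : ∀ s ∈ 𝓕, v₀ ∈ s → ∀ u ∈ s, F' u = if u = v₀ then q none else q (some u))
    [DecidablePred (ZeroIn F)] [DecidablePred (ZeroIn F')] :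
    Even ((𝓕.filter fun s => v₀ ∈ s ∧ ZeroIn F s).card +
      (𝓕.filter fun s => v₀ ∈ s ∧ ZeroIn F' s).card) := by
  classical
  subst hD
  let star := 𝓕.filter fun s => v₀ ∈ s
  have hstar : ∀ s ∈ star, s ∈ 𝓕 ∧ v₀ ∈ s := fun s hs => mem_filter.1 hs
  let P : Finset Vx → ZMod 2 := fun τ => if ZeroIn q (insertNone τ) then 1 else 0
  have h1 : ∀ s ∈ star, (if ZeroIn F s then (1 : ZMod 2) else 0) + (if ZeroIn F' s then 1 else 0) +
      ∑ w ∈ s.erase v₀, P (s.erase w) = 0 := by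
    intro s hs
    obtain ⟨hs, hv⟩ := hstar s hs
    have h := even_card_zeroIn_erase (q := q) (insertNone s)
      (by rw [card_insertNone, h𝓕.card_eq s hs]) (hq s hs hv)
    rw [← ZMod.natCast_eq_zero_iff_even, card_filter] at h
    push_cast at h
    have e1 : ((insertNone s).erase none) = s.image some := by
      ext u; cases u <;> simp
    have e2 : ((insertNone s).erase (some v₀)) = s.image fun u => if u = v₀ then none else some u := by
      ext u
      rcases u with _ | u
      · simp [hv]
      · simp only [mem_erase, ne_eq, Option.some.injEq, some_mem_insertNone, mem_image]
        constructor
        · rintro ⟨h1, h2⟩; exact ⟨u, h2, by simp [h1]⟩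
        · rintro ⟨w, h1, h2⟩
          split_ifs at h2 with h3
          cases h2; exact ⟨h3, h1⟩
    have e3 : ∀ w, (insertNone s).erase (some w) = insertNone (s.erase w) := by
      intro w; ext u; cases u <;> simp
    have i2 : Set.InjOn (fun u => if u = v₀ then none else some u) (s : Set Vx) := by
      intro x _ y _ hxy
      by_cases hx : x = v₀ <;> by_cases hy : y = v₀ <;> simp_all
    have z1 : ZeroIn q ((insertNone s).erase none) ↔ ZeroIn F s := by
      rw [e1, zeroIn_image_iff (Option.some_injective _).injOn]
      simp only [← hF]
    have z2 : ZeroIn q ((insertNone s).erase (some v₀)) ↔ ZeroIn F' s := by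
      rw [e2, zeroIn_image_iff i2]
      have : ∀ u ∈ s, q (if u = v₀ then none else some u) = F' u := by
        intro u hu; rw [hF' s hs hv u hu]; split_ifs <;> rfl
      exact ⟨fun h => h.congr this, fun h => h.congr fun u hu => (this u hu).symm⟩
    have hins : insertNone s = insert none (s.image some) := by
      ext u; cases u <;> simp
    rw [hins, sum_insert (by simp), ← hins, sum_image (Option.some_injective _).injOn,
      ← add_sum_erase _ _ hv] at h
    simp only [z1, e3] at h
    rw [add_assoc, ← h]
    congr 3
    rw [← e3, z2]
  have h2 : ∑ s ∈ star, ∑ w ∈ s.erase v₀, P (s.erase w) = 0 := by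
    rw [sum_sigma']
    rw [← sum_fiberwise_of_maps_to (g := fun x : (_ : Finset Vx) × Vx => x.1.erase x.2)
      (fun x hx => mem_image_of_mem _ hx)]
    refine sum_eq_zero fun τ hτ => ?_
    obtain ⟨⟨s, w⟩, hx, rfl⟩ := mem_image.1 hτ
    simp only [mem_sigma, mem_erase] at hx
    obtain ⟨hs, hwv, hw⟩ := hx
    obtain ⟨hs, hv⟩ := hstar s hs
    have hcard : ((star.sigma fun s => s.erase v₀).filter
        fun x => x.1.erase x.2 = s.erase w).card = (𝓕.filter fun s' => s.erase w ⊆ s').card := by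
      refine card_bij (fun x _ => x.1) ?_ ?_ ?_
      · rintro ⟨s', w'⟩ hx
        simp only [mem_filter, mem_sigma, mem_erase] at hx ⊢
        exact ⟨(hstar _ hx.1.1).1, hx.2 ▸ erase_subset _ _⟩
      · rintro ⟨s', w'⟩ hx ⟨s'', w''⟩ hx' (rfl : s' = s'')
        simp only [mem_filter, mem_sigma, mem_erase] at hx hx'
        have h3 : s'.erase w' = s'.erase w'' := hx.2.trans hx'.2.symm
        have : w' = w'' := by
          by_contra hne
          have : w' ∈ s'.erase w' := h3 ▸ mem_erase.2 ⟨hne, hx.1.2.2⟩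
          simp at this
        rw [this]
      · intro s' hs'
        simp only [mem_filter] at hs'
        obtain ⟨w', hw'⟩ : (s' \ s.erase w).Nonempty := by
          rw [← card_pos, card_sdiff_of_subset hs'.2, card_erase_of_mem hw, h𝓕.card_eq s hs,
            h𝓕.card_eq s' hs'.1]
          omega
        have hv' : v₀ ∈ s.erase w := mem_erase.2 ⟨hwv.symm, hv⟩
        obtain ⟨hw1, hw2⟩ := mem_sdiff.1 hw'
        refine ⟨⟨s', w'⟩, ?_, rfl⟩
        simp only [mem_filter, mem_sigma, mem_erase, star]
        refine ⟨⟨⟨hs'.1, hs'.2 hv'⟩, fun h => hw2 (h ▸ hv'), hw1⟩, ?_⟩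
        symm
        refine eq_of_subset_of_card_le (fun u hu => mem_erase.2 ⟨fun h => hw2 (h ▸ hu), hs'.2 hu⟩) ?_
        rw [card_erase_of_mem hw1, card_erase_of_mem hw, h𝓕.card_eq s hs, h𝓕.card_eq s' hs'.1]
    rw [sum_congr rfl (g := fun _ => P (s.erase w)) (fun x hx => by rw [(mem_filter.1 hx).2]),
      sum_const, hcard, nsmul_eq_mul,
      (ZMod.natCast_eq_zero_iff_even).2 (h𝓕.even s hs v₀ hv w hw hwv.symm), zero_mul]
  have h3 := sum_congr rfl h1
  rw [sum_add_distrib, h2, sum_add_distrib, add_zero, sum_const_zero] at h3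
  rw [← ZMod.natCast_eq_zero_iff_even]
  push_cast [card_filter]
  refine Eq.trans ?_ h3
  simp only [star, sum_filter, ite_and]

theorem FreeComplex.card_zero_modEq [FiniteDimensional ℝ V] [Fintype Γ]
    (h𝓕 : FreeComplex Γ Vx D 𝓕) (hD : D = Module.finrank ℝ V) [Finite Vx]
    (rep : Representation ℝ Γ V) (K : Vx ⊕ Vx → V) (hK : ∀ (γ : Γ) q, K (γ • q) = rep γ (K q))
    (hgp : ∀ S : Finset (Vx ⊕ Vx), S.card ≤ Module.finrank ℝ V →
        (∀ x ∈ S, ∀ y ∈ S, ∀ γ : Γ, γ • x = y → x = y) → LinearIndepOn ℝ K (S : Set (Vx ⊕ Vx)))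
    [DecidablePred (ZeroIn fun v => K (.inl v))] [DecidablePred (ZeroIn fun v => K (.inr v))] :
    (𝓕.filter fun s => ZeroIn (fun v => K (.inl v)) s).card ≡
      (𝓕.filter fun s => ZeroIn (fun v => K (.inr v)) s).card [MOD 2 * Fintype.card Γ] := by
  classical
  let R := MulAction.orbitRel.Quotient Γ Vx
  have : Finite R := Quotient.finite _
  have := Fintype.ofFinite R
  let ch : Finset R → Vx → Vx ⊕ Vx := fun A v => if (Quotient.mk'' v : R) ∈ A then .inr v else .inl v
  have hmk : ∀ (g : Γ) (v : Vx), (Quotient.mk'' (g • v) : R) = Quotient.mk'' v := fun g v =>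
      Quotient.sound (s := MulAction.orbitRel Γ Vx) ⟨g, rfl⟩
  have hch : ∀ A (γ : Γ) v, ch A (γ • v) = γ • ch A v := by
    intro A γ v
    simp only [ch, hmk]
    split_ifs <;> rfl
  let N : Finset R → ℕ := fun A => (𝓕.filter fun s => ZeroIn (fun v => K (ch A v)) s).card
  suffices H : ∀ A, N ∅ ≡ N A [MOD 2 * Fintype.card Γ] by
    have := H univ
    simpa [N, ch] using this
  intro A
  induction A using Finset.induction_on with
  | empty => rfl
  | insert o A ho ih =>
    refine ih.trans ?_
    have hmko : (Quotient.mk'' o.out : R) = o := Quotient.out_eq o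
    have hmeet : ∀ u : Vx, (Quotient.mk'' u : R) = o → ∃ γ : Γ, γ • o.out = u := by
      intro u hu
      rw [← hmko] at hu
      exact Quotient.exact (s := MulAction.orbitRel Γ Vx) hu
    have hsplit : ∀ B, N B = (𝓕.filter fun s => (∃ γ : Γ, γ • o.out ∈ s) ∧
          ZeroIn (fun v => K (ch B v)) s).card + (𝓕.filter fun s => ¬ (∃ γ : Γ, γ • o.out ∈ s) ∧
          ZeroIn (fun v => K (ch B v)) s).card := by
      intro B
      simp only [N]
      rw [← card_filter_add_card_filter_not (fun s => ∃ γ : Γ, γ • o.out ∈ s), filter_filter,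
        filter_filter]
      simp only [and_comm]
    have heq : (𝓕.filter fun s => ¬ (∃ γ : Γ, γ • o.out ∈ s) ∧
          ZeroIn (fun v => K (ch A v)) s) = (𝓕.filter fun s => ¬ (∃ γ : Γ, γ • o.out ∈ s) ∧
          ZeroIn (fun v => K (ch (insert o A) v)) s) := by
      refine filter_congr fun s _ => and_congr_right fun hns => ?_
      have : ∀ u ∈ s, K (ch A u) = K (ch (insert o A) u) := by
        intro u hu
        have : (Quotient.mk'' u : R) ≠ o := by
          intro h
          obtain ⟨γ, hγ⟩ := hmeet u h
          exact hns ⟨γ, hγ ▸ hu⟩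
        simp [ch, mem_insert, this]
      exact ⟨fun h => h.congr this, fun h => h.congr fun u hu => (this u hu).symm⟩
    have heqv : ∀ B (γ : Γ) v, K (ch B (γ • v)) = rep γ (K (ch B v)) := fun B γ v => by
      rw [hch, hK]
    rw [hsplit A, hsplit (insert o A), heq, h𝓕.card_filter_orbit rep (heqv A),
      h𝓕.card_filter_orbit rep (heqv _)]
    refine Nat.ModEq.add_right _ ?_
    rw [mul_comm 2]
    refine Nat.ModEq.mul_left' _ ?_
    let chq : Option Vx → Vx ⊕ Vx := fun u => u.elim (.inr o.out) (ch A)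
    have hchA : ∀ u, ch A u = .inl u ∨ ch A u = .inr u := by
      intro u; simp only [ch]; split_ifs <;> simp
    have hcho : ch A o.out = .inl o.out := by
      simp only [ch]; rw [if_neg]; rw [hmko]; exact ho
    have key := h𝓕.star_parity hD o.out (fun u => K (chq u)) (F := fun v => K (ch A v))
      (F' := fun v => K (ch (insert o A) v)) ?_ (fun u => rfl) ?_
    · rw [Nat.even_iff] at key
      unfold Nat.ModEq
      omega
    · intro s hs hos S hS hSD
      have hdist : ∀ x ∈ S, ∀ y ∈ S, ∀ γ : Γ, γ • chq x = chq y → x = y := by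
        have hin : ∀ u ∈ s, some u ∈ S → ∀ γ : Γ, γ • ch A u ≠ .inr o.out := by
          intro u hu _ γ h
          rcases hchA u with h1 | h1
          · rw [h1] at h; cases h
          · rw [h1] at h
            have h2 : γ • u = o.out := Sum.inr_injective h
            have := h𝓕.free s hs u hu γ (h2 ▸ hos)
            rw [this, one_smul] at h2
            rw [h2, hcho] at h1; cases h1
        rintro (_ | x) hx (_ | y) hy γ hxy
        · rfl
        · exact absurd (inv_smul_eq_iff.2 hxy.symm) (hin y (by simpa using hS hy) hy γ⁻¹)
        · exact absurd hxy (hin x (by simpa using hS hx) hx γ)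
        · have hx' : x ∈ s := by simpa using hS hx
          have hy' : y ∈ s := by simpa using hS hy
          have h2 : γ • x = y := by
            change γ • ch A x = ch A y at hxy
            rcases hchA x with h1 | h1 <;> rcases hchA y with h3 | h3 <;> rw [h1, h3] at hxy
            · exact Sum.inl_injective hxy
            · cases hxy
            · cases hxy
            · exact Sum.inr_injective hxy
          have := h𝓕.free s hs x hx' γ (h2 ▸ hy')
          rw [this, one_smul] at h2; rw [h2]
      have hinj : Set.InjOn chq (S : Set (Option Vx)) := fun x hx y hy hxy =>
        hdist x hx y hy 1 (by rw [one_smul, hxy])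
      have h1 := hgp (S.image chq) (card_image_le.trans (hSD.trans hD).le) (by
        intro x hx y hy γ hxy
        obtain ⟨x', hx', rfl⟩ := mem_image.1 hx
        obtain ⟨y', hy', rfl⟩ := mem_image.1 hy
        rw [hdist x' hx' y' hy' γ hxy])
      rw [coe_image] at h1
      exact h1.comp_of_image hinj
    · intro s hs hos u hu
      by_cases h : u = o.out
      · subst h
        simp [ch, chq, hmko]
      · have : (Quotient.mk'' u : R) ≠ o := by
          intro h'
          obtain ⟨γ, hγ⟩ := hmeet u h'
          have := h𝓕.free s hs _ hos γ (hγ ▸ hu)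
          rw [this, one_smul] at hγ
          exact h hγ.symm
        simp [ch, chq, h, this]
end

section
open Finset

variable {ι Z : Type*} [CommRing Z] (par : Z →+* ZMod 2)

/-- The face order of the circle subdivided at `Z`: even points are vertices, odd points edges. -/
def RootLE (a b : Z) : Prop := a = b ∨ par a = 0 ∧ (b = a + 1 ∨ b = a - 1)

/-- The product of the face orders. -/
def GridLE (u v : ι → Z) : Prop := ∀ i, RootLE par (u i) (v i)

/-- The dimension of the face corresponding to a grid point. -/
def gridRank [Fintype ι] (v : ι → Z) : ℕ := (univ.filter fun i => par (v i) = 1).card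

open Classical in
/-- The facets of the barycentric subdivision: maximal chains. -/
noncomputable def gridFacets [Fintype ι] [Fintype Z] : Finset (Finset (ι → Z)) :=
  univ.filter fun s => s.card = Fintype.card ι + 1 ∧
    ∀ u ∈ s, ∀ v ∈ s, GridLE par u v ∨ GridLE par v u

variable {par}

theorem zmod_two_cases (a : ZMod 2) : a = 0 ∨ a = 1 := by
  revert a; decide

theorem zmod_two_two : (2 : ZMod 2) = 0 := by decide

theorem RootLE.par_eq_one {a b : Z} (h : RootLE par a b) (hab : a ≠ b) : par a = 0 ∧ par b = 1 := by
  rcases h with h | ⟨h, rfl | rfl⟩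
  · exact absurd h hab
  · simp [h]
  · simp [h]

theorem RootLE.trans {a b c : Z} (h : RootLE par a b) (h' : RootLE par b c) : RootLE par a c := by
  by_cases hab : a = b
  · rwa [hab]
  by_cases hbc : b = c
  · rwa [← hbc]
  have h1 := (h.par_eq_one hab).2
  rw [(h'.par_eq_one hbc).1] at h1
  exact absurd h1 (by decide)

theorem RootLE.eq_or_eq {a b c : Z} (h : RootLE par a b) (h' : RootLE par b c) : b = a ∨ b = c := by
  by_contra! hcon
  have h1 := (h.par_eq_one hcon.1.symm).2
  rw [(h'.par_eq_one hcon.2).1] at h1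
  exact absurd h1 (by decide)

theorem rootLE_sub_left {w x : Z} (h : RootLE par w x) : RootLE par (2 * x - w) x := by
  rcases h with rfl | ⟨h, rfl | rfl⟩
  · left; ring
  · right; refine ⟨?_, Or.inr (by ring)⟩
    rw [map_sub, map_mul, map_ofNat, zmod_two_two, zero_mul, zero_sub, h, neg_zero]
  · right; refine ⟨?_, Or.inl (by ring)⟩
    rw [map_sub, map_mul, map_ofNat, zmod_two_two, zero_mul, zero_sub, h, neg_zero]

theorem rootLE_sub_right {u w : Z} (h : RootLE par u w) : RootLE par u (2 * u - w) := by
  rcases h with rfl | ⟨h, rfl | rfl⟩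
  · left; ring
  · exact Or.inr ⟨h, Or.inr (by ring)⟩
  · exact Or.inr ⟨h, Or.inl (by ring)⟩

theorem RootLE.sub_ne {a b : Z} (h2 : (2 : Z) ≠ 0) (h : RootLE par a b) (hab : a ≠ b) :
    2 * b - a ≠ a ∧ 2 * a - b ≠ b := by
  rcases h with rfl | ⟨h, rfl | rfl⟩
  · exact absurd rfl hab
  · refine ⟨fun h => h2 ?_, fun h => h2 ?_⟩
    · linear_combination h
    · linear_combination -h
  · refine ⟨fun h => h2 ?_, fun h => h2 ?_⟩
    · linear_combination -h
    · linear_combination h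

theorem GridLE.trans {a b c : ι → Z} (h : GridLE par a b) (h' : GridLE par b c) :
    GridLE par a c := fun i => (h i).trans (h' i)

variable [Fintype ι]

theorem GridLE.eq_of_rank_le {u v : ι → Z} (h : GridLE par u v)
    (hr : gridRank par v ≤ gridRank par u) : u = v := by
  by_contra hne
  obtain ⟨i, hi⟩ := Function.ne_iff.1 hne
  have := (h i).par_eq_one hi
  refine absurd hr (not_le.2 (card_lt_card ⟨fun j hj => ?_, fun hsub => ?_⟩))
  · simp only [mem_filter, mem_univ, true_and] at hj ⊢
    by_cases huv : u j = v j
    · rwa [← huv]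
    · exact ((h j).par_eq_one huv).2
  · have h1 := hsub (mem_filter.2 ⟨mem_univ i, this.2⟩)
    simp [this.1] at h1

theorem gridRank_le (v : ι → Z) : gridRank par v ≤ Fintype.card ι := card_le_univ _

variable [Fintype Z]

theorem mem_gridFacets {s : Finset (ι → Z)} : s ∈ gridFacets par ↔ s.card = Fintype.card ι + 1 ∧
    ∀ u ∈ s, ∀ v ∈ s, GridLE par u v ∨ GridLE par v u := by
  classical
  simp [gridFacets]

theorem injOn_gridRank {s : Finset (ι → Z)} (hs : s ∈ gridFacets par) :
    Set.InjOn (gridRank par) (s : Set (ι → Z)) := by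
  intro u hu v hv huv
  rcases (mem_gridFacets.1 hs).2 u hu v hv with h | h
  · exact h.eq_of_rank_le huv.ge
  · exact (h.eq_of_rank_le huv.le).symm

theorem exists_gridRank_eq {s : Finset (ι → Z)} (hs : s ∈ gridFacets par) {t : ℕ}
    (ht : t ≤ Fintype.card ι) : ∃ u ∈ s, gridRank par u = t := by
  have : s.image (gridRank par) = range (Fintype.card ι + 1) := by
    refine eq_of_subset_of_card_le (fun t ht => ?_) ?_
    · obtain ⟨u, -, rfl⟩ := mem_image.1 ht
      exact mem_range.2 (Nat.lt_succ_of_le (gridRank_le u))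
    · rw [card_image_of_injOn (injOn_gridRank hs), (mem_gridFacets.1 hs).1, card_range]
  have h : t ∈ s.image (gridRank par) := this ▸ mem_range.2 (Nat.lt_succ_of_le ht)
  exact mem_image.1 h

theorem gridLE_of_rank_lt {s : Finset (ι → Z)} (hs : s ∈ gridFacets par) {u v : ι → Z} (hu : u ∈ s)
    (hv : v ∈ s) (h : gridRank par u ≤ gridRank par v) : GridLE par u v := by
  rcases (mem_gridFacets.1 hs).2 u hu v hv with h' | h'
  · exact h'
  · rw [h'.eq_of_rank_le h]; exact fun _ => Or.inl rfl

theorem exists_cube_of_mem_gridFacets {s : Finset (ι → Z)} (hs : s ∈ gridFacets par) :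
    ∃ a b : ι → Z, (∀ i, par (a i) = 0) ∧ (∀ i, b i = a i + 1 ∨ b i = a i - 1) ∧
      ∀ u ∈ s, ∀ i, u i = a i ∨ u i = b i := by
  obtain ⟨a, ha, hra⟩ := exists_gridRank_eq hs (t := 0) (Nat.zero_le _)
  obtain ⟨b, hb, hrb⟩ := exists_gridRank_eq hs le_rfl
  have ha' : ∀ i, par (a i) = 0 := by
    intro i
    rw [gridRank, card_eq_zero, filter_eq_empty_iff] at hra
    exact (zmod_two_cases _).resolve_right (hra (mem_univ i))
  have hb' : ∀ i, par (b i) = 1 := by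
    intro i
    rw [gridRank, card_eq_iff_eq_univ, filter_eq_self] at hrb
    exact hrb i (mem_univ i)
  refine ⟨a, b, ha', fun i => ?_, fun u hu i => ?_⟩
  · rcases gridLE_of_rank_lt hs ha hb (by omega) i with h | h
    · have := ha' i
      rw [h, hb'] at this
      exact absurd this (by decide)
    · exact h.2
  · have h1 := gridLE_of_rank_lt hs ha hu (by omega) i
    have h2 := gridLE_of_rank_lt hs hu hb (by rw [hrb]; exact gridRank_le u) i
    exact h1.eq_or_eq h2

/-- The faces of rank `t` filling the gap in a flag are exchanged by a reflection. -/
theorem exists_reflection (h2 : (2 : Z) ≠ 0) {s : Finset (ι → Z)} (hs : s ∈ gridFacets par)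
    (hι : 0 < Fintype.card ι) {t : ℕ} (ht : t ≤ Fintype.card ι) :
    ∃ c : ι → Z, ∀ w : ι → Z, gridRank par w = t →
      (∀ y ∈ s, (gridRank par y < t → GridLE par y w) ∧ (t < gridRank par y → GridLE par w y)) →
      gridRank par (c - w) = t ∧ (∀ y ∈ s, (gridRank par y < t → GridLE par y (c - w)) ∧
        (t < gridRank par y → GridLE par (c - w) y)) ∧ c - w ≠ w := by
  have hpar2 : ∀ a b : Z, par (2 * a - b) = par b := by
    intro a b
    rw [map_sub, map_mul, map_ofNat, zmod_two_two, zero_mul, zero_sub, ZMod.neg_eq_self_mod_two]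
  rcases Nat.eq_zero_or_pos t with rfl | ht0
  · obtain ⟨x, hx, hrx⟩ := exists_gridRank_eq hs (t := 1) hι
    refine ⟨fun i => 2 * x i, fun w hw hwy => ⟨?_, fun y hy => ⟨fun h => by omega, fun h => ?_⟩, ?_⟩⟩
    · refine Eq.trans ?_ hw; simp only [gridRank, Pi.sub_apply, hpar2]
    · have h1 : GridLE par (fun i => 2 * x i - w i) x := fun i =>
        rootLE_sub_left ((hwy x hx).2 (by omega) i)
      exact h1.trans (gridLE_of_rank_lt hs hx hy (by omega))
    · have hne : w ≠ x := by rintro rfl; omega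
      obtain ⟨i, hi⟩ := Function.ne_iff.1 hne
      exact fun h => (((hwy x hx).2 (by omega) i).sub_ne h2 hi).1 (congrFun h i)
  rcases ht.eq_or_lt with rfl | htD
  · obtain ⟨u, hu, hru⟩ := exists_gridRank_eq hs (t := Fintype.card ι - 1) (by omega)
    refine ⟨fun i => 2 * u i, fun w hw hwy => ⟨?_, fun y hy => ⟨fun h => ?_, fun h => ?_⟩, ?_⟩⟩
    · refine Eq.trans ?_ hw; simp only [gridRank, Pi.sub_apply, hpar2]
    · have h1 : GridLE par u (fun i => 2 * u i - w i) := fun i =>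
        rootLE_sub_right ((hwy u hu).1 (by omega) i)
      exact (gridLE_of_rank_lt hs hy hu (by omega)).trans h1
    · exact absurd (gridRank_le (par := par) y) (by omega)
    · have hne : u ≠ w := by rintro rfl; omega
      obtain ⟨i, hi⟩ := Function.ne_iff.1 hne
      exact fun h => (((hwy u hu).1 (by omega) i).sub_ne h2 hi).2 (congrFun h i)
  · obtain ⟨u, hu, hru⟩ := exists_gridRank_eq hs (t := t - 1) (by omega)
    obtain ⟨x, hx, hrx⟩ := exists_gridRank_eq hs (t := t + 1) (by omega)
    refine ⟨u + x, fun w hw hwy => ?_⟩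
    have huw := (hwy u hu).1 (by omega)
    have hwx := (hwy x hx).2 (by omega)
    have hcase : ∀ i, (w i = u i ∧ (u + x - w) i = x i) ∨ (w i = x i ∧ (u + x - w) i = u i) := by
      intro i
      rcases (huw i).eq_or_eq (hwx i) with h | h
      · left; exact ⟨h, by simp [h]⟩
      · right; exact ⟨h, by simp [h]⟩
    have hux : GridLE par u x := huw.trans hwx
    have huc : GridLE par u (u + x - w) := by
      intro i
      rcases hcase i with ⟨-, h⟩ | ⟨-, h⟩ <;> rw [h]
      exacts [hux i, Or.inl rfl]
    have hcx : GridLE par (u + x - w) x := by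
      intro i
      rcases hcase i with ⟨-, h⟩ | ⟨-, h⟩ <;> rw [h]
      exacts [Or.inl rfl, hux i]
    refine ⟨?_, fun y hy => ⟨fun h => ?_, fun h => ?_⟩, ?_⟩
    · have : gridRank par (u + x - w) + gridRank par w = gridRank par u + gridRank par x := by
        simp only [gridRank, card_filter, ← sum_add_distrib]
        refine sum_congr rfl fun i _ => ?_
        rcases hcase i with ⟨h, h'⟩ | ⟨h, h'⟩ <;> rw [h, h']
        rw [add_comm]
      omega
    · exact (gridLE_of_rank_lt hs hy hu (by omega)).trans huc
    · exact hcx.trans (gridLE_of_rank_lt hs hx hy (by omega))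
    · have hne : w ≠ x := by rintro rfl; omega
      obtain ⟨i, hi⟩ := Function.ne_iff.1 hne
      intro h
      have h' := congrFun h i
      rcases hcase i with ⟨-, h1⟩ | ⟨h1, -⟩
      · exact hi (h'.symm.trans h1)
      · exact hi h1

theorem even_card_facets [DecidableEq Z] [DecidableEq ι] (h2 : (2 : Z) ≠ 0) {s : Finset (ι → Z)}
    (hs : s ∈ gridFacets par) {w : ι → Z} (hw : w ∈ s) (hs1 : 1 < s.card) :
    Even ((gridFacets par).filter fun s' => s.erase w ⊆ s').card := by
  classical
  have hcs := (mem_gridFacets.1 hs).1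
  set t := gridRank par w with ht
  let W : Finset (ι → Z) := univ.filter fun w' => gridRank par w' = t ∧
    ∀ y ∈ s, (gridRank par y < t → GridLE par y w') ∧ (t < gridRank par y → GridLE par w' y)
  have hrne : ∀ y ∈ s.erase w, gridRank par y ≠ t := fun y hy h =>
    (mem_erase.1 hy).1 (injOn_gridRank hs (mem_erase.1 hy).2 hw h)
  have hW : W.card = ((gridFacets par).filter fun s' => s.erase w ⊆ s').card := by
    have hnot : ∀ w' ∈ W, w' ∉ s.erase w := fun w' hw' h =>
      hrne w' h (mem_filter.1 hw').2.1
    refine card_bij (fun w' _ => insert w' (s.erase w)) ?_ ?_ ?_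
    · intro w' hw'
      have hn := hnot w' hw'
      simp only [W, mem_filter, mem_univ, true_and] at hw'
      rw [mem_filter, mem_gridFacets]
      refine ⟨⟨?_, ?_⟩, subset_insert _ _⟩
      · rw [card_insert_of_notMem hn, card_erase_of_mem hw]; omega
      · have hcomp : ∀ y ∈ s.erase w, GridLE par w' y ∨ GridLE par y w' := by
          intro y hy
          rcases (hrne y hy).lt_or_gt with h | h
          · exact Or.inr ((hw'.2 y (mem_erase.1 hy).2).1 h)
          · exact Or.inl ((hw'.2 y (mem_erase.1 hy).2).2 h)
        intro u hu v hv
        rcases mem_insert.1 hu with hu | hu <;> rcases mem_insert.1 hv with hv | hv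
        · exact Or.inl fun _ => Or.inl (by rw [hu, hv])
        · exact hu ▸ hcomp v hv
        · exact hv ▸ (hcomp u hu).symm
        · exact (mem_gridFacets.1 hs).2 u (mem_erase.1 hu).2 v (mem_erase.1 hv).2
    · intro w' hw' w'' hw'' h
      have : w' ∈ insert w'' (s.erase w) := h ▸ mem_insert_self _ _
      exact (mem_insert.1 this).resolve_right (hnot w' hw')
    · intro s' hs'
      obtain ⟨hs', hsub⟩ := mem_filter.1 hs'
      obtain ⟨w', hw', hrw'⟩ := exists_gridRank_eq hs' (gridRank_le (par := par) w)
      have hn : w' ∉ s.erase w := fun h => hrne w' h hrw'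
      refine ⟨w', ?_, ?_⟩
      · simp only [W, mem_filter, mem_univ, true_and]
        refine ⟨hrw', fun y hy => ⟨fun h => ?_, fun h => ?_⟩⟩
        · have : y ∈ s' := hsub (mem_erase.2 ⟨by rintro rfl; omega, hy⟩)
          exact gridLE_of_rank_lt hs' this hw' (by omega)
        · have : y ∈ s' := hsub (mem_erase.2 ⟨by rintro rfl; omega, hy⟩)
          exact gridLE_of_rank_lt hs' hw' this (by omega)
      · refine eq_of_subset_of_card_le (insert_subset hw' hsub) ?_
        rw [card_insert_of_notMem hn, card_erase_of_mem hw, (mem_gridFacets.1 hs').1]; omega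
  rw [← hW, ← ZMod.natCast_eq_zero_iff_even]
  obtain ⟨c, hc⟩ := exists_reflection h2 hs (by omega) (gridRank_le (par := par) w)
  have hcW : ∀ w' ∈ W, c - w' ∈ W ∧ c - w' ≠ w' := by
    intro w' hw'
    simp only [W, mem_filter, mem_univ, true_and] at hw' ⊢
    obtain ⟨h1, h3, h4⟩ := hc w' hw'.1 hw'.2
    exact ⟨⟨h1, h3⟩, h4⟩
  have := sum_involution (s := W) (f := fun _ => (1 : ZMod 2)) (fun w' _ => c - w')
    (fun _ _ => by decide) (fun w' hw' _ => (hcW w' hw').2) (fun w' hw' => (hcW w' hw').1)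
    (fun _ _ => by simp)
  simpa using this
end

section
open Finset

/-- The circle subdivided into `16 K` points. -/
abbrev Grid (K : ℕ) : Type := ZMod (16 * K)

namespace Grid
variable {K : ℕ}

instance [NeZero K] : NeZero (16 * K) := ⟨mul_ne_zero (by norm_num) (NeZero.ne K)⟩

/-- The parity of a grid point. -/
def par : Grid K →+* ZMod 2 := ZMod.castHom (show 2 ∣ 16 * K by omega) (ZMod 2)

/-- The grid point opposite to `0`. -/
def half (K : ℕ) : Grid K := ((8 * K : ℕ) : ZMod (16 * K))

theorem half_add_half : half K + half K = 0 := by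
  change ((8 * K : ℕ) : ZMod (16 * K)) + ((8 * K : ℕ) : ZMod (16 * K)) = 0
  rw [← Nat.cast_add, ← two_mul, ← mul_assoc]
  exact ZMod.natCast_self _

theorem neg_half : -half K = half K := neg_eq_of_add_eq_zero_left half_add_half

theorem par_half : par (half K) = 0 := by
  have : par (half K) = ((8 * K : ℕ) : ZMod 2) := map_natCast (par (K := K)) _
  rw [this, ZMod.natCast_eq_zero_iff_even]
  exact ⟨4 * K, by ring⟩

/-- The action of the two coordinate reflections. -/
instance : MulAction (ℤˣ × ℤˣ) (Grid K) where
  smul g θ := ((g.1 * g.2 : ℤˣ) : ℤ) • θ + if g.1 = 1 then 0 else half K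
  one_smul θ := by
    change ((1 * 1 : ℤˣ) : ℤ) • θ + (if (1 : ℤˣ) = 1 then 0 else half K) = θ
    simp
  mul_smul g g' θ := by
    change (((g.1 * g'.1) * (g.2 * g'.2) : ℤˣ) : ℤ) • θ + (if g.1 * g'.1 = 1 then 0 else half K) =
      ((g.1 * g.2 : ℤˣ) : ℤ) • (((g'.1 * g'.2 : ℤˣ) : ℤ) • θ + if g'.1 = 1 then 0 else half K) +
        if g.1 = 1 then 0 else half K
    obtain ⟨a, b⟩ := g
    obtain ⟨a', b'⟩ := g'
    rcases Int.units_eq_one_or a with rfl | rfl <;> rcases Int.units_eq_one_or b with rfl | rfl <;>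
      rcases Int.units_eq_one_or a' with rfl | rfl <;>
      rcases Int.units_eq_one_or b' with rfl | rfl <;> simp [neg_half, add_assoc, half_add_half]

theorem smul_def (g : ℤˣ × ℤˣ) (θ : Grid K) :
    g • θ = ((g.1 * g.2 : ℤˣ) : ℤ) • θ + if g.1 = 1 then 0 else half K := rfl

theorem rootLE_smul (g : ℤˣ × ℤˣ) {a b : Grid K} (h : RootLE par a b) :
    RootLE par (g • a) (g • b) := by
  have hh : par (if g.1 = 1 then 0 else half K) = 0 := by split_ifs <;> simp [par_half]
  rcases h with rfl | ⟨h, hb⟩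
  · left; rfl
  · right
    simp only [smul_def]
    refine ⟨by rw [map_add, map_zsmul, h, hh, smul_zero, zero_add], ?_⟩
    rcases Int.units_eq_one_or (g.1 * g.2) with h1 | h1 <;> rw [h1] <;> rcases hb with rfl | rfl
    · left; simp; ring
    · right; simp; ring
    · right; simp; ring
    · left; simp; ring

/-- Two neighboring grid points. -/
def Adj (p : Grid K × Grid K) : Prop := p.2 = p.1 + 1 ∨ p.1 = p.2 + 1

theorem Adj.smul {p : Grid K × Grid K} (h : Adj p) (g : ℤˣ × ℤˣ) : Adj (g • p) := by
  change g • p.2 = g • p.1 + 1 ∨ g • p.1 = g • p.2 + 1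
  simp only [smul_def]
  rcases Int.units_eq_one_or (g.1 * g.2) with h1 | h1 <;> rw [h1] <;> rcases h with h | h <;> rw [h]
  all_goals simp only [Units.val_neg, Units.val_one, Int.reduceNeg, neg_smul, one_smul]
  · left; abel
  · right; abel
  · right; abel
  · left; abel

/-- The action of the two coordinate reflections on the complex plane. -/
instance complexAction : MulAction (ℤˣ × ℤˣ) ℂ where
  smul g z := ⟨((g.1 : ℤ) : ℝ) * z.re, ((g.2 : ℤ) : ℝ) * z.im⟩
  one_smul z := by
    change (⟨((1 : ℤˣ) : ℤ) * z.re, ((1 : ℤˣ) : ℤ) * z.im⟩ : ℂ) = z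
    simp
  mul_smul g g' z := by
    change (⟨((g.1 * g'.1 : ℤˣ) : ℤ) * z.re, ((g.2 * g'.2 : ℤˣ) : ℤ) * z.im⟩ : ℂ) =
      ⟨((g.1 : ℤ) : ℝ) * (((g'.1 : ℤ) : ℝ) * z.re), ((g.2 : ℤ) : ℝ) * (((g'.2 : ℤ) : ℝ) * z.im)⟩
    simp [mul_assoc]

theorem complex_smul_re (g : ℤˣ × ℤˣ) (z : ℂ) : (g • z).re = ((g.1 : ℤ) : ℝ) * z.re := rfl
theorem complex_smul_im (g : ℤˣ × ℤˣ) (z : ℂ) : (g • z).im = ((g.2 : ℤ) : ℝ) * z.im := rfl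

variable [NeZero K]

theorem two_ne_zero : (2 : Grid K) ≠ 0 := by
  intro h
  have h' : ((2 : ℕ) : ZMod (16 * K)) = 0 := by exact_mod_cast h
  rw [ZMod.natCast_eq_zero_iff] at h'
  have := Nat.le_of_dvd (by norm_num) h'
  have := NeZero.pos K
  omega

/-- The embedding of the grid in the unit circle. -/
noncomputable def emb (θ : Grid K) : ℂ :=
  (ZMod.toCircle θ : ℂ)

theorem norm_emb (θ : Grid K) : ‖emb θ‖ = 1 := Circle.norm_coe _

theorem emb_add (θ θ' : Grid K) : emb (θ + θ') = emb θ * emb θ' := by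
  unfold emb
  rw [← Circle.coe_mul, ← AddChar.map_add_eq_mul]

theorem emb_neg (θ : Grid K) : emb (-θ) = (starRingEnd ℂ) (emb θ) := by
  unfold emb
  rw [← Circle.coe_inv_eq_conj, ← AddChar.map_neg_eq_inv]

theorem emb_natCast (n : ℕ) : emb (n : Grid K) = Complex.exp (2 * Real.pi * Complex.I * n / (16 * K)) := by
  have := ZMod.toCircle_intCast (N := 16 * K) (n : ℤ)
  push_cast at this
  rw [← this]
  simp [emb]

theorem emb_half : emb (half K) = -1 := by
  have h : emb (half K) = emb ((8 * K : ℕ) : Grid K) := rfl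
  have hK : (K : ℂ) ≠ 0 := by exact_mod_cast NeZero.ne K
  rw [h, emb_natCast, ← Complex.exp_pi_mul_I]
  congr 1
  push_cast
  field_simp
  ring

theorem emb_smul (g : ℤˣ × ℤˣ) (θ : Grid K) : emb (g • θ) = g • emb θ := by
  have h0 : emb (0 : Grid K) = 1 := by simp [emb]
  obtain ⟨a, b⟩ := g
  rw [smul_def, emb_add]
  apply Complex.ext <;> simp only [complex_smul_re, complex_smul_im] <;>
    rcases Int.units_eq_one_or a with rfl | rfl <;> rcases Int.units_eq_one_or b with rfl | rfl <;>
      simp [h0, emb_half, emb_neg]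

theorem norm_emb_sub_emb_le (p : Grid K × Grid K) (hp : Adj p) :
    ‖emb p.1 - emb p.2‖ ≤ 2 * Real.pi / (16 * K) := by
  have h : ∀ θ : Grid K, ‖emb (θ + 1) - emb θ‖ ≤ 2 * Real.pi / (16 * K) := by
    intro θ
    have h1 : emb (1 : Grid K) = Complex.exp (Complex.I * ((2 * Real.pi / (16 * K) : ℝ) : ℂ)) := by
      have := emb_natCast (K := K) 1
      rw [Nat.cast_one] at this
      rw [this]; congr 1; push_cast; ring
    rw [emb_add, ← mul_sub_one, norm_mul, norm_emb, one_mul, h1]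
    refine (Real.norm_exp_I_mul_ofReal_sub_one_le).trans ?_
    rw [Real.norm_of_nonneg (by positivity)]
  rcases hp with hp | hp
  · rw [hp, norm_sub_rev]; exact h _
  · rw [hp]; exact h _

end Grid
end

section
open Finset

/-- The weights for which the origin is the barycenter of the staircase simplex. -/
noncomputable def stairWeight (D : ℕ) (j : Fin D) : ℝ := (D - (j : ℕ)) / (D + 1)

theorem stairWeight_pos {D : ℕ} (j : Fin D) : 0 < stairWeight D j := by
  have : ((j : ℕ) : ℝ) < D := by exact_mod_cast j.2
  unfold stairWeight
  apply div_pos <;> linarith [Nat.cast_nonneg (α := ℝ) j.1]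

theorem stairWeight_lt_one {D : ℕ} (j : Fin D) : stairWeight D j < 1 := by
  have : ((j : ℕ) : ℝ) < D := by exact_mod_cast j.2
  unfold stairWeight
  rw [div_lt_one] <;> linarith [Nat.cast_nonneg (α := ℝ) j.1]

theorem stairWeight_lt {D : ℕ} {j j' : Fin D} (h : j < j') : stairWeight D j' < stairWeight D j := by
  have : ((j : ℕ) : ℝ) < (j' : ℕ) := by exact_mod_cast h
  unfold stairWeight
  apply div_lt_div_of_pos_right <;> linarith [Nat.cast_nonneg (α := ℝ) D]

/-- The vertices of the staircase simplex. -/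
noncomputable def stair (D : ℕ) (t : Fin (D + 1)) (j : Fin D) : ℝ :=
  (if (j : ℕ) < t then 1 else 0) - stairWeight D j

theorem sum_stair (D : ℕ) (j : Fin D) : ∑ t, stair D t j = 0 := by
  have h : ∑ t : Fin (D + 1), (if (j : ℕ) < t then (1 : ℝ) else 0) = D - (j : ℕ) := by
    rw [Fin.sum_univ_eq_sum_range (fun t => if (j : ℕ) < t then (1 : ℝ) else 0) (D + 1)]
    rw [← Finset.sum_filter, Finset.sum_const, nsmul_eq_mul, mul_one]
    have : (range (D + 1)).filter (fun t => (j : ℕ) < t) = Ioo (j : ℕ) (D + 1) := by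
      ext t; simp; tauto
    rw [this, Nat.card_Ioo]
    have := j.2
    rw [Nat.sub_sub, show D + 1 - ((j : ℕ) + 1) = D - j by omega, Nat.cast_sub this.le]
  simp only [stair]
  rw [Finset.sum_sub_distrib, h]
  simp only [stairWeight, sum_const, card_univ, Fintype.card_fin, nsmul_eq_mul]
  push_cast
  field_simp
  ring

/-- The homogeneous coordinate matrix of `D + 1` points. -/
def homMatrix {D : ℕ} (q : Fin (D + 1) → Fin D → ℝ) : Matrix (Fin (D + 1)) (Fin (D + 1)) ℝ :=
  fun r t => Fin.cases (motive := fun _ => ℝ) 1 (fun j => q t j) r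

theorem det_homMatrix_stair (D : ℕ) : (homMatrix (stair D)).det ≠ 0 := by
  intro h
  obtain ⟨c, hc, h0⟩ := Matrix.exists_mulVec_eq_zero_iff.mpr h
  apply hc
  have hsum : ∑ t, c t = 0 := by
    have := congrFun h0 0
    simpa [Matrix.mulVec, dotProduct, homMatrix] using this
  have htail : ∀ r : Fin (D + 1), ∑ t, (if r ≤ t then c t else 0) = 0 := by
    intro r
    refine Fin.cases ?_ (fun j => ?_) r
    · simpa using hsum
    · have := congrFun h0 j.succ
      simp only [Matrix.mulVec, dotProduct, homMatrix, stair, Fin.cases_succ, sub_mul,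
        Finset.sum_sub_distrib, Pi.zero_apply, ← Finset.mul_sum, hsum, mul_zero, sub_zero] at this
      refine Eq.trans (Finset.sum_congr rfl fun t _ => ?_) this
      have : (j.succ ≤ t) ↔ (j : ℕ) < t := by
        rw [Fin.le_def]; simp
      simp [this]
  have key : ∀ n : ℕ, ∀ r : Fin (D + 1), D + 1 ≤ n + r → c r = 0 := by
    intro n
    induction n with
    | zero => intro r hr; have := r.2; omega
    | succ n ih =>
      intro r hr
      have := htail r
      rw [Finset.sum_eq_single r] at this
      · simpa using this
      · intro t _ htr
        split_ifs with hle
        · apply ih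
          have : (r : ℕ) < t := lt_of_le_of_ne hle (fun hh => htr (Fin.ext hh.symm))
          omega
        · rfl
      · simp
  funext r
  exact key (D + 1) r (by omega)

theorem eventually_exists_pos_combination (D : ℕ) : ∀ᶠ q in nhds (stair D),
    ∃ c : Fin (D + 1) → ℝ, (∀ t, 0 < c t) ∧ ∑ t, c t • q t = 0 := by
  let c : (Fin (D + 1) → Fin D → ℝ) → Fin (D + 1) → ℝ := fun q =>
    (homMatrix q).det • ((homMatrix q).adjugate.mulVec (Pi.single 0 1))
  have hA : Continuous fun q : Fin (D + 1) → Fin D → ℝ => homMatrix q := by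
    refine continuous_matrix fun r t => ?_
    refine Fin.cases ?_ (fun j => ?_) r
    · exact continuous_const
    · change Continuous fun q : Fin (D + 1) → Fin D → ℝ => q t j
      fun_prop
  have hc : Continuous c := hA.matrix_det.smul (hA.matrix_adjugate.matrix_mulVec continuous_const)
  have hpos : ∀ t, 0 < c (stair D) t := by
    have h1 : (homMatrix (stair D)).mulVec 1 = ((D : ℝ) + 1) • Pi.single 0 1 := by
      funext r
      refine Fin.cases ?_ (fun j => ?_) r
      · simp [Matrix.mulVec, dotProduct, homMatrix]
      · simp [Matrix.mulVec, dotProduct, homMatrix, sum_stair]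
    have h2 := congrArg ((homMatrix (stair D)).adjugate.mulVec) h1
    rw [Matrix.mulVec_mulVec, Matrix.adjugate_mul, Matrix.smul_mulVec, Matrix.one_mulVec,
      Matrix.mulVec_smul] at h2
    intro t
    have h3 := congrFun h2 t
    simp only [Pi.smul_apply, Pi.one_apply, smul_eq_mul, mul_one] at h3
    have hD : (0 : ℝ) < D + 1 := by positivity
    have hd := det_homMatrix_stair D
    have h4 : ((D : ℝ) + 1) * c (stair D) t = (homMatrix (stair D)).det ^ 2 := by
      simp only [c, Pi.smul_apply, smul_eq_mul]
      rw [sq, mul_left_comm, ← h3]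
    have : 0 < (homMatrix (stair D)).det ^ 2 := by positivity
    rw [← h4] at this
    exact pos_of_mul_pos_right this hD.le
  have hev : ∀ᶠ q in nhds (stair D), ∀ t, 0 < c q t := by
    rw [Filter.eventually_all]
    intro t
    have : Continuous fun q => c q t := (continuous_apply t).comp hc
    exact this.continuousAt.eventually (lt_mem_nhds (hpos t))
  filter_upwards [hev] with q hq
  refine ⟨c q, hq, ?_⟩
  have h := congrArg (fun v => (homMatrix q).det • v)
    (Matrix.mulVec_mulVec (Pi.single 0 1 : Fin (D + 1) → ℝ) (homMatrix q) (homMatrix q).adjugate)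
  simp only [Matrix.mul_adjugate, Matrix.smul_mulVec, Matrix.one_mulVec] at h
  rw [← Matrix.mulVec_smul] at h
  funext j
  have hj := congrFun h j.succ
  simp only [Matrix.mulVec, dotProduct, homMatrix, Fin.cases_succ] at hj
  simp only [Finset.sum_apply, Pi.smul_apply, smul_eq_mul, Pi.zero_apply]
  simp only [Pi.smul_apply, smul_eq_mul] at hj
  rw [Pi.single_eq_of_ne (Fin.succ_ne_zero j), mul_zero, mul_zero] at hj
  rw [← hj]
  refine Finset.sum_congr rfl fun t _ => ?_
  rw [mul_comm]
  rfl

end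

section
open Finset

/-- A natural action of a group on the `ι`-tuples in sets with two commuting reflections. -/
structure CubeAction (Γ ι : Type) [Group Γ] where
  /-- The action. -/
  act : ∀ {Z : Type} [MulAction (ℤˣ × ℤˣ) Z], Γ → (ι → Z) → ι → Z
  act_one : ∀ {Z : Type} [MulAction (ℤˣ × ℤˣ) Z] (v : ι → Z), act 1 v = v
  act_mul : ∀ {Z : Type} [MulAction (ℤˣ × ℤˣ) Z] (γ γ' : Γ) (v : ι → Z),
    act (γ * γ') v = act γ (act γ' v)
  act_map : ∀ {Z Z' : Type} [MulAction (ℤˣ × ℤˣ) Z] [MulAction (ℤˣ × ℤˣ) Z'] (φ : Z → Z'),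
    (∀ (g : ℤˣ × ℤˣ) z, φ (g • z) = g • φ z) → ∀ (γ : Γ) (v : ι → Z),
      act γ (fun i => φ (v i)) = fun i => φ (act γ v i)

namespace CubeAction
variable {Γ ι : Type} [Group Γ] (a : CubeAction Γ ι)

theorem act_inv_act {Z : Type} [MulAction (ℤˣ × ℤˣ) Z] (γ : Γ) (v : ι → Z) :
    a.act γ⁻¹ (a.act γ v) = v := by
  rw [← a.act_mul, inv_mul_cancel, a.act_one]

theorem act_mem {Z : Type} [MulAction (ℤˣ × ℤˣ) Z] {R : Set Z}
    (hR : ∀ (g : ℤˣ × ℤˣ), ∀ z ∈ R, g • z ∈ R) (γ : Γ) {v : ι → Z} (hv : ∀ i, v i ∈ R) (i : ι) :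
    a.act γ v i ∈ R := by
  let _ : MulAction (ℤˣ × ℤˣ) R :=
    { smul := fun g z => ⟨g • z.1, hR g _ z.2⟩
      one_smul := fun z => Subtype.ext (one_smul _ z.1)
      mul_smul := fun g g' z => Subtype.ext (mul_smul g g' z.1) }
  have h := a.act_map (Subtype.val : R → Z) (fun _ _ => rfl) γ (fun i => ⟨v i, hv i⟩)
  change a.act γ v = _ at h
  rw [h]
  exact Subtype.prop _

theorem act_rel {Z Z' : Type} [MulAction (ℤˣ × ℤˣ) Z] [MulAction (ℤˣ × ℤˣ) Z'] {R : Z → Z' → Prop}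
    (hR : ∀ (g : ℤˣ × ℤˣ) z z', R z z' → R (g • z) (g • z')) (γ : Γ) {v : ι → Z} {w : ι → Z'}
    (h : ∀ i, R (v i) (w i)) (i : ι) : R (a.act γ v i) (a.act γ w i) := by
  have h1 := a.act_mem (R := {p : Z × Z' | R p.1 p.2}) (fun g p hp => hR g _ _ hp) γ
    (v := fun i => (v i, w i)) h i
  have h2 := a.act_map (Prod.fst : Z × Z' → Z) (fun _ _ => rfl) γ (fun i => (v i, w i))
  have h3 := a.act_map (Prod.snd : Z × Z' → Z') (fun _ _ => rfl) γ (fun i => (v i, w i))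
  change a.act γ v = _ at h2
  change a.act γ w = _ at h3
  rw [h2, h3]
  exact h1

end CubeAction

variable {ι Γ : Type} {K : ℕ}

/-- The first vertex of the base edge. -/
def Grid.base (K : ℕ) : Grid K := ((2 * K : ℕ) : ZMod (16 * K))

/-- `e` describes a cube of the grid. -/
def IsCube (e : ι → Grid K × Grid K) : Prop := ∀ i, Grid.Adj (e i)

/-- `v` is a vertex of the cube `e`. -/
def InCube (e : ι → Grid K × Grid K) (v : ι → Grid K) : Prop := ∀ i, v i = (e i).1 ∨ v i = (e i).2

/-- `v` is a vertex of the base cube. -/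
def IsBase (v : ι → Grid K) : Prop := ∀ i, v i = Grid.base K ∨ v i = Grid.base K + 1

/-- The cube of base vertices. -/
def baseCube (ι : Type) (K : ℕ) : ι → Grid K × Grid K := fun _ => (Grid.base K, Grid.base K + 1)

theorem isCube_baseCube : IsCube (baseCube ι K) := fun _ => Or.inl rfl

theorem CubeAction.isCube_act [Group Γ] (a : CubeAction Γ ι) (γ : Γ) {e : ι → Grid K × Grid K}
    (he : IsCube e) : IsCube (a.act γ e) :=
  a.act_mem (R := {p | Grid.Adj p}) (fun g _ hp => Grid.Adj.smul hp g) γ he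

theorem CubeAction.inCube_act [Group Γ] (a : CubeAction Γ ι) (γ : Γ) {e : ι → Grid K × Grid K}
    {v : ι → Grid K} (hv : InCube e v) : InCube (a.act γ e) (a.act γ v) :=
  a.act_rel (R := fun (v : Grid K) (p : Grid K × Grid K) => v = p.1 ∨ v = p.2)
    (fun g _ _ h => h.imp (fun h => by rw [h]; rfl) (fun h => by rw [h]; rfl)) γ hv

/-- A finite group acting freely on a grid torus and linearly on `ℝ^ι`, with an equivariant
map having a single orbit of nondegenerate zeros, located at the base cube. -/
structure Sys where
  /-- The index set of the torus coordinates. -/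
  ι : Type
  /-- The group. -/
  Γ : Type
  [fintypeIndex : Fintype ι]
  [group : Group Γ]
  [fintypeGroup : Fintype Γ]
  /-- The action on the torus. -/
  cube : CubeAction Γ ι
  /-- The action on the target. -/
  rep : Representation ℝ Γ (ι → ℝ)
  free : ∀ (K : ℕ) [NeZero K] (γ : Γ) (e : ι → Grid K × Grid K) (v : ι → Grid K), IsCube e →
    InCube e v → InCube e (cube.act γ v) → γ = 1
  good : ∀ (K : ℕ) [NeZero K] (p : ι → ℝ), (∀ i, 0 < p i ∧ p i < 1) →
    ∃ F : (ι → Grid K) → ι → ℝ, (∀ γ v, F (cube.act γ v) = rep γ (F v)) ∧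
      (∀ v, IsBase v → ∀ i, F v i = (if v i = Grid.base K then 0 else 1) - p i) ∧
      ∀ e, IsCube e → (∃ φ : (ι → ℝ) →ₗ[ℝ] ℝ, ∀ v, InCube e v → 0 < φ (F v)) ∨
        ∃ γ, ∀ v, InCube e v → IsBase (cube.act γ v)

attribute [instance] Sys.fintypeIndex Sys.group Sys.fintypeGroup

namespace Sys
variable (S : Sys)

/-- The action on the grid torus. -/
abbrev gridAction (K : ℕ) : MulAction S.Γ (S.ι → Grid K) where
  smul γ v := S.cube.act γ v
  one_smul := S.cube.act_one
  mul_smul := S.cube.act_mul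

theorem gridLE_act (γ : S.Γ) {u v : S.ι → Grid K} (h : GridLE Grid.par u v) :
    GridLE Grid.par (S.cube.act γ u) (S.cube.act γ v) :=
  S.cube.act_rel (fun g _ _ h => Grid.rootLE_smul g h) γ h

variable [NeZero K]

theorem exists_cube_of_facet {s : Finset (S.ι → Grid K)} (hs : s ∈ gridFacets Grid.par) :
    ∃ e : S.ι → Grid K × Grid K, IsCube e ∧ (∀ u ∈ s, InCube e u) ∧
      ∀ i, Grid.par (e i).1 = 0 := by
  obtain ⟨a, b, ha, hb, h⟩ := exists_cube_of_mem_gridFacets hs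
  refine ⟨fun i => (a i, b i), fun i => ?_, h, ha⟩
  rcases hb i with hb | hb
  · exact Or.inl hb
  · exact Or.inr (by simp [hb])

open Classical in
theorem freeComplex :
    letI := S.gridAction K
    FreeComplex S.Γ (S.ι → Grid K) (Fintype.card S.ι) (gridFacets (Grid.par (K := K))) := by
  let _ := S.gridAction K
  refine ⟨fun s hs => (mem_gridFacets.mp hs).1, fun γ s hs => ?_, fun s hs u hu γ hγ => ?_,
    fun s hs v hv w hw hvw => ?_⟩
  · rw [mem_gridFacets] at hs ⊢
    refine ⟨by rw [card_image_of_injective _ (MulAction.injective γ), hs.1], ?_⟩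
    intro u hu v hv
    obtain ⟨u', hu', rfl⟩ := mem_image.mp hu
    obtain ⟨v', hv', rfl⟩ := mem_image.mp hv
    exact (hs.2 u' hu' v' hv').imp (S.gridLE_act γ) (S.gridLE_act γ)
  · obtain ⟨e, he, h, -⟩ := S.exists_cube_of_facet hs
    exact S.free K γ e u he (h u hu) (h _ hγ)
  · exact even_card_facets Grid.two_ne_zero hs hw (one_lt_card.mpr ⟨v, hv, w, hw, hvw⟩)

end Sys
end

section
open Finset

theorem exists_threshold (D : ℕ) (P : Fin D → Prop) (hP : ∀ i j, i < j → P j → P i) :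
    ∃ t : Fin (D + 1), ∀ j : Fin D, P j ↔ (j : ℕ) < t := by
  classical
  have hex : ∃ n, n = D ∨ ∃ h : n < D, ¬ P ⟨n, h⟩ := ⟨D, Or.inl rfl⟩
  have hle : Nat.find hex ≤ D := Nat.find_le (Or.inl rfl)
  refine ⟨⟨Nat.find hex, by omega⟩, fun j => ⟨fun hj => ?_, fun hj => ?_⟩⟩
  · rw [← not_le]
    intro hcon
    rcases Nat.find_spec hex with h | ⟨h, h'⟩
    · have := j.2
      simp only at hcon
      omega
    · rcases eq_or_lt_of_le hcon with h1 | h1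
      · apply h'
        convert hj
      · exact h' (hP _ j h1 hj)
  · have := Nat.find_min hex hj
    push Not at this
    exact this.2 j.2

variable {K : ℕ}

theorem Grid.par_base : Grid.par (Grid.base K) = 0 := by
  have : par (base K) = ((2 * K : ℕ) : ZMod 2) := map_natCast (par (K := K)) _
  rw [this, ZMod.natCast_eq_zero_iff_even]
  exact ⟨K, by ring⟩

theorem Grid.not_rootLE_base : ¬ RootLE Grid.par (Grid.base K + 1) (Grid.base K) := by
  have h1 : Grid.par (Grid.base K + 1) = 1 := by rw [map_add, par_base, map_one, zero_add]
  rintro (h | ⟨h, -⟩)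
  · rw [h, par_base] at h1
    exact absurd h1 (by decide)
  · rw [h] at h1
    exact absurd h1 (by decide)

theorem Grid.base_add_one_ne : Grid.base K + 1 ≠ Grid.base K := fun h =>
  Grid.not_rootLE_base (Or.inl h)

/-- The vertices of the distinguished facet of the base cube. -/
def stairVertex {ι : Type} {D : ℕ} (K : ℕ) (e : ι ≃ Fin D) (t : Fin (D + 1)) (i : ι) : Grid K :=
  if (e i : ℕ) < t then Grid.base K + 1 else Grid.base K

theorem isBase_stairVertex {ι : Type} {D : ℕ} (e : ι ≃ Fin D) (t : Fin (D + 1)) :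
    IsBase (stairVertex K e t) := fun i => by
  unfold stairVertex
  split_ifs <;> simp

theorem stairVertex_injective {ι : Type} {D : ℕ} (e : ι ≃ Fin D) :
    Function.Injective (stairVertex K e) := by
  have key : ∀ t t' : Fin (D + 1), stairVertex K e t = stairVertex K e t' → ¬ t < t' := by
    intro t t' h hlt
    have hD : (t : ℕ) < D := by have := t'.2; have : (t : ℕ) < t' := hlt; omega
    have := congrFun h (e.symm ⟨t, hD⟩)
    simp only [stairVertex, Equiv.apply_symm_apply, lt_irrefl, if_false] at this
    rw [if_pos (show (t : ℕ) < t' from hlt)] at this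
    exact Grid.base_add_one_ne this.symm
  intro t t' h
  exact le_antisymm (not_lt.mp (key _ _ h.symm)) (not_lt.mp (key _ _ h))

open Classical in
theorem gridLE_stairVertex {ι : Type} {D : ℕ} (e : ι ≃ Fin D) {t t' : Fin (D + 1)} (h : t ≤ t') :
    GridLE Grid.par (stairVertex K e t) (stairVertex K e t') := by
  intro i
  unfold stairVertex
  have : (t : ℕ) ≤ t' := h
  split_ifs with h1 h2 h2
  · left; rfl
  · omega
  · right; exact ⟨Grid.par_base, Or.inl rfl⟩
  · left; rfl

namespace Sys
variable (S : Sys) [NeZero K]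

open Classical in
theorem stair_mem_gridFacets (e : S.ι ≃ Fin (Fintype.card S.ι)) :
    univ.image (stairVertex K e) ∈ gridFacets (Grid.par (K := K)) := by
  rw [mem_gridFacets]
  refine ⟨by rw [card_image_of_injective _ (stairVertex_injective e), card_univ, Fintype.card_fin],
    ?_⟩
  intro u hu v hv
  obtain ⟨t, -, rfl⟩ := mem_image.mp hu
  obtain ⟨t', -, rfl⟩ := mem_image.mp hv
  exact (le_total t t').imp (gridLE_stairVertex e) (gridLE_stairVertex e)

open Classical in
theorem facet_cases (e : S.ι ≃ Fin (Fintype.card S.ι)) {F : (S.ι → Grid K) → S.ι → ℝ}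
    (hF : ∀ γ v, F (S.cube.act γ v) = S.rep γ (F v))
    (hbase : ∀ v, IsBase v → ∀ i,
      F v i = (if v i = Grid.base K then 0 else 1) - stairWeight _ (e i))
    (hcube : ∀ c, IsCube c → (∃ φ : (S.ι → ℝ) →ₗ[ℝ] ℝ, ∀ v, InCube c v → 0 < φ (F v)) ∨
        ∃ γ, ∀ v, InCube c v → IsBase (S.cube.act γ v))
    {s : Finset (S.ι → Grid K)} (hs : s ∈ gridFacets Grid.par) :
    (∃ φ : (S.ι → ℝ) →ₗ[ℝ] ℝ, ∀ v ∈ s, 0 < φ (F v)) ∨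
      ∃ γ, s.image (S.cube.act γ) = univ.image (stairVertex K e) := by
  obtain ⟨c, hc, hin, -⟩ := S.exists_cube_of_facet hs
  rcases hcube c hc with ⟨φ, hφ⟩ | ⟨γ, hγ⟩
  · exact Or.inl ⟨φ, fun v hv => hφ v (hin v hv)⟩
  let _ := S.gridAction K
  have hs' : s.image (S.cube.act γ) ∈ gridFacets (Grid.par (K := K)) :=
    S.freeComplex.image_mem γ s hs
  have hb : ∀ v ∈ s.image (S.cube.act γ), IsBase v := by
    intro v hv
    obtain ⟨u, hu, rfl⟩ := mem_image.mp hv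
    exact hγ u (hin u hu)
  by_cases hdown : ∀ v ∈ s.image (S.cube.act γ), ∀ i j, e i < e j → v j = Grid.base K + 1 →
      v i = Grid.base K + 1
  · right
    refine ⟨γ, eq_of_subset_of_card_le ?_ ?_⟩
    · intro v hv
      obtain ⟨t, ht⟩ := exists_threshold _ (fun j => v (e.symm j) = Grid.base K + 1)
        (fun i j hij h => hdown v hv _ _ (by simpa using hij) h)
      refine mem_image.mpr ⟨t, mem_univ _, ?_⟩
      funext i
      have := ht (e i)
      rw [Equiv.symm_apply_apply] at this
      unfold stairVertex
      rcases hb v hv i with h | h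
      · rw [if_neg, h]
        rw [← this, h]
        exact Grid.base_add_one_ne.symm
      · rw [if_pos (this.mp h), h]
    · rw [(mem_gridFacets.mp hs').1, (mem_gridFacets.mp (S.stair_mem_gridFacets e)).1]
  · left
    push Not at hdown
    obtain ⟨v, hv, i, j, hij, hvj, hvi⟩ := hdown
    have hvi : v i = Grid.base K := (hb v hv i).resolve_right hvi
    refine ⟨((LinearMap.proj j : (S.ι → ℝ) →ₗ[ℝ] ℝ) - LinearMap.proj i) ∘ₗ S.rep γ, fun u hu => ?_⟩
    have hw := mem_image_of_mem (S.cube.act γ) hu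
    rw [LinearMap.comp_apply, ← hF, LinearMap.sub_apply, LinearMap.proj_apply,
      LinearMap.proj_apply, hbase _ (hb _ hw), hbase _ (hb _ hw)]
    generalize S.cube.act γ u = w at hw
    have hst := stairWeight_lt hij
    have h01 : w j = Grid.base K + 1 ∨ w i = Grid.base K := by
      rcases (mem_gridFacets.mp hs').2 v hv w hw with h | h
      · left
        refine (hb w hw j).resolve_left fun hwj => ?_
        have := h j
        rw [hvj, hwj] at this
        exact Grid.not_rootLE_base this
      · right
        refine (hb w hw i).resolve_right fun hwi => ?_
        have := h i
        rw [hvi, hwi] at this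
        exact Grid.not_rootLE_base this
    rcases h01 with h | h
    · rw [if_neg (by rw [h]; exact Grid.base_add_one_ne)]
      split_ifs <;> linarith
    · rw [if_pos h]
      split_ifs <;> linarith

end Sys
end

section
open Finset

variable {K : ℕ}
namespace Sys
variable (S : Sys) [NeZero K]

open Classical in
theorem eventually_zero_structure (e : S.ι ≃ Fin (Fintype.card S.ι))
    {F : (S.ι → Grid K) → S.ι → ℝ}
    (hbase : ∀ v, IsBase v → ∀ i,
      F v i = (if v i = Grid.base K then 0 else 1) - stairWeight _ (e i)) :
    ∀ᶠ F' in nhds F, ZeroIn F' (univ.image (stairVertex K e)) ∧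
      ∀ s : Finset (S.ι → Grid K), (∃ φ : (S.ι → ℝ) →ₗ[ℝ] ℝ, ∀ v ∈ s, 0 < φ (F v)) →
        ¬ ZeroIn F' s := by
  refine Filter.Eventually.and ?_ ?_
  · have hc : Continuous fun (F' : (S.ι → Grid K) → S.ι → ℝ) (t : Fin (Fintype.card S.ι + 1)) j =>
        F' (stairVertex K e t) (e.symm j) := by fun_prop
    have hF : (fun t j => F (stairVertex K e t) (e.symm j)) = stair (Fintype.card S.ι) := by
      funext t j
      rw [hbase _ (isBase_stairVertex e t), stair, stairVertex, Equiv.apply_symm_apply]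
      congr 1
      split_ifs with h1 h2 h2
      · exact absurd h2 Grid.base_add_one_ne
      · rfl
      · rfl
      · simp at h2
    have := hc.continuousAt.eventually (hF ▸ eventually_exists_pos_combination (Fintype.card S.ι))
    filter_upwards [this] with F' ⟨c, hc0, hc⟩
    rw [zeroIn_image_iff (stairVertex_injective e).injOn]
    refine ⟨c, fun t _ => (hc0 t).le, ⟨0, mem_univ _, hc0 0⟩, ?_⟩
    funext i
    have := congrFun hc (e i)
    simp only [Finset.sum_apply, Pi.smul_apply, Equiv.symm_apply_apply] at this ⊢
    exact this
  · rw [Filter.eventually_all]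
    intro s
    by_cases h : ∃ φ : (S.ι → ℝ) →ₗ[ℝ] ℝ, ∀ v ∈ s, 0 < φ (F v)
    · obtain ⟨φ, hφ⟩ := h
      have hφc : Continuous φ := φ.continuous_of_finiteDimensional
      have : ∀ᶠ F' in nhds F, ∀ v ∈ s, 0 < φ (F' v) := by
        rw [Finset.eventually_all]
        intro v hv
        have hc : Continuous fun F' : (S.ι → Grid K) → S.ι → ℝ => φ (F' v) :=
          hφc.comp (continuous_apply v)
        exact hc.continuousAt.eventually (lt_mem_nhds (hφ v hv))
      filter_upwards [this] with F' hF' _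
      exact not_zeroIn_of_pos φ hF'
    · exact Filter.Eventually.of_forall fun _ h' => absurd h' h

theorem no_equivariant_grid_map (G : (S.ι → Grid K) → S.ι → ℝ)
    (hG : ∀ γ v, G (S.cube.act γ v) = S.rep γ (G v)) {η : ℝ} (hη : 0 < η) (hG0 : ∀ v, η ≤ ‖G v‖)
    (hGc : ∀ e, IsCube e → ∀ u v, InCube e u → InCube e v → ‖G u - G v‖ < η / 4) : False := by
  classical
  let e := Fintype.equivFin S.ι
  obtain ⟨F, hF, hbase, hcube⟩ := S.good K (fun i => stairWeight _ (e i))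
    fun i => ⟨stairWeight_pos _, stairWeight_lt_one _⟩
  obtain ⟨ε, hε, hev⟩ := Metric.eventually_nhds_iff.mp (S.eventually_zero_structure e hbase)
  let _ := S.gridAction K
  have hFC := S.freeComplex (K := K)
  have hfree : ∀ (γ : S.Γ) (q : (S.ι → Grid K) ⊕ (S.ι → Grid K)), γ • q = q → γ = 1 := by
    have h1 : ∀ (γ : S.Γ) (v : S.ι → Grid K), γ • v = v → γ = 1 := by
      intro γ v hv
      refine S.free K γ (fun i => (v i, v i + 1)) v (fun i => Or.inl rfl) (fun i => Or.inl rfl) ?_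
      change InCube _ (γ • v)
      rw [hv]
      exact fun i => Or.inl rfl
    rintro γ (q | q) h
    · exact h1 γ q (Sum.inl_injective h)
    · exact h1 γ q (Sum.inr_injective h)
  obtain ⟨H, hH, hHn, hgp⟩ := exists_equivariant_linearIndepOn hfree S.rep (Sum.elim F G)
    (by rintro γ (q | q); exacts [hF γ q, hG γ q]) (lt_min hε (by positivity : 0 < η / 4))
  have hpar := hFC.card_zero_modEq (by simp) S.rep H hH hgp
  obtain ⟨hz0, hz1⟩ := hev (y := fun v => H (.inl v)) (by
    rw [dist_pi_lt_iff hε]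
    intro v
    rw [dist_eq_norm]
    exact (hHn (.inl v)).trans_le (min_le_left _ _))
  have hr : (gridFacets (Grid.par (K := K))).filter
      (fun s : Finset (S.ι → Grid K) => ZeroIn (fun v => H (.inr v)) s) = ∅ := by
    rw [filter_eq_empty_iff]
    intro s hs
    obtain ⟨c, hc, hin, -⟩ := S.exists_cube_of_facet hs
    have hne : s.Nonempty := by rw [← card_pos, (mem_gridFacets.mp hs).1]; omega
    obtain ⟨v₀, hv₀⟩ := hne
    obtain ⟨i, hi⟩ : ∃ i, η ≤ |G v₀ i| := by
      by_contra! hcon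
      exact absurd (hG0 v₀) (not_le.mpr ((pi_norm_lt_iff hη).mpr hcon))
    have hd : ∀ v ∈ s, |H (.inr v) i - G v₀ i| < η / 2 := by
      intro v hv
      have h1 := (norm_le_pi_norm (H (.inr v) - G v) i).trans_lt
        ((hHn (.inr v)).trans_le (min_le_right _ _))
      have h2 := (norm_le_pi_norm (G v - G v₀) i).trans_lt
        (hGc c hc v v₀ (hin v hv) (hin v₀ hv₀))
      rw [Pi.sub_apply, Real.norm_eq_abs, abs_lt] at h1 h2
      rw [abs_lt]
      constructor <;> linarith
    rcases le_or_gt 0 (G v₀ i) with h | h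
    · rw [abs_of_nonneg h] at hi
      refine not_zeroIn_of_pos (LinearMap.proj i : (S.ι → ℝ) →ₗ[ℝ] ℝ) fun v hv => ?_
      have := abs_lt.mp (hd v hv)
      rw [LinearMap.proj_apply]
      linarith
    · rw [abs_of_neg h] at hi
      refine not_zeroIn_of_pos (-(LinearMap.proj i : (S.ι → ℝ) →ₗ[ℝ] ℝ)) fun v hv => ?_
      have := abs_lt.mp (hd v hv)
      rw [LinearMap.neg_apply, LinearMap.proj_apply]
      linarith
  have hst := S.stair_mem_gridFacets (K := K) e
  have hl : (gridFacets (Grid.par (K := K))).filter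
      (fun s : Finset (S.ι → Grid K) => ZeroIn (fun v => H (.inl v)) s) =
        univ.image fun γ : S.Γ => (univ.image (stairVertex K e)).image (γ • ·) := by
    ext s
    rw [mem_filter, mem_image]
    constructor
    · rintro ⟨hs, hzs⟩
      rcases S.facet_cases e hF hbase hcube hs with h | ⟨γ, hγ⟩
      · exact absurd hzs (hz1 s h)
      · refine ⟨γ⁻¹, mem_univ _, ?_⟩
        rw [← hγ, image_image]
        refine Eq.trans (image_congr fun v _ => ?_) image_id
        exact S.cube.act_inv_act γ v
    · rintro ⟨γ, -, rfl⟩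
      exact ⟨hFC.image_mem γ _ hst,
        (zeroIn_smul_iff S.rep (F := fun v => H (.inl v)) (fun γ v => hH γ (.inl v)) γ _).mpr hz0⟩
  rw [hr, hl, card_empty, card_image_of_injective, card_univ] at hpar
  · have h1 := (Nat.modEq_zero_iff_dvd.mp hpar)
    have h2 := Nat.le_of_dvd Fintype.card_pos h1
    have : 0 < Fintype.card S.Γ := Fintype.card_pos
    omega
  · intro γ γ' h
    have h0 := mem_image_of_mem (stairVertex K e) (mem_univ (0 : Fin (Fintype.card S.ι + 1)))
    have h1 := mem_image_of_mem (γ • ·) h0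
    simp only at h
    rw [h] at h1
    obtain ⟨u, hu, hu'⟩ := mem_image.mp h1
    have h2 := hFC.free _ hst _ h0 (γ'⁻¹ * γ) (by
      rw [mul_smul]
      rw [← hu', inv_smul_smul]
      exact hu)
    exact (inv_mul_eq_one.mp h2).symm

end Sys
end

section
open Finset

namespace Sys
variable (S : Sys)

theorem exists_torus_zero (Φ : (S.ι → ℂ) → S.ι → ℝ) (hΦ : Continuous Φ)
    (heq : ∀ γ z, (∀ i, ‖z i‖ = 1) → Φ (S.cube.act γ z) = S.rep γ (Φ z)) :
    ∃ z, (∀ i, ‖z i‖ = 1) ∧ Φ z = 0 := by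
  by_contra! hne
  let T : Set (S.ι → ℂ) := Set.univ.pi fun _ => Metric.sphere 0 1
  have hT : IsCompact T := isCompact_univ_pi fun _ => isCompact_sphere 0 1
  have hmem : ∀ z, z ∈ T ↔ ∀ i, ‖z i‖ = 1 := fun z => by simp [T]
  obtain ⟨z₀, hz₀, hmin⟩ := hT.exists_isMinOn ⟨fun _ => 1, by simp [T]⟩ hΦ.norm.continuousOn
  have hη : 0 < ‖Φ z₀‖ := norm_pos_iff.mpr (hne z₀ ((hmem z₀).mp hz₀))
  have hmin' : ∀ z ∈ T, ‖Φ z₀‖ ≤ ‖Φ z‖ := fun z hz => hmin hz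
  obtain ⟨δ, hδ, hunif⟩ := Metric.uniformContinuousOn_iff.mp
    (hT.uniformContinuousOn_of_continuous hΦ.continuousOn) (‖Φ z₀‖ / 4) (by positivity)
  obtain ⟨K, hK⟩ := exists_nat_gt (2 * Real.pi / δ)
  have hK0 : (0 : ℝ) < K := lt_of_le_of_lt (by positivity) hK
  have : NeZero K := ⟨by rintro rfl; simp at hK0⟩
  have hlt : 2 * Real.pi / (16 * K) < δ := by
    rw [div_lt_iff₀ hδ] at hK
    rw [div_lt_iff₀ (by positivity)]
    nlinarith
  have hemb : ∀ v : S.ι → Grid K, (fun i => Grid.emb (v i)) ∈ T := fun v =>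
    (hmem _).mpr fun i => Grid.norm_emb _
  refine S.no_equivariant_grid_map (K := K) (fun v => Φ fun i => Grid.emb (v i)) ?_ hη
    (fun v => hmin' _ (hemb v)) ?_
  · intro γ v
    rw [← heq γ _ ((hmem _).mp (hemb v)), S.cube.act_map Grid.emb Grid.emb_smul]
  · intro e he u v hu hv
    rw [← dist_eq_norm]
    refine hunif _ (hemb u) _ (hemb v) ?_
    rw [dist_pi_lt_iff hδ]
    intro i
    rw [dist_eq_norm]
    have h := (Grid.norm_emb_sub_emb_le _ (he i)).trans_lt hlt
    rcases hu i with h1 | h1 <;> rcases hv i with h2 | h2 <;> rw [h1, h2]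
    · simpa using hδ
    · exact h
    · rwa [norm_sub_rev]
    · simpa using hδ

end Sys
end

section
open Finset

namespace Sys
variable (S : Sys) {K : ℕ} [NeZero K]

theorem eq_of_isBase_act {γ γ' : S.Γ} {v : S.ι → Grid K} (h : IsBase (S.cube.act γ v))
    (h' : IsBase (S.cube.act γ' v)) : γ = γ' := by
  have : γ' * γ⁻¹ = 1 := by
    refine S.free K (γ' * γ⁻¹) (baseCube S.ι K) (S.cube.act γ v) isCube_baseCube h ?_
    rw [S.cube.act_mul, S.cube.act_inv_act]
    exact h'
  exact (mul_inv_eq_one.mp this).symm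

open Classical in
/-- The group element moving a grid point to the base cube. -/
noncomputable def loc (v : S.ι → Grid K) : Option S.Γ :=
  if h : ∃ γ, IsBase (S.cube.act γ v) then some h.choose else none

theorem loc_eq_some {v : S.ι → Grid K} {γ : S.Γ} : S.loc v = some γ ↔ IsBase (S.cube.act γ v) := by
  unfold loc
  split_ifs with h
  · rw [Option.some_inj]
    exact ⟨fun h' => h' ▸ h.choose_spec, fun h' => S.eq_of_isBase_act h.choose_spec h'⟩
  · refine iff_of_false nofun ?_
    exact fun h' => h ⟨γ, h'⟩

theorem loc_act (g : S.Γ) (v : S.ι → Grid K) :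
    S.loc (S.cube.act g v) = (S.loc v).map (· * g⁻¹) := by
  cases h : S.loc v with
  | some γ =>
    rw [Option.map_some, loc_eq_some, S.cube.act_mul, S.cube.act_inv_act]
    exact S.loc_eq_some.mp h
  | none =>
    rw [Option.map_none, Option.eq_none_iff_forall_ne_some]
    intro γ hγ
    rw [loc_eq_some, ← S.cube.act_mul, ← loc_eq_some, h] at hγ
    cases hγ

end Sys

/-- The action of a semidirect product on a sum of coordinates. -/
def CubeAction.semi {Γ N ι κ : Type} [Group Γ] [Group N] (b : CubeAction Γ ι) (u : CubeAction N κ)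
    (φ : Γ →* MulAut N) (α : CubeAction Γ κ)
    (h : ∀ {Z : Type} [MulAction (ℤˣ × ℤˣ) Z] (g : Γ) (n : N) (v : κ → Z),
      α.act g (u.act n v) = u.act (φ g n) (α.act g v)) : CubeAction (N ⋊[φ] Γ) (ι ⊕ κ) where
  act γ v := Sum.elim (b.act γ.right fun i => v (.inl i))
    (u.act γ.left (α.act γ.right fun i => v (.inr i)))
  act_one v := by
    simp only [SemidirectProduct.one_right, SemidirectProduct.one_left, b.act_one, u.act_one,
      α.act_one]
    exact Sum.elim_comp_inl_inr v
  act_mul γ γ' v := by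
    simp only [SemidirectProduct.mul_right, SemidirectProduct.mul_left, b.act_mul, u.act_mul,
      α.act_mul, h, Sum.elim_inl, Sum.elim_inr]
  act_map f hf γ v := by
    funext i
    rcases i with i | i
    · simp only [Sum.elim_inl]
      rw [b.act_map f hf γ.right fun i => v (.inl i)]
    · simp only [Sum.elim_inr]
      rw [α.act_map f hf γ.right fun i => v (.inr i), u.act_map f hf]

/-- The splitting of functions on a sum type. -/
def sumSplit (ι κ : Type) : (ι ⊕ κ → ℝ) ≃ₗ[ℝ] (ι → ℝ) × (κ → ℝ) :=
  LinearEquiv.sumArrowLequivProdArrow ι κ ℝ ℝ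

/-- The representation of a semidirect product on a sum of coordinates. -/
def Representation.semi {Γ N ι κ : Type} [Group Γ] [Group N] (b : Representation ℝ Γ (ι → ℝ))
    (u : Representation ℝ N (κ → ℝ)) (φ : Γ →* MulAut N) (β : Representation ℝ Γ (κ → ℝ))
    (h : ∀ g n w, β g (u n w) = u (φ g n) (β g w)) :
    Representation ℝ (N ⋊[φ] Γ) (ι ⊕ κ → ℝ) where
  toFun γ := (sumSplit ι κ).symm ∘ₗ ((b γ.right).prodMap (u γ.left ∘ₗ β γ.right)) ∘ₗ sumSplit ι κ
  map_one' := by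
    ext w i
    simp
  map_mul' γ γ' := by
    apply LinearMap.ext
    intro w
    simp [h]

theorem Representation.semi_apply {Γ N ι κ : Type} [Group Γ] [Group N]
    (b : Representation ℝ Γ (ι → ℝ))
    (u : Representation ℝ N (κ → ℝ)) (φ : Γ →* MulAut N) (β : Representation ℝ Γ (κ → ℝ))
    (h : ∀ g n w, β g (u n w) = u (φ g n) (β g w)) (γ : N ⋊[φ] Γ) (x : ι → ℝ) (y : κ → ℝ) :
    b.semi u φ β h γ (Sum.elim x y) = Sum.elim (b γ.right x) (u γ.left (β γ.right y)) := rfl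

namespace Sys

/-- A fibered product of two systems. -/
noncomputable def fib (B U : Sys) (φ : B.Γ →* MulAut U.Γ) (α : CubeAction B.Γ U.ι)
    (β : Representation ℝ B.Γ (U.ι → ℝ))
    (hα : ∀ {Z : Type} [MulAction (ℤˣ × ℤˣ) Z] (g : B.Γ) (n : U.Γ) (v : U.ι → Z),
      α.act g (U.cube.act n v) = U.cube.act (φ g n) (α.act g v))
    (hβ : ∀ g n w, β g (U.rep n w) = U.rep (φ g n) (β g w)) : Sys where
  ι := B.ι ⊕ U.ι
  Γ := U.Γ ⋊[φ] B.Γ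
  fintypeGroup := Fintype.ofEquiv _ SemidirectProduct.equivProd.symm
  cube := B.cube.semi U.cube φ α hα
  rep := B.rep.semi U.rep φ β hβ
  free K _ γ e v he hv hγ := by
    have h1 : γ.right = 1 := B.free K _ (fun i => e (.inl i)) (fun i => v (.inl i))
      (fun i => he _) (fun i => hv _) (fun i => hγ (.inl i))
    have h2 : γ.left = 1 := by
      refine U.free K _ (fun i => e (.inr i)) (fun i => v (.inr i))
        (fun i => he _) (fun i => hv _) (fun i => ?_)
      have := hγ (.inr i)
      simp only [CubeAction.semi, Sum.elim_inr, h1, α.act_one] at this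
      exact this
    exact SemidirectProduct.ext h2 h1
  good K _ p hp := by
    obtain ⟨F, hF, hFb, hFc⟩ := B.good K (fun i => p (.inl i)) (fun i => hp _)
    obtain ⟨G, hG, hGb, hGc⟩ := U.good K (fun i => p (.inr i)) (fun i => hp _)
    let H : (B.ι ⊕ U.ι → Grid K) → U.ι → ℝ := fun v =>
      ((B.loc fun i => v (.inl i)).map fun g => β g⁻¹ (G (α.act g fun i => v (.inr i)))).getD 0
    have hH : ∀ v g, (IsBase (B.cube.act g fun i => v (.inl i))) →
        H v = β g⁻¹ (G (α.act g fun i => v (.inr i))) := by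
      intro v g hg
      simp only [H, B.loc_eq_some.mpr hg, Option.map_some, Option.getD_some]
    refine ⟨fun v => Sum.elim (F fun i => v (.inl i)) (H v), ?_, ?_, ?_⟩
    · intro γ v
      rw [Representation.semi_apply]
      refine congrArg₂ Sum.elim (hF γ.right _) ?_
      simp only [H, CubeAction.semi, Sum.elim_inl, Sum.elim_inr, B.loc_act]
      cases B.loc (fun i => v (.inl i)) with
      | none => simp
      | some g =>
        simp only [Option.map_some, Option.getD_some, α.act_mul, hα, α.act_inv_act, mul_inv_rev,
          inv_inv, map_mul, hβ, hG, Module.End.mul_apply, map_inv,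
          MulAut.inv_apply_self]
    · intro v hv i
      rcases i with i | i
      · exact hFb _ (fun i => hv _) i
      · simp only [Sum.elim_inr]
        rw [hH v 1 (by rw [B.cube.act_one]; exact fun i => hv _), inv_one, map_one,
          Module.End.one_apply, α.act_one]
        exact hGb _ (fun i => hv _) i
    · intro e he
      rcases hFc (fun i => e (.inl i)) (fun i => he _) with ⟨f, hf⟩ | ⟨g, hg⟩
      · left
        refine ⟨f ∘ₗ LinearMap.fst ℝ _ _ ∘ₗ (sumSplit B.ι U.ι).toLinearMap, fun v hv => ?_⟩
        exact hf (fun i => v (.inl i)) (fun i => hv _)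
      · rcases hGc (α.act g fun i => e (.inr i)) (α.isCube_act g fun i => he _) with
          ⟨f, hf⟩ | ⟨n, hn⟩
        · left
          refine ⟨f ∘ₗ β g ∘ₗ LinearMap.snd ℝ _ _ ∘ₗ (sumSplit B.ι U.ι).toLinearMap,
            fun v hv => ?_⟩
          change 0 < f (β g (H v))
          rw [hH v g (hg _ fun i => hv _), ← Module.End.mul_apply, ← map_mul, mul_inv_cancel,
            map_one]
          exact hf _ (α.inCube_act g fun i => hv _)
        · right
          refine ⟨⟨n, g⟩, fun v hv i => ?_⟩
          rcases i with i | i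
          · exact hg (fun i => v (.inl i)) (fun i => hv _) i
          · exact hn _ (α.inCube_act g (v := fun i => v (.inr i)) fun i => hv _) i

end Sys
end

section
open Finset

/-- The homomorphism from the units of `ℤ` given by an involution. -/
def unitsHom {M : Type*} [Monoid M] (f : M) (hf : f * f = 1) : ℤˣ →* M where
  toFun ε := if ε = 1 then 1 else f
  map_one' := if_pos rfl
  map_mul' a b := by
    rcases Int.units_eq_one_or a with rfl | rfl <;> rcases Int.units_eq_one_or b with rfl | rfl <;>
      simp [hf]

theorem unitsHom_neg_one {M : Type*} [Monoid M] (f : M) (hf : f * f = 1) :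
    unitsHom f hf (-1) = f :=
  if_neg (c := (-1 : ℤˣ) = 1) (t := 1) (by decide)

/-- The trivial action. -/
def CubeAction.trivial (Γ ι : Type) [Group Γ] : CubeAction Γ ι where
  act _ v := v
  act_one _ := rfl
  act_mul _ _ _ := rfl
  act_map _ _ _ _ := rfl

/-- The action exchanging two copies of the coordinates. -/
def CubeAction.exchange {Γ : Type} [Group Γ] (χ : Γ →* ℤˣ) (ι : Type) : CubeAction Γ (ι ⊕ ι) where
  act γ v := if χ γ = 1 then v else fun i => v i.swap
  act_one v := by simp
  act_mul γ γ' v := by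
    rw [map_mul]
    rcases Int.units_eq_one_or (χ γ) with h | h <;> rcases Int.units_eq_one_or (χ γ') with h' | h' <;>
      rw [h, h'] <;> simp
  act_map f _ γ v := by split_ifs <;> rfl

namespace Sys

/-- The system with no coordinates. -/
def point : Sys where
  ι := Empty
  Γ := Unit
  cube := CubeAction.trivial _ _
  rep := 1
  free _ _ _ _ _ _ _ _ := rfl
  good _ _ _ _ := ⟨fun _ => 0, fun _ _ => by simp, fun _ _ i => i.elim,
    fun _ _ => Or.inr ⟨1, fun _ _ i => i.elim⟩⟩

/-- The product of two copies of a system. -/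
noncomputable def pair (S : Sys) : Sys :=
  fib S S 1 (CubeAction.trivial _ _) 1 (fun _ _ _ => rfl) (fun _ _ _ => rfl)

/-- The exchange automorphism of the group of `S.pair`. -/
noncomputable def exchangeAut (S : Sys) : MulAut S.pair.Γ where
  toFun γ := (⟨SemidirectProduct.right γ, SemidirectProduct.left γ⟩ :
    S.Γ ⋊[(1 : S.Γ →* MulAut S.Γ)] S.Γ)
  invFun γ := (⟨SemidirectProduct.right γ, SemidirectProduct.left γ⟩ :
    S.Γ ⋊[(1 : S.Γ →* MulAut S.Γ)] S.Γ)
  left_inv _ := rfl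
  right_inv _ := rfl
  map_mul' _ _ := rfl

theorem exchangeAut_mul_self (S : Sys) : S.exchangeAut * S.exchangeAut = 1 := rfl

/-- The exchange of the two halves of a vector. -/
noncomputable def exchangeLin (S : Sys) : Module.End ℝ (S.pair.ι → ℝ) :=
  LinearMap.funLeft ℝ ℝ (Sum.swap : S.ι ⊕ S.ι → S.ι ⊕ S.ι)

theorem exchangeLin_mul_self (S : Sys) : S.exchangeLin * S.exchangeLin = 1 := by
  apply LinearMap.ext
  intro w
  funext i
  rcases i with i | i <;> rfl

section
variable {Γ : Type} [Group Γ] (χ : Γ →* ℤˣ) (S : Sys)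

/-- The exchange action on the group of `S.pair`. -/
noncomputable def twAut : Γ →* MulAut S.pair.Γ :=
  (unitsHom S.exchangeAut S.exchangeAut_mul_self).comp χ

/-- The exchange action on the coordinates of `S.pair`. -/
noncomputable def twCube : CubeAction Γ S.pair.ι := CubeAction.exchange χ S.ι

/-- The exchange action on the target of `S.pair`. -/
noncomputable def twRep : Representation ℝ Γ (S.pair.ι → ℝ) :=
  (unitsHom S.exchangeLin S.exchangeLin_mul_self).comp χ

variable {χ} {g : Γ}

theorem twAut_of_one (h : χ g = 1) : S.twAut χ g = 1 := by
  unfold twAut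
  rw [MonoidHom.comp_apply, h, map_one]

theorem twAut_of_neg (h : χ g = -1) : S.twAut χ g = S.exchangeAut := by
  unfold twAut
  rw [MonoidHom.comp_apply, h, unitsHom_neg_one]

theorem twRep_of_one (h : χ g = 1) : S.twRep χ g = 1 := by
  change unitsHom S.exchangeLin S.exchangeLin_mul_self (χ g) = _
  rw [h, map_one]

theorem twRep_of_neg (h : χ g = -1) : S.twRep χ g = S.exchangeLin := by
  change unitsHom S.exchangeLin S.exchangeLin_mul_self (χ g) = _
  rw [h, unitsHom_neg_one]

theorem twCube_of_one (h : χ g = 1) {Z : Type} [MulAction (ℤˣ × ℤˣ) Z] (v : S.pair.ι → Z) :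
    (S.twCube χ).act g v = v := if_pos h

theorem twCube_of_neg (h : χ g = -1) {Z : Type} [MulAction (ℤˣ × ℤˣ) Z] (y z : S.ι → Z) :
    (S.twCube χ).act g (Sum.elim y z : S.ι ⊕ S.ι → Z) = (Sum.elim z y : S.ι ⊕ S.ι → Z) := by
  refine (if_neg (by rw [h]; decide)).trans ?_
  funext i
  rcases i with i | i <;> rfl

end

/-- The twisted square of `S` over `X`. -/
noncomputable def twistedSquare (X : Sys) (χ : X.Γ →* ℤˣ) (S : Sys) : Sys :=
  fib X S.pair (S.twAut χ) (S.twCube χ) (S.twRep χ)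
    (fun g n v => by
      rcases Int.units_eq_one_or (χ g) with h | h
      · rw [S.twCube_of_one h, S.twCube_of_one h, S.twAut_of_one h, MulAut.one_apply]
      · rw [S.twAut_of_neg h]
        have hv : v = (Sum.elim (fun i => v (.inl i)) (fun i => v (.inr i)) : S.ι ⊕ S.ι → _) :=
          (Sum.elim_comp_inl_inr v).symm
        rw [hv, S.twCube_of_neg h]
        exact S.twCube_of_neg h _ _)
    (fun g n w => by
      rcases Int.units_eq_one_or (χ g) with h | h
      · rw [S.twRep_of_one h, S.twAut_of_one h]
        rfl
      · rw [S.twRep_of_neg h, S.twAut_of_neg h]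
        funext i
        rcases i with i | i <;> rfl)

section
variable (X : Sys) (χ : X.Γ →* ℤˣ) (S : Sys) (γ : (twistedSquare X χ S).Γ)

/-- The component of a group element in the base group. -/
def twBase : X.Γ := SemidirectProduct.right γ
/-- The component of a group element in the first copy of the fiber group. -/
def twFst : S.Γ := SemidirectProduct.right (SemidirectProduct.left γ)
/-- The component of a group element in the second copy of the fiber group. -/
def twSnd : S.Γ := SemidirectProduct.left (SemidirectProduct.left γ)

theorem twistedSquare_act_one (h : χ (X.twBase χ S γ) = 1) {Z : Type} [MulAction (ℤˣ × ℤˣ) Z]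
    (x : X.ι → Z) (y z : S.ι → Z) :
    (twistedSquare X χ S).cube.act γ (Sum.elim x (Sum.elim y z)) =
      Sum.elim (X.cube.act (X.twBase χ S γ) x)
        (Sum.elim (S.cube.act (X.twFst χ S γ) y) (S.cube.act (X.twSnd χ S γ) z)) :=
  congrArg (fun w => Sum.elim (X.cube.act (X.twBase χ S γ) x)
    (S.pair.cube.act (SemidirectProduct.left γ) w)) (S.twCube_of_one h (Sum.elim y z))

theorem twistedSquare_act_neg (h : χ (X.twBase χ S γ) = -1) {Z : Type} [MulAction (ℤˣ × ℤˣ) Z]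
    (x : X.ι → Z) (y z : S.ι → Z) :
    (twistedSquare X χ S).cube.act γ (Sum.elim x (Sum.elim y z)) =
      Sum.elim (X.cube.act (X.twBase χ S γ) x)
        (Sum.elim (S.cube.act (X.twFst χ S γ) z) (S.cube.act (X.twSnd χ S γ) y)) :=
  congrArg (fun w => Sum.elim (X.cube.act (X.twBase χ S γ) x)
    (S.pair.cube.act (SemidirectProduct.left γ) w)) (S.twCube_of_neg h y z)

theorem twistedSquare_rep_one (h : χ (X.twBase χ S γ) = 1)
    (x : X.ι → ℝ) (y z : S.ι → ℝ) :
    (twistedSquare X χ S).rep γ (Sum.elim x (Sum.elim y z)) =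
      Sum.elim (X.rep (X.twBase χ S γ) x)
        (Sum.elim (S.rep (X.twFst χ S γ) y) (S.rep (X.twSnd χ S γ) z)) :=
  congrArg (fun L : Module.End ℝ (S.pair.ι → ℝ) => (Sum.elim (X.rep (X.twBase χ S γ) x)
    (S.pair.rep (SemidirectProduct.left γ) (L (Sum.elim y z))) : X.ι ⊕ S.pair.ι → ℝ))
    (S.twRep_of_one h)

theorem twistedSquare_rep_neg (h : χ (X.twBase χ S γ) = -1)
    (x : X.ι → ℝ) (y z : S.ι → ℝ) :
    (twistedSquare X χ S).rep γ (Sum.elim x (Sum.elim y z)) =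
      Sum.elim (X.rep (X.twBase χ S γ) x)
        (Sum.elim (S.rep (X.twFst χ S γ) z) (S.rep (X.twSnd χ S γ) y)) :=
  (congrArg (fun L : Module.End ℝ (S.pair.ι → ℝ) => (Sum.elim (X.rep (X.twBase χ S γ) x)
    (S.pair.rep (SemidirectProduct.left γ) (L (Sum.elim y z))) : X.ι ⊕ S.pair.ι → ℝ))
    (S.twRep_of_neg h)).trans (by
      funext i
      rcases i with i | i | i <;> rfl)

end
end Sys
end

section
open Finset

namespace Grid
variable {K : ℕ} [NeZero K]

/-- The sign of the real part of a grid point. -/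
noncomputable def reSign (θ : Grid K) : ℝ := Real.sign (emb θ).re

/-- The sign of the imaginary part of a grid point. -/
noncomputable def imSign (θ : Grid K) : ℝ := Real.sign (emb θ).im

/-- The grid point is closer to the imaginary axis than to the real axis. -/
def Far (θ : Grid K) : Prop := |(emb θ).re| < |(emb θ).im|

theorem sign_units_mul (a : ℤˣ) (x : ℝ) : Real.sign (((a : ℤ) : ℝ) * x) = ((a : ℤ) : ℝ) * Real.sign x := by
  rcases Int.units_eq_one_or a with rfl | rfl <;> simp [Real.sign_neg]

theorem reSign_smul (g : ℤˣ × ℤˣ) (θ : Grid K) : reSign (g • θ) = ((g.1 : ℤ) : ℝ) * reSign θ := by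
  rw [reSign, emb_smul, complex_smul_re, sign_units_mul, reSign]

theorem imSign_smul (g : ℤˣ × ℤˣ) (θ : Grid K) : imSign (g • θ) = ((g.2 : ℤ) : ℝ) * imSign θ := by
  rw [imSign, emb_smul, complex_smul_im, sign_units_mul, imSign]

theorem abs_units_mul (a : ℤˣ) (x : ℝ) : |((a : ℤ) : ℝ) * x| = |x| := by
  rcases Int.units_eq_one_or a with rfl | rfl <;> simp

theorem far_smul (g : ℤˣ × ℤˣ) (θ : Grid K) : Far (g • θ) ↔ Far θ := by
  rw [Far, emb_smul, complex_smul_re, complex_smul_im, abs_units_mul, abs_units_mul, Far]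

theorem abs_sign_le (x : ℝ) : |Real.sign x| ≤ 1 := by
  rcases Real.sign_apply_eq x with h | h | h <;> rw [h] <;> simp

theorem re_sq_add_im_sq (θ : Grid K) : (emb θ).re ^ 2 + (emb θ).im ^ 2 = 1 := by
  have h := norm_emb θ
  have h2 := Complex.sq_norm (emb θ)
  rw [h, Complex.normSq_apply] at h2
  linarith

theorem Adj.norm_sub_lt {p : Grid K × Grid K} (hp : Adj p) : ‖emb p.1 - emb p.2‖ < 2 / 5 := by
  refine (norm_emb_sub_emb_le p hp).trans_lt ?_
  have hK : (1 : ℝ) ≤ K := by exact_mod_cast NeZero.pos K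
  rw [div_lt_iff₀ (by positivity)]
  have := Real.pi_lt_d2
  nlinarith

theorem sign_const {x y : ℝ} (hx : 1 / 2 ≤ x ^ 2) (hxy : |x - y| < 2 / 5) :
    ∃ c : ℤˣ, Real.sign x = ((c : ℤ) : ℝ) ∧ Real.sign y = ((c : ℤ) : ℝ) := by
  rw [abs_lt] at hxy
  rcases le_or_gt 0 x with h | h
  · have : 1 / 2 < x := by nlinarith
    exact ⟨1, by rw [Real.sign_of_pos (by linarith)]; simp,
      by rw [Real.sign_of_pos (by linarith)]; simp⟩
  · have : x < - (1 / 2) := by nlinarith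
    exact ⟨-1, by rw [Real.sign_of_neg (by linarith)]; simp,
      by rw [Real.sign_of_neg (by linarith)]; simp⟩

theorem Far.sq_le {θ : Grid K} (h : Far θ) : 1 / 2 ≤ (emb θ).im ^ 2 := by
  have := sq_lt_sq.mpr h
  have := re_sq_add_im_sq θ
  linarith

theorem sq_le_of_not_far {θ : Grid K} (h : ¬ Far θ) : 1 / 2 ≤ (emb θ).re ^ 2 := by
  have := sq_le_sq.mpr (not_lt.mp h)
  have := re_sq_add_im_sq θ
  linarith

theorem Adj.reSign_const {p : Grid K × Grid K} (hp : Adj p) (h : ¬ Far p.1 ∨ ¬ Far p.2) :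
    ∃ c : ℤˣ, reSign p.1 = ((c : ℤ) : ℝ) ∧ reSign p.2 = ((c : ℤ) : ℝ) := by
  have h1 := (Complex.abs_re_le_norm (emb p.1 - emb p.2)).trans_lt hp.norm_sub_lt
  rw [Complex.sub_re] at h1
  rcases h with h | h
  · exact sign_const (sq_le_of_not_far h) h1
  · rw [abs_sub_comm] at h1
    obtain ⟨c, hc⟩ := sign_const (sq_le_of_not_far h) h1
    exact ⟨c, hc.symm⟩

theorem Adj.imSign_const {p : Grid K × Grid K} (hp : Adj p) (h : Far p.1 ∨ Far p.2) :
    ∃ c : ℤˣ, imSign p.1 = ((c : ℤ) : ℝ) ∧ imSign p.2 = ((c : ℤ) : ℝ) := by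
  have h1 := (Complex.abs_im_le_norm (emb p.1 - emb p.2)).trans_lt hp.norm_sub_lt
  rw [Complex.sub_im] at h1
  rcases h with h | h
  · exact sign_const h.sq_le h1
  · rw [abs_sub_comm] at h1
    obtain ⟨c, hc⟩ := sign_const h.sq_le h1
    exact ⟨c, hc.symm⟩

theorem emb_eq (n : ℕ) : emb (n : Grid K) =
    ⟨Real.cos (Real.pi * n / (8 * K)), Real.sin (Real.pi * n / (8 * K))⟩ := by
  rw [emb_natCast]
  have : (2 * Real.pi * Complex.I * n / (16 * K) : ℂ) =
      ((Real.pi * n / (8 * K) : ℝ) : ℂ) * Complex.I := by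
    push_cast
    have hK : (K : ℂ) ≠ 0 := by exact_mod_cast NeZero.ne K
    field_simp
    ring
  rw [this]
  apply Complex.ext
  · exact Complex.exp_ofReal_mul_I_re _
  · exact Complex.exp_ofReal_mul_I_im _

theorem angle_le {n : ℕ} {a : ℝ} (h : (n : ℝ) ≤ 8 * K * a) :
    Real.pi * n / (8 * K) ≤ Real.pi * a := by
  have hK : (0 : ℝ) < K := by exact_mod_cast NeZero.pos K
  rw [div_le_iff₀ (by positivity)]
  nlinarith [Real.pi_pos]

theorem le_angle {n : ℕ} {a : ℝ} (h : 8 * K * a ≤ (n : ℝ)) :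
    Real.pi * a ≤ Real.pi * n / (8 * K) := by
  have hK : (0 : ℝ) < K := by exact_mod_cast NeZero.pos K
  rw [le_div_iff₀ (by positivity)]
  nlinarith [Real.pi_pos]

theorem lt_angle {n : ℕ} {a : ℝ} (h : 8 * K * a < (n : ℝ)) :
    Real.pi * a < Real.pi * n / (8 * K) := by
  have hK : (0 : ℝ) < K := by exact_mod_cast NeZero.pos K
  rw [lt_div_iff₀ (by positivity)]
  nlinarith [Real.pi_pos]

theorem angle_lt {n : ℕ} {a : ℝ} (h : (n : ℝ) < 8 * K * a) :
    Real.pi * n / (8 * K) < Real.pi * a := by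
  have hK : (0 : ℝ) < K := by exact_mod_cast NeZero.pos K
  rw [div_lt_iff₀ (by positivity)]
  nlinarith [Real.pi_pos]

theorem lt_of_pos {n : ℕ} (hn : n < 16 * K) (hre : 0 < (emb (n : Grid K)).re)
    (him : 0 < (emb (n : Grid K)).im) : n < 4 * K := by
  rw [emb_eq] at hre him
  simp only at hre him
  have hpi := Real.pi_pos
  have h8 : n < 8 * K := by
    by_contra! hcon
    have h1 : Real.pi * 1 ≤ Real.pi * n / (8 * K) := le_angle (by
      have : ((8 * K : ℕ) : ℝ) ≤ n := by exact_mod_cast hcon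
      push_cast at this; linarith)
    have h2 : Real.pi * n / (8 * K) ≤ Real.pi * 2 := angle_le (by
      have : (n : ℝ) ≤ ((16 * K : ℕ) : ℝ) := by exact_mod_cast hn.le
      push_cast at this; linarith)
    have h3 := Real.sin_nonneg_of_nonneg_of_le_pi (x := Real.pi * n / (8 * K) - Real.pi)
      (by linarith) (by linarith)
    rw [Real.sin_sub_pi] at h3
    linarith
  by_contra! hcon
  have h1 : Real.pi * (1 / 2) ≤ Real.pi * n / (8 * K) := le_angle (by
    have : ((4 * K : ℕ) : ℝ) ≤ n := by exact_mod_cast hcon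
    push_cast at this; linarith)
  have h2 : Real.pi * n / (8 * K) ≤ Real.pi * 1 := angle_le (by
    have : (n : ℝ) ≤ ((8 * K : ℕ) : ℝ) := by exact_mod_cast h8.le
    push_cast at this; linarith)
  have h3 := Real.cos_nonpos_of_pi_div_two_le_of_le (x := Real.pi * n / (8 * K))
    (by linarith) (by linarith)
  linarith

theorem re_pos_im_pos {n : ℕ} (hn0 : 0 < n) (hn : n < 4 * K) : 0 < (emb (n : Grid K)).re ∧
    0 < (emb (n : Grid K)).im := by
  have hpi := Real.pi_pos
  have h1 : Real.pi * 0 < Real.pi * n / (8 * K) := lt_angle (by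
    have : (0 : ℝ) < n := by exact_mod_cast hn0
    linarith)
  have h2 : Real.pi * n / (8 * K) < Real.pi * (1 / 2) := angle_lt (by
    have : (n : ℝ) < ((4 * K : ℕ) : ℝ) := by exact_mod_cast hn
    push_cast at this; linarith)
  rw [emb_eq]
  exact ⟨Real.cos_pos_of_mem_Ioo ⟨by linarith, by linarith⟩,
    Real.sin_pos_of_pos_of_lt_pi (by linarith) (by linarith)⟩

theorem far_iff {n : ℕ} (hn0 : 0 < n) (hn : n < 4 * K) : Far (n : Grid K) ↔ 2 * K < n := by
  have hpi := Real.pi_pos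
  obtain ⟨h1, h2⟩ := re_pos_im_pos hn0 hn
  rw [Far, abs_of_pos h1, abs_of_pos h2, emb_eq]
  simp only
  rw [← Real.sin_pi_div_two_sub]
  have h1 : Real.pi * 0 < Real.pi * n / (8 * K) := lt_angle (by
    have : (0 : ℝ) < n := by exact_mod_cast hn0
    linarith)
  have h2 : Real.pi * n / (8 * K) < Real.pi * (1 / 2) := angle_lt (by
    have : (n : ℝ) < ((4 * K : ℕ) : ℝ) := by exact_mod_cast hn
    push_cast at this; linarith)
  rw [Real.strictMonoOn_sin.lt_iff_lt ⟨by linarith, by linarith⟩ ⟨by linarith, by linarith⟩]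
  constructor
  · intro h
    by_contra! hcon
    have h3 : Real.pi * n / (8 * K) ≤ Real.pi * (1 / 4) := angle_le (by
      have : (n : ℝ) ≤ ((2 * K : ℕ) : ℝ) := by exact_mod_cast hcon
      push_cast at this; linarith)
    linarith
  · intro h
    have h3 : Real.pi * (1 / 4) < Real.pi * n / (8 * K) := lt_angle (by
      have : ((2 * K : ℕ) : ℝ) < n := by exact_mod_cast h
      push_cast at this; linarith)
    linarith

theorem eq_base_of_far {θ : Grid K} (h1 : reSign θ = 1) (h2 : imSign θ = 1)
    (h1' : reSign (θ + 1) = 1) (h2' : imSign (θ + 1) = 1) (hf : Far θ ↔ ¬ Far (θ + 1)) :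
    θ = base K := by
  have hpos : ∀ x, Real.sign x = 1 → 0 < x := by
    intro x hx
    rcases lt_trichotomy x 0 with h | h | h
    · rw [Real.sign_of_neg h] at hx; norm_num at hx
    · rw [h, Real.sign_zero] at hx; norm_num at hx
    · exact h
  have hθ : ((θ.val : ℕ) : Grid K) = θ := ZMod.natCast_zmod_val θ
  have hθ' : ((θ.val + 1 : ℕ) : Grid K) = θ + 1 := by rw [Nat.cast_add, hθ, Nat.cast_one]
  have hK := NeZero.pos K
  have hlt := lt_of_pos (K := K) (ZMod.val_lt θ) (by rw [hθ]; exact hpos _ h1)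
    (by rw [hθ]; exact hpos _ h2)
  have hlt' := lt_of_pos (K := K) (n := θ.val + 1) (by omega) (by rw [hθ']; exact hpos _ h1')
    (by rw [hθ']; exact hpos _ h2')
  have h0 : 0 < θ.val := by
    by_contra! hcon
    have : θ.val = 0 := by omega
    have h3 := hpos _ h2
    rw [← hθ, this, emb_eq] at h3
    simp at h3
  have hf1 := far_iff h0 hlt
  have hf2 := far_iff (K := K) (Nat.succ_pos θ.val) hlt'
  rw [hθ] at hf1
  rw [hθ'] at hf2
  rw [hf1, hf2] at hf
  have : θ.val = 2 * K := by omega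
  rw [← hθ, this]
  rfl

theorem Adj.eq_base_of_far {p : Grid K × Grid K} (hp : Adj p) (h1 : reSign p.1 = 1)
    (h2 : imSign p.1 = 1) (h1' : reSign p.2 = 1) (h2' : imSign p.2 = 1)
    (hf : Far p.1 ↔ ¬ Far p.2) :
    (p.1 = base K ∨ p.1 = base K + 1) ∧ (p.2 = base K ∨ p.2 = base K + 1) := by
  rcases hp with hp | hp
  · rw [hp] at h1' h2' hf ⊢
    have := Grid.eq_base_of_far h1 h2 h1' h2' hf
    exact ⟨Or.inl this, Or.inr (by rw [this])⟩
  · rw [hp] at h1 h2 hf ⊢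
    have := Grid.eq_base_of_far h1' h2' h1 h2 (by tauto)
    exact ⟨Or.inr (by rw [this]), Or.inl this⟩

theorem base_signs : reSign (base K) = 1 ∧ imSign (base K) = 1 ∧ ¬ Far (base K) ∧
    reSign (base K + 1) = 1 ∧ imSign (base K + 1) = 1 ∧ Far (base K + 1) := by
  have hK := NeZero.pos K
  have h0 : ((2 * K : ℕ) : Grid K) = base K := rfl
  have h1 : ((2 * K + 1 : ℕ) : Grid K) = base K + 1 := by rw [Nat.cast_add, h0, Nat.cast_one]
  have e0 := re_pos_im_pos (K := K) (n := 2 * K) (by omega) (by omega)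
  have e1 := re_pos_im_pos (K := K) (n := 2 * K + 1) (by omega) (by omega)
  have f0 := far_iff (K := K) (n := 2 * K) (by omega) (by omega)
  have f1 := far_iff (K := K) (n := 2 * K + 1) (by omega) (by omega)
  rw [h0] at e0 f0
  rw [h1] at e1 f1
  exact ⟨Real.sign_of_pos e0.1, Real.sign_of_pos e0.2, by rw [f0]; omega,
    Real.sign_of_pos e1.1, Real.sign_of_pos e1.2, by rw [f1]; omega⟩

end Grid
end

section
open Finset

/-- The sign representation on `ℝ^ι`. -/
def signRep {Γ : Type} [Group Γ] (χ : Γ →* ℤˣ) (ι : Type) : Representation ℝ Γ (ι → ℝ) where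
  toFun γ := (((χ γ : ℤˣ) : ℤ) : ℝ) • 1
  map_one' := by simp
  map_mul' γ γ' := by
    apply LinearMap.ext
    intro w
    simp only [map_mul, Units.val_mul, Int.cast_mul, mul_smul, LinearMap.smul_apply,
      Module.End.mul_apply, Module.End.one_apply]

theorem signRep_apply {Γ : Type} [Group Γ] (χ : Γ →* ℤˣ) (ι : Type) (γ : Γ) (w : ι → ℝ) :
    signRep χ ι γ w = (((χ γ : ℤˣ) : ℤ) : ℝ) • w := rfl

namespace Sys
variable (S : Sys) (χ : S.Γ →* ℤˣ) {K : ℕ} [NeZero K]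

/-- The sign of the group element moving a grid point to the base cube. -/
noncomputable def locSign (v : S.ι → Grid K) : ℝ :=
  ((S.loc v).map fun γ => (((χ γ : ℤˣ) : ℤ) : ℝ)).getD 0

theorem units_mul_self (a : ℤˣ) : ((a : ℤ) : ℝ) * ((a : ℤ) : ℝ) = 1 := by
  rcases Int.units_eq_one_or a with rfl | rfl <;> simp

theorem locSign_of_isBase {γ : S.Γ} {v : S.ι → Grid K} (h : IsBase (S.cube.act γ v)) :
    S.locSign χ v = (((χ γ : ℤˣ) : ℤ) : ℝ) := by
  rw [locSign, S.loc_eq_some.mpr h, Option.map_some, Option.getD_some]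

theorem locSign_act (g : S.Γ) (v : S.ι → Grid K) :
    S.locSign χ (S.cube.act g v) = (((χ g : ℤˣ) : ℤ) : ℝ) * S.locSign χ v := by
  rw [locSign, locSign, loc_act]
  cases S.loc v with
  | none => simp
  | some γ =>
    simp only [Option.map_some, Option.getD_some, map_mul, map_inv, Int.units_inv_eq_self]
    push_cast
    ring

theorem abs_locSign_le {K : ℕ} (v : S.ι → Grid K) : |S.locSign χ v| ≤ 1 := by
  rw [locSign]
  cases S.loc v with
  | none => simp
  | some γ =>
    rcases Int.units_eq_one_or (χ γ) with h | h <;> simp [h]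

end Sys

/-- The action of the doubled group on the doubled coordinates and the root coordinate. -/
def CubeAction.double {Γ ι : Type} [Group Γ] (a : CubeAction Γ ι) (χ : Γ →* ℤˣ) :
    CubeAction (Γ × Γ × ℤˣ) ((ι ⊕ ι) ⊕ Unit) where
  act γ v := Sum.elim (Sum.elim (a.act γ.1 fun i => v (.inl (.inl i)))
    (a.act γ.2.1 fun i => v (.inl (.inr i))))
      fun _ => ((γ.2.2 * χ γ.1, γ.2.2 * χ γ.2.1) : ℤˣ × ℤˣ) • v (.inr ())
  act_one v := by
    funext i
    rcases i with (i | i) | i <;> simp [a.act_one, ← Prod.one_eq_mk]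
  act_mul γ γ' v := by
    funext i
    rcases i with (i | i) | i
    · simp [a.act_mul]
    · simp [a.act_mul]
    · simp only [Sum.elim_inr, smul_smul, Prod.fst_mul, Prod.snd_mul, map_mul, Prod.mk_mul_mk]
      rw [mul_mul_mul_comm γ.2.2 γ'.2.2 (χ γ.1), mul_mul_mul_comm γ.2.2 γ'.2.2 (χ γ.2.1)]
  act_map f hf γ v := by
    funext i
    rcases i with (i | i) | i
    · simp only [Sum.elim_inl]
      rw [a.act_map f hf]
    · simp only [Sum.elim_inl, Sum.elim_inr]
      rw [a.act_map f hf]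
    · simp only [Sum.elim_inr]
      rw [hf]

theorem Grid.half_smul_ne {K : ℕ} [NeZero K] {p : Grid K × Grid K} (hp : Grid.Adj p) {θ : Grid K}
    (h : θ = p.1 ∨ θ = p.2) (h' : ((-1, -1) : ℤˣ × ℤˣ) • θ = p.1 ∨ ((-1, -1) : ℤˣ × ℤˣ) • θ = p.2) :
    False := by
  have h1 : ‖Grid.emb θ - Grid.emb (((-1, -1) : ℤˣ × ℤˣ) • θ)‖ = 2 := by
    have : ((-1, -1) : ℤˣ × ℤˣ) • Grid.emb θ = -Grid.emb θ := by
      apply Complex.ext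
      · rw [Grid.complex_smul_re]; simp
      · rw [Grid.complex_smul_im]; simp
    rw [Grid.emb_smul, this, sub_neg_eq_add, ← two_mul, norm_mul, Grid.norm_emb]
    simp
  have h2 := hp.norm_sub_lt
  rcases h with h | h <;> rcases h' with h' | h' <;> rw [h', h] at h1
  · simp at h1
  · linarith
  · rw [norm_sub_rev] at h1; linarith
  · simp at h1

/-- The scaled imaginary sign of a grid point. -/
noncomputable def Grid.imScale {K : ℕ} [NeZero K] (p : ℝ) (θ : Grid K) : ℝ :=
  open Classical in Grid.imSign θ * ((if Grid.Far θ then 2 else 1) - p)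

theorem Grid.imScale_smul {K : ℕ} [NeZero K] (p : ℝ) (g : ℤˣ × ℤˣ) (θ : Grid K) :
    Grid.imScale p (g • θ) = ((g.2 : ℤ) : ℝ) * Grid.imScale p θ := by
  have hf := Grid.far_smul g θ
  rw [Grid.imScale, Grid.imScale, Grid.imSign_smul, mul_assoc]
  by_cases h : Grid.Far θ
  · rw [if_pos h, if_pos (hf.mpr h)]
  · rw [if_neg h, if_neg (fun h' => h (hf.mp h'))]

namespace Sys
variable (S : Sys) (χ : S.Γ →* ℤˣ) {K : ℕ} [NeZero K]

/-- The model map of the doubled system. -/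
noncomputable def doubleMap (p : ℝ) (F G : (S.ι → Grid K) → S.ι → ℝ)
    (v : (S.ι ⊕ S.ι) ⊕ Unit → Grid K) : (S.ι ⊕ S.ι) ⊕ Unit → ℝ :=
  Sum.elim
    (Sum.elim (Grid.reSign (v (.inr ())) • F fun i => v (.inl (.inl i)))
      (Grid.imSign (v (.inr ())) • G fun i => v (.inl (.inr i))))
    fun _ => Grid.imScale p (v (.inr ())) * S.locSign χ (fun i => v (.inl (.inr i))) -
      Grid.reSign (v (.inr ())) * S.locSign χ (fun i => v (.inl (.inl i)))

theorem doubleMap_act (hrep : ∀ γ w, S.rep γ w = (((χ γ : ℤˣ) : ℤ) : ℝ) • w) (p : ℝ)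
    {F G : (S.ι → Grid K) → S.ι → ℝ}
    (hF : ∀ γ v, F (S.cube.act γ v) = S.rep γ (F v))
    (hG : ∀ γ v, G (S.cube.act γ v) = S.rep γ (G v)) (γ : S.Γ × S.Γ × ℤˣ)
    (v : (S.ι ⊕ S.ι) ⊕ Unit → Grid K) :
    S.doubleMap χ p F G ((S.cube.double χ).act γ v) =
      ((γ.2.2 : ℤ) : ℝ) • S.doubleMap χ p F G v := by
  have h1 := units_mul_self (χ γ.1)
  have h2 := units_mul_self (χ γ.2.1)
  funext i
  rcases i with (i | i) | i <;>
    simp only [doubleMap, CubeAction.double, Sum.elim_inl, Sum.elim_inr, Pi.smul_apply, hF, hG,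
      hrep, Grid.reSign_smul, Grid.imSign_smul, Grid.imScale_smul, locSign_act, smul_eq_mul,
      Units.val_mul, Int.cast_mul]
  · linear_combination (((γ.2.2 : ℤ) : ℝ) * Grid.reSign (v (.inr ())) *
      F (fun i => v (.inl (.inl i))) i) * h1
  · linear_combination (((γ.2.2 : ℤ) : ℝ) * Grid.imSign (v (.inr ())) *
      G (fun i => v (.inl (.inr i))) i) * h2
  · linear_combination (((γ.2.2 : ℤ) : ℝ) * Grid.imScale p (v (.inr ())) *
      S.locSign χ (fun i => v (.inl (.inr i)))) * h2 - (((γ.2.2 : ℤ) : ℝ) *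
      Grid.reSign (v (.inr ())) * S.locSign χ (fun i => v (.inl (.inl i)))) * h1

theorem doubleMap_of_isBase (p : ℝ) (q : S.ι ⊕ S.ι → ℝ) {F G : (S.ι → Grid K) → S.ι → ℝ}
    (hF : ∀ v, IsBase v → ∀ i, F v i = (if v i = Grid.base K then 0 else 1) - q (.inl i))
    (hG : ∀ v, IsBase v → ∀ i, G v i = (if v i = Grid.base K then 0 else 1) - q (.inr i))
    {v : (S.ι ⊕ S.ι) ⊕ Unit → Grid K} (hv : IsBase v) (i : (S.ι ⊕ S.ι) ⊕ Unit) :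
    S.doubleMap χ p F G v i = (if v i = Grid.base K then 0 else 1) - Sum.elim q (fun _ => p) i := by
  obtain ⟨b1, b2, b3, b4, b5, b6⟩ := Grid.base_signs (K := K)
  have hl : ∀ w : S.ι → Grid K, IsBase w → S.locSign χ w = 1 := by
    intro w hw
    rw [S.locSign_of_isBase χ (γ := 1) (by rwa [S.cube.act_one])]
    simp
  have h1 : Grid.reSign (v (.inr ())) = 1 := by rcases hv (.inr ()) with h | h <;> rw [h] <;> assumption
  have h2 : Grid.imSign (v (.inr ())) = 1 := by rcases hv (.inr ()) with h | h <;> rw [h] <;> assumption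
  rcases i with (i | i) | i
  · simp only [doubleMap, Sum.elim_inl, h1, one_smul]
    exact hF _ (fun i => hv _) i
  · simp only [doubleMap, Sum.elim_inl, Sum.elim_inr, h2, one_smul]
    exact hG _ (fun i => hv _) i
  · simp only [doubleMap, Sum.elim_inr, h1]
    rw [hl _ (fun i => hv _), hl _ (fun i => hv _), Grid.imScale, h2]
    rcases hv (.inr ()) with h | h <;> rw [h]
    · rw [if_neg b3, if_pos rfl]; ring
    · rw [if_pos b6, if_neg Grid.base_add_one_ne]; ring

end Sys
end

section
open Finset

namespace Grid
variable {K : ℕ} [NeZero K] {p : ℝ} {θ : Grid K}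

theorem abs_imScale_lt (hp : 0 < p ∧ p < 1) (h : ¬ Far θ) : |imScale p θ| < 1 := by
  rw [imScale, if_neg h, abs_mul, abs_of_pos (by linarith : (0 : ℝ) < 1 - p)]
  have h1 : |imSign θ| ≤ 1 := abs_sign_le _
  nlinarith

theorem imScale_of_far (h : Far θ) : imScale p θ = imSign θ * (2 - p) := by
  rw [imScale, if_pos h]

theorem exists_imScale_eq (hp : 0 < p ∧ p < 1) (θ : Grid K) :
    ∃ m : ℝ, 0 < m ∧ imScale p θ = imSign θ * m := by
  rw [imScale]
  split_ifs
  · exact ⟨2 - p, by linarith, rfl⟩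
  · exact ⟨1 - p, by linarith, rfl⟩

end Grid

theorem units_mul_eq_one_or (a b : ℤˣ) : ((a : ℤ) : ℝ) * ((b : ℤ) : ℝ) = -1 ∨ a = b := by
  rcases Int.units_eq_one_or a with rfl | rfl <;> rcases Int.units_eq_one_or b with rfl | rfl <;>
    simp

namespace Sys
variable (S : Sys) (χ : S.Γ →* ℤˣ) {K : ℕ} [NeZero K]

theorem abs_mul_locSign_le {K : ℕ} (a b : ℤˣ) (v : S.ι → Grid K) :
    |((a : ℤ) : ℝ) * ((b : ℤ) : ℝ) * S.locSign χ v| ≤ 1 := by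
  rw [mul_assoc, Grid.abs_units_mul, Grid.abs_units_mul]
  exact S.abs_locSign_le χ v

/-- The index of the edge in which a cube of the doubled system meets a coordinate block. -/
theorem doubleMap_dichotomy {p : ℝ} (hp : 0 < p ∧ p < 1) {F G : (S.ι → Grid K) → S.ι → ℝ}
    (hF : ∀ e, IsCube e → (∃ φ : (S.ι → ℝ) →ₗ[ℝ] ℝ, ∀ v, InCube e v → 0 < φ (F v)) ∨
      ∃ γ, ∀ v, InCube e v → IsBase (S.cube.act γ v))
    (hG : ∀ e, IsCube e → (∃ φ : (S.ι → ℝ) →ₗ[ℝ] ℝ, ∀ v, InCube e v → 0 < φ (G v)) ∨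
      ∃ γ, ∀ v, InCube e v → IsBase (S.cube.act γ v))
    (e : (S.ι ⊕ S.ι) ⊕ Unit → Grid K × Grid K) (he : IsCube e) :
    (∃ φ : ((S.ι ⊕ S.ι) ⊕ Unit → ℝ) →ₗ[ℝ] ℝ, ∀ v, InCube e v → 0 < φ (S.doubleMap χ p F G v)) ∨
      ∃ γ, ∀ v, InCube e v → IsBase ((S.cube.double χ).act γ v) := by
  have hroot := he (.inr ())
  have h1 := hF (fun i => e (.inl (.inl i))) (fun i => he _)
  have h2 := hG (fun i => e (.inl (.inr i))) (fun i => he _)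
  have hC : ∀ c : ℤˣ, (∀ v, InCube e v → Grid.reSign (v (.inr ())) = ((c : ℤ) : ℝ)) →
      (∃ φ : (S.ι → ℝ) →ₗ[ℝ] ℝ, ∀ v, InCube (fun i => e (.inl (.inl i))) v → 0 < φ (F v)) →
      ∃ φ : ((S.ι ⊕ S.ι) ⊕ Unit → ℝ) →ₗ[ℝ] ℝ, ∀ v, InCube e v →
        0 < φ (S.doubleMap χ p F G v) := by
    rintro c hc ⟨φ, hφ⟩
    refine ⟨((c : ℤ) : ℝ) • φ ∘ₗ LinearMap.funLeft ℝ ℝ (fun i => .inl (.inl i)), fun v hv => ?_⟩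
    have : LinearMap.funLeft ℝ ℝ (fun i => .inl (.inl i)) (S.doubleMap χ p F G v) =
        ((c : ℤ) : ℝ) • F fun i => v (.inl (.inl i)) := by rw [← hc v hv]; rfl
    rw [LinearMap.smul_apply, LinearMap.comp_apply, this, map_smul, smul_smul, units_mul_self,
      one_smul]
    exact hφ _ fun i => hv _
  have hD : ∀ c : ℤˣ, (∀ v, InCube e v → Grid.imSign (v (.inr ())) = ((c : ℤ) : ℝ)) →
      (∃ φ : (S.ι → ℝ) →ₗ[ℝ] ℝ, ∀ v, InCube (fun i => e (.inl (.inr i))) v → 0 < φ (G v)) →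
      ∃ φ : ((S.ι ⊕ S.ι) ⊕ Unit → ℝ) →ₗ[ℝ] ℝ, ∀ v, InCube e v →
        0 < φ (S.doubleMap χ p F G v) := by
    rintro c hc ⟨φ, hφ⟩
    refine ⟨((c : ℤ) : ℝ) • φ ∘ₗ LinearMap.funLeft ℝ ℝ (fun i => .inl (.inr i)), fun v hv => ?_⟩
    have : LinearMap.funLeft ℝ ℝ (fun i => .inl (.inr i)) (S.doubleMap χ p F G v) =
        ((c : ℤ) : ℝ) • G fun i => v (.inl (.inr i)) := by rw [← hc v hv]; rfl
    rw [LinearMap.smul_apply, LinearMap.comp_apply, this, map_smul, smul_smul, units_mul_self,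
      one_smul]
    exact hφ _ fun i => hv _
  have hR : ∀ a b : ℤˣ, (∀ v, InCube e v → 0 < ((a : ℤ) : ℝ) * ((b : ℤ) : ℝ) *
      (Grid.imScale p (v (.inr ())) * S.locSign χ (fun i => v (.inl (.inr i))) -
      Grid.reSign (v (.inr ())) * S.locSign χ (fun i => v (.inl (.inl i))))) →
      ∃ φ : ((S.ι ⊕ S.ι) ⊕ Unit → ℝ) →ₗ[ℝ] ℝ, ∀ v, InCube e v →
        0 < φ (S.doubleMap χ p F G v) := by
    intro a b h
    exact ⟨(((a : ℤ) : ℝ) * ((b : ℤ) : ℝ)) • LinearMap.proj (.inr ()), fun v hv => h v hv⟩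
  have hre : (¬ Grid.Far (e (.inr ())).1 ∨ ¬ Grid.Far (e (.inr ())).2) →
      ∃ c : ℤˣ, ∀ v, InCube e v → Grid.reSign (v (.inr ())) = ((c : ℤ) : ℝ) := by
    intro h
    obtain ⟨c, hc, hc'⟩ := hroot.reSign_const h
    exact ⟨c, fun v hv => by rcases hv (.inr ()) with h | h <;> rw [h] <;> assumption⟩
  have him : (Grid.Far (e (.inr ())).1 ∨ Grid.Far (e (.inr ())).2) →
      ∃ c : ℤˣ, ∀ v, InCube e v → Grid.imSign (v (.inr ())) = ((c : ℤ) : ℝ) := by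
    intro h
    obtain ⟨c, hc, hc'⟩ := hroot.imSign_const h
    exact ⟨c, fun v hv => by rcases hv (.inr ()) with h | h <;> rw [h] <;> assumption⟩
  by_cases hA : ¬ Grid.Far (e (.inr ())).1 ∧ ¬ Grid.Far (e (.inr ())).2
  · left
    obtain ⟨c, hc⟩ := hre (Or.inl hA.1)
    rcases h1 with h1 | ⟨γ, hγ⟩
    · exact hC c hc h1
    · refine hR (-c) (χ γ) fun v hv => ?_
      have hl := S.locSign_of_isBase χ (hγ (fun i => v (.inl (.inl i))) fun i => hv _)
      rw [hl, hc v hv]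
      have hs : |Grid.imScale p (v (.inr ()))| < 1 :=
        Grid.abs_imScale_lt hp (by rcases hv (.inr ()) with h | h <;> rw [h]; exacts [hA.1, hA.2])
      have ha := S.abs_mul_locSign_le χ c (χ γ) (fun i => v (.inl (.inr i)))
      have hm : |((c : ℤ) : ℝ) * ((χ γ : ℤ) : ℝ) * S.locSign χ (fun i => v (.inl (.inr i))) *
          Grid.imScale p (v (.inr ()))| < 1 := by
        rw [abs_mul]
        exact (mul_le_of_le_one_left (abs_nonneg _) ha).trans_lt hs
      have h3 := units_mul_self c
      have h4 := units_mul_self (χ γ)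
      have h5 := (abs_lt.mp hm).2
      have h6 : ((c : ℤ) : ℝ) * ((χ γ : ℤ) : ℝ) * (((c : ℤ) : ℝ) * ((χ γ : ℤ) : ℝ)) = 1 := by
        rw [mul_mul_mul_comm, h3, h4, one_mul]
      push_cast
      linarith
  by_cases hB : Grid.Far (e (.inr ())).1 ∧ Grid.Far (e (.inr ())).2
  · left
    obtain ⟨c, hc⟩ := him (Or.inl hB.1)
    rcases h2 with h2 | ⟨γ, hγ⟩
    · exact hD c hc h2
    · refine hR c (χ γ) fun v hv => ?_
      have hl := S.locSign_of_isBase χ (hγ (fun i => v (.inl (.inr i))) fun i => hv _)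
      rw [hl, Grid.imScale_of_far (by rcases hv (.inr ()) with h | h <;> rw [h]; exacts [hB.1, hB.2]),
        hc v hv]
      have ha := S.abs_mul_locSign_le χ c (χ γ) (fun i => v (.inl (.inl i)))
      have hm : |((c : ℤ) : ℝ) * ((χ γ : ℤ) : ℝ) * S.locSign χ (fun i => v (.inl (.inl i))) *
          Grid.reSign (v (.inr ()))| ≤ 1 := by
        rw [abs_mul]
        exact mul_le_one₀ ha (abs_nonneg _) (Grid.abs_sign_le _)
      have h3 := units_mul_self c
      have h4 := units_mul_self (χ γ)
      have h5 := (abs_le.mp hm).2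
      have h6 : ((c : ℤ) : ℝ) * ((χ γ : ℤ) : ℝ) * (((c : ℤ) : ℝ) * ((χ γ : ℤ) : ℝ)) = 1 := by
        rw [mul_mul_mul_comm, h3, h4, one_mul]
      have h7 : ((c : ℤ) : ℝ) * ((χ γ : ℤ) : ℝ) * (((c : ℤ) : ℝ) * (2 - p) * ((χ γ : ℤ) : ℝ)) =
          2 - p := by linear_combination (2 - p) * h6
      linarith
  obtain ⟨c, hc⟩ := hre (by tauto)
  obtain ⟨s, hs⟩ := him (by tauto)
  rcases h1 with h1 | ⟨γ, hγ⟩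
  · exact Or.inl (hC c hc h1)
  rcases h2 with h2 | ⟨γ', hγ'⟩
  · exact Or.inl (hD s hs h2)
  rcases units_mul_eq_one_or (s * χ γ') (c * χ γ) with h | h
  · left
    refine hR s (χ γ') fun v hv => ?_
    rw [S.locSign_of_isBase χ (hγ (fun i => v (.inl (.inl i))) fun i => hv _),
      S.locSign_of_isBase χ (hγ' (fun i => v (.inl (.inr i))) fun i => hv _), hc v hv]
    obtain ⟨m, hm, hm'⟩ := Grid.exists_imScale_eq hp (v (.inr ()))
    rw [hm', hs v hv]
    have h3 := units_mul_self s
    have h4 := units_mul_self (χ γ')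
    have h6 : ((s : ℤ) : ℝ) * ((χ γ' : ℤ) : ℝ) * (((s : ℤ) : ℝ) * ((χ γ' : ℤ) : ℝ)) = 1 := by
      rw [mul_mul_mul_comm, h3, h4, one_mul]
    have h7 : ((s : ℤ) : ℝ) * ((χ γ' : ℤ) : ℝ) * (((s : ℤ) : ℝ) * m * ((χ γ' : ℤ) : ℝ)) = m := by
      linear_combination m * h6
    push_cast at h
    linarith
  · right
    refine ⟨(γ, γ', s * χ γ'), fun v hv i => ?_⟩
    rcases i with (i | i) | i
    · exact hγ (fun i => v (.inl (.inl i))) (fun i => hv _) i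
    · exact hγ' (fun i => v (.inl (.inr i))) (fun i => hv _) i
    · have hcs : ((s * χ γ' * χ γ, s * χ γ' * χ γ') : ℤˣ × ℤˣ) = (c, s) := by
        refine Prod.ext ?_ ?_
        · change s * χ γ' * χ γ = c
          rw [h, mul_assoc, Int.units_mul_self, mul_one]
        · change s * χ γ' * χ γ' = s
          rw [mul_assoc, Int.units_mul_self, mul_one]
      change ((s * χ γ' * χ γ, s * χ γ' * χ γ') : ℤˣ × ℤˣ) • v (.inr ()) = _ ∨
        ((s * χ γ' * χ γ, s * χ γ' * χ γ') : ℤˣ × ℤˣ) • v (.inr ()) = _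
      rw [hcs]
      obtain ⟨v0, hv0⟩ : ∃ v0, InCube e v0 ∧ v0 (.inr ()) = (e (.inr ())).1 :=
        ⟨fun i => (e i).1, fun _ => Or.inl rfl, rfl⟩
      obtain ⟨v1, hv1⟩ : ∃ v1, InCube e v1 ∧ v1 (.inr ()) = (e (.inr ())).2 :=
        ⟨fun i => (e i).2, fun _ => Or.inr rfl, rfl⟩
      have hb := (hroot.smul (c, s)).eq_base_of_far
        (by rw [Prod.smul_fst, Grid.reSign_smul, ← hv0.2, hc v0 hv0.1, units_mul_self])
        (by rw [Prod.smul_fst, Grid.imSign_smul, ← hv0.2, hs v0 hv0.1, units_mul_self])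
        (by rw [Prod.smul_snd, Grid.reSign_smul, ← hv1.2, hc v1 hv1.1, units_mul_self])
        (by rw [Prod.smul_snd, Grid.imSign_smul, ← hv1.2, hs v1 hv1.1, units_mul_self])
        (by rw [Prod.smul_fst, Prod.smul_snd, Grid.far_smul, Grid.far_smul]; tauto)
      rcases hv (.inr ()) with h | h <;> rw [h]
      exacts [hb.1, hb.2]

/-- The doubled system. -/
noncomputable def double (hrep : ∀ γ w, S.rep γ w = (((χ γ : ℤˣ) : ℤ) : ℝ) • w) : Sys where
  ι := (S.ι ⊕ S.ι) ⊕ Unit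
  Γ := S.Γ × S.Γ × ℤˣ
  cube := S.cube.double χ
  rep := signRep ((MonoidHom.snd S.Γ ℤˣ).comp (MonoidHom.snd S.Γ (S.Γ × ℤˣ))) _
  free K _ γ e v he hv hγ := by
    obtain ⟨γ, γ', ε⟩ := γ
    have h1 : γ = 1 := S.free K γ (fun i => e (.inl (.inl i))) (fun i => v (.inl (.inl i)))
      (fun i => he _) (fun i => hv _) (fun i => hγ (.inl (.inl i)))
    have h2 : γ' = 1 := S.free K γ' (fun i => e (.inl (.inr i))) (fun i => v (.inl (.inr i)))
      (fun i => he _) (fun i => hv _) (fun i => hγ (.inl (.inr i)))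
    subst h1 h2
    rcases Int.units_eq_one_or ε with rfl | rfl
    · rfl
    · exfalso
      have h3 := hγ (.inr ())
      change ((-1 * χ 1, -1 * χ 1) : ℤˣ × ℤˣ) • v (.inr ()) = _ ∨
        ((-1 * χ 1, -1 * χ 1) : ℤˣ × ℤˣ) • v (.inr ()) = _ at h3
      rw [map_one, mul_one] at h3
      exact Grid.half_smul_ne (he (.inr ())) (hv (.inr ())) h3
  good K _ p hp := by
    obtain ⟨F, hF, hFb, hFd⟩ := S.good K (fun i => p (.inl (.inl i))) fun i => hp _
    obtain ⟨G, hG, hGb, hGd⟩ := S.good K (fun i => p (.inl (.inr i))) fun i => hp _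
    refine ⟨S.doubleMap χ (p (.inr ())) F G, fun γ v => ?_, fun v hv i => ?_,
      S.doubleMap_dichotomy χ (hp _) hFd hGd⟩
    · rw [signRep_apply]
      exact S.doubleMap_act χ hrep _ hF hG γ v
    · rw [S.doubleMap_of_isBase χ (p (.inr ())) (fun i => p (.inl i)) hFb hGb hv]
      rcases i with i | i <;> rfl

end Sys
end

section
open Finset Matrix

/-- A system acting by signs together with an equivariant map from its torus to orthogonal
matrices of size `2 ^ m`. -/
structure Tower (m : ℕ) where
  /-- The system. -/
  S : Sys
  /-- The sign character. -/
  χ : S.Γ →* ℤˣ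
  rep_apply : ∀ γ w, S.rep γ w = (((χ γ : ℤˣ) : ℤ) : ℝ) • w
  /-- The index type of the matrices. -/
  Λ : Type
  [fintypeIndex : Fintype Λ]
  [decEq : DecidableEq Λ]
  /-- A distinguished index. -/
  origin : Λ
  card_succ : Fintype.card S.ι + 1 = Fintype.card Λ
  card_index : Fintype.card Λ = 2 ^ m
  /-- The matrices. -/
  mat : (S.ι → ℂ) → Matrix Λ Λ ℝ
  continuous_mat : Continuous mat
  mat_act : ∀ γ z, mat (S.cube.act γ z) = (((χ γ : ℤˣ) : ℤ) : ℝ) • mat z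
  orthogonal : ∀ z, (∀ i, ‖z i‖ = 1) → (mat z)ᵀ * mat z = 1

attribute [instance] Tower.fintypeIndex Tower.decEq

namespace Tower

/-- The tower of height zero. -/
def zero : Tower 0 where
  S := Sys.point
  χ := 1
  rep_apply _ w := by
    funext i
    exact i.elim
  Λ := Unit
  fintypeIndex := inferInstance
  decEq := inferInstance
  origin := ()
  card_succ := rfl
  card_index := rfl
  mat _ := 1
  continuous_mat := continuous_const
  mat_act _ _ := by simp
  orthogonal _ _ := by simp

variable {m : ℕ} (T : Tower m)

/-- The matrices of the next tower. -/
noncomputable def stepMat (z : (T.S.ι ⊕ T.S.ι) ⊕ Unit → ℂ) : Matrix (T.Λ ⊕ T.Λ) (T.Λ ⊕ T.Λ) ℝ :=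
  fromBlocks ((z (.inr ())).re • T.mat fun i => z (.inl (.inl i)))
    (-((z (.inr ())).im • T.mat fun i => z (.inl (.inr i))))
    ((z (.inr ())).im • T.mat fun i => z (.inl (.inr i)))
    ((z (.inr ())).re • ((T.mat fun i => z (.inl (.inr i))) *
      (T.mat fun i => z (.inl (.inl i)))ᵀ * T.mat fun i => z (.inl (.inr i))))

theorem continuous_stepMat : Continuous T.stepMat := by
  have h := T.continuous_mat
  have hA : Continuous fun z : (T.S.ι ⊕ T.S.ι) ⊕ Unit → ℂ => T.mat fun i => z (.inl (.inl i)) :=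
    h.comp (by fun_prop)
  have hB : Continuous fun z : (T.S.ι ⊕ T.S.ι) ⊕ Unit → ℂ => T.mat fun i => z (.inl (.inr i)) :=
    h.comp (by fun_prop)
  have hc : Continuous fun z : (T.S.ι ⊕ T.S.ι) ⊕ Unit → ℂ => (z (.inr ())).re :=
    Complex.continuous_re.comp (continuous_apply _)
  have hs : Continuous fun z : (T.S.ι ⊕ T.S.ι) ⊕ Unit → ℂ => (z (.inr ())).im :=
    Complex.continuous_im.comp (continuous_apply _)
  exact Continuous.matrix_fromBlocks (hc.smul hA) (hs.smul hB).neg (hs.smul hB)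
    (hc.smul ((hB.matrix_mul hA.matrix_transpose).matrix_mul hB))

theorem stepMat_act (γ : T.S.Γ × T.S.Γ × ℤˣ) (z : (T.S.ι ⊕ T.S.ι) ⊕ Unit → ℂ) :
    T.stepMat ((T.S.cube.double T.χ).act γ z) = ((γ.2.2 : ℤ) : ℝ) • T.stepMat z := by
  have h1 := Sys.units_mul_self (T.χ γ.1)
  have h2 := Sys.units_mul_self (T.χ γ.2.1)
  have hA : (T.mat fun i => (T.S.cube.double T.χ).act γ z (.inl (.inl i))) =
      (((T.χ γ.1 : ℤˣ) : ℤ) : ℝ) • T.mat fun i => z (.inl (.inl i)) :=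
    T.mat_act γ.1 fun i => z (.inl (.inl i))
  have hB : (T.mat fun i => (T.S.cube.double T.χ).act γ z (.inl (.inr i))) =
      (((T.χ γ.2.1 : ℤˣ) : ℤ) : ℝ) • T.mat fun i => z (.inl (.inr i)) :=
    T.mat_act γ.2.1 fun i => z (.inl (.inr i))
  have hc : ((T.S.cube.double T.χ).act γ z (.inr ())).re =
      ((γ.2.2 : ℤ) : ℝ) * (((T.χ γ.1 : ℤˣ) : ℤ) : ℝ) * (z (.inr ())).re := by
    refine (Grid.complex_smul_re (γ.2.2 * T.χ γ.1, γ.2.2 * T.χ γ.2.1) (z (.inr ()))).trans ?_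
    push_cast
    rfl
  have hs : ((T.S.cube.double T.χ).act γ z (.inr ())).im =
      ((γ.2.2 : ℤ) : ℝ) * (((T.χ γ.2.1 : ℤˣ) : ℤ) : ℝ) * (z (.inr ())).im := by
    refine (Grid.complex_smul_im (γ.2.2 * T.χ γ.1, γ.2.2 * T.χ γ.2.1) (z (.inr ()))).trans ?_
    push_cast
    rfl
  rw [stepMat, stepMat, hA, hB, hc, hs, fromBlocks_smul]
  simp only [transpose_smul, Matrix.smul_mul, Matrix.mul_smul, smul_smul, smul_neg]
  congr 2
  · linear_combination (((γ.2.2 : ℤ) : ℝ) * (z (.inr ())).re) * h1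
  · congr 1
    linear_combination (((γ.2.2 : ℤ) : ℝ) * (z (.inr ())).im) * h2
  · linear_combination (((γ.2.2 : ℤ) : ℝ) * (z (.inr ())).im) * h2
  · linear_combination (((γ.2.2 : ℤ) : ℝ) * (z (.inr ())).re) *
      ((((T.χ γ.2.1 : ℤˣ) : ℤ) : ℝ) * (((T.χ γ.2.1 : ℤˣ) : ℤ) : ℝ) * h1 + h2)

theorem orthogonal_stepMat (z : (T.S.ι ⊕ T.S.ι) ⊕ Unit → ℂ) (hz : ∀ i, ‖z i‖ = 1) :
    (T.stepMat z)ᵀ * T.stepMat z = 1 := by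
  have hA := T.orthogonal (fun i => z (.inl (.inl i))) fun i => hz _
  have hB := T.orthogonal (fun i => z (.inl (.inr i))) fun i => hz _
  have hA' := mul_eq_one_comm.mp hA
  have hcs : (z (.inr ())).re * (z (.inr ())).re + (z (.inr ())).im * (z (.inr ())).im = 1 := by
    rw [← Complex.normSq_apply, ← Complex.sq_norm, hz, one_pow]
  rw [stepMat]
  generalize (T.mat fun i => z (.inl (.inl i))) = A at *
  generalize (T.mat fun i => z (.inl (.inr i))) = B at *
  have h1 : Bᵀ * (B * Aᵀ * B) = Aᵀ * B := by
    rw [← Matrix.mul_assoc, ← Matrix.mul_assoc, hB, Matrix.one_mul]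
  have h2 : Bᵀ * (A * Bᵀ) * B = Bᵀ * A := by
    rw [Matrix.mul_assoc, Matrix.mul_assoc, hB, Matrix.mul_one]
  have h3 : Bᵀ * (A * Bᵀ) * (B * Aᵀ * B) = 1 := by
    rw [Matrix.mul_assoc, Matrix.mul_assoc, h1, ← Matrix.mul_assoc A, hA', Matrix.one_mul, hB]
  rw [fromBlocks_transpose, fromBlocks_multiply, ← fromBlocks_one]
  simp only [transpose_smul, transpose_neg, transpose_mul, transpose_transpose, Matrix.smul_mul,
    Matrix.mul_smul, Matrix.neg_mul, Matrix.mul_neg, smul_smul, smul_neg, neg_neg, hA, hB, h1, h2,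
    h3]
  congr 1
  · rw [← add_smul, hcs, one_smul]
  · rw [mul_comm (z (.inr ())).im, neg_add_cancel]
  · rw [mul_comm (z (.inr ())).im, neg_add_cancel]
  · rw [← add_smul, add_comm, hcs, one_smul]

/-- The next tower. -/
noncomputable def step : Tower (m + 1) where
  S := T.S.double T.χ T.rep_apply
  χ := (MonoidHom.snd T.S.Γ ℤˣ).comp (MonoidHom.snd T.S.Γ (T.S.Γ × ℤˣ))
  rep_apply _ _ := rfl
  Λ := T.Λ ⊕ T.Λ
  fintypeIndex := inferInstance
  decEq := inferInstance
  origin := .inl T.origin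
  card_succ := by
    change Fintype.card ((T.S.ι ⊕ T.S.ι) ⊕ Unit) + 1 = _
    simp only [Fintype.card_sum, Fintype.card_unit, ← T.card_succ]
    ring
  card_index := by
    rw [Fintype.card_sum, T.card_index, pow_succ]
    ring
  mat := T.stepMat
  continuous_mat := T.continuous_stepMat
  mat_act := T.stepMat_act
  orthogonal := T.orthogonal_stepMat

/-- The tower of a given height. -/
noncomputable def ofHeight : (m : ℕ) → Tower m
  | 0 => zero
  | m + 1 => (ofHeight m).step

end Tower
end

section
open Finset

/-- The exchange of the two halves of a vector. -/
def halfExchange (κ : Type) : Module.End ℝ (κ ⊕ κ → ℝ) :=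
  LinearMap.funLeft ℝ ℝ (Sum.swap : κ ⊕ κ → κ ⊕ κ)

theorem halfExchange_elim {κ : Type} (y z : κ → ℝ) :
    halfExchange κ (Sum.elim y z) = Sum.elim z y := by
  funext i
  rcases i with i | i <;> rfl

theorem halfExchange_mul_self (κ : Type) : halfExchange κ * halfExchange κ = 1 := by
  apply LinearMap.ext
  intro w
  funext i
  rcases i with i | i <;> rfl

namespace Sys
variable (X : Sys) (χ : X.Γ →* ℤˣ) (S : Sys) {κ : Type} (ρ : Representation ℝ S.Γ (κ → ℝ))

/-- The external square of a representation of the group of `S`. -/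
def pairRep : Representation ℝ (S.Γ ⋊[(1 : S.Γ →* MulAut S.Γ)] S.Γ) (κ ⊕ κ → ℝ) :=
  ρ.semi ρ 1 1 (fun _ _ _ => rfl)

/-- The representation of the group of the twisted square induced by a representation of the
group of `S`. -/
noncomputable def twRho (σ : Type) :
    Representation ℝ (twistedSquare X χ S).Γ (σ ⊕ (κ ⊕ κ) → ℝ) :=
  Representation.semi (N := S.pair.Γ) (signRep χ σ) (S.pairRep ρ) (S.twAut χ)
    ((unitsHom (halfExchange κ) (halfExchange_mul_self κ)).comp χ) (fun g n w => by
      rcases Int.units_eq_one_or (χ g) with h | h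
      · rw [MonoidHom.comp_apply, h, map_one, S.twAut_of_one h]
        rfl
      · rw [MonoidHom.comp_apply, h, unitsHom_neg_one, S.twAut_of_neg h]
        funext i
        rcases i with i | i <;> rfl)

variable (γ : (twistedSquare X χ S).Γ) (σ : Type)

theorem twRho_one (h : χ (X.twBase χ S γ) = 1) (x : σ → ℝ) (y z : κ → ℝ) :
    X.twRho χ S ρ σ γ (Sum.elim x (Sum.elim y z)) =
      Sum.elim x (Sum.elim (ρ (X.twFst χ S γ) y) (ρ (X.twSnd χ S γ) z)) := by
  have h1 : ((unitsHom (halfExchange κ) (halfExchange_mul_self κ)).comp χ) (X.twBase χ S γ) = 1 := by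
    rw [MonoidHom.comp_apply, h, map_one]
  refine (congrArg (fun L : Module.End ℝ (κ ⊕ κ → ℝ) =>
    (Sum.elim ((((χ (X.twBase χ S γ) : ℤˣ) : ℤ) : ℝ) • x)
    (S.pairRep ρ (SemidirectProduct.left γ) (L (Sum.elim y z))) : σ ⊕ (κ ⊕ κ) → ℝ)) h1).trans ?_
  rw [h]
  simp only [Units.val_one, Int.cast_one, one_smul]
  rfl

theorem twRho_neg (h : χ (X.twBase χ S γ) = -1) (x : σ → ℝ) (y z : κ → ℝ) :
    X.twRho χ S ρ σ γ (Sum.elim x (Sum.elim y z)) =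
      Sum.elim (-x) (Sum.elim (ρ (X.twFst χ S γ) z) (ρ (X.twSnd χ S γ) y)) := by
  have h1 : ((unitsHom (halfExchange κ) (halfExchange_mul_self κ)).comp χ) (X.twBase χ S γ) =
      halfExchange κ := by
    rw [MonoidHom.comp_apply, h, unitsHom_neg_one]
  refine (congrArg (fun L : Module.End ℝ (κ ⊕ κ → ℝ) =>
    (Sum.elim ((((χ (X.twBase χ S γ) : ℤˣ) : ℤ) : ℝ) • x)
    (S.pairRep ρ (SemidirectProduct.left γ) (L (Sum.elim y z))) : σ ⊕ (κ ⊕ κ) → ℝ)) h1).trans ?_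
  rw [h, halfExchange_elim]
  simp only [Units.val_neg, Units.val_one, Int.cast_neg, Int.cast_one, neg_smul, one_smul]
  rfl

end Sys

namespace Tower
open Matrix
variable {m : ℕ} (T : Tower m)

/-- The first column of the matrices. -/
def vec (z : T.S.ι → ℂ) : T.Λ → ℝ := T.mat z *ᵥ Pi.single T.origin 1

/-- The image of a first column under a transposed matrix. -/
def dir (z y : T.S.ι → ℂ) : T.Λ → ℝ := (T.mat z)ᵀ *ᵥ T.vec y

theorem continuous_vec : Continuous T.vec :=
  T.continuous_mat.matrix_mulVec continuous_const

theorem continuous_dir : Continuous fun q : (T.S.ι → ℂ) × (T.S.ι → ℂ) => T.dir q.1 q.2 :=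
  (T.continuous_mat.comp continuous_fst).matrix_transpose.matrix_mulVec
    (T.continuous_vec.comp continuous_snd)

theorem vec_act (γ : T.S.Γ) (z : T.S.ι → ℂ) :
    T.vec (T.S.cube.act γ z) = (((T.χ γ : ℤˣ) : ℤ) : ℝ) • T.vec z := by
  rw [vec, T.mat_act, smul_mulVec, vec]

theorem dir_act_left (γ : T.S.Γ) (z y : T.S.ι → ℂ) :
    T.dir (T.S.cube.act γ z) y = (((T.χ γ : ℤˣ) : ℤ) : ℝ) • T.dir z y := by
  rw [dir, T.mat_act, transpose_smul, smul_mulVec, dir]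

theorem dir_act_right (γ : T.S.Γ) (z y : T.S.ι → ℂ) :
    T.dir z (T.S.cube.act γ y) = (((T.χ γ : ℤˣ) : ℤ) : ℝ) • T.dir z y := by
  rw [dir, T.vec_act, mulVec_smul, dir]

theorem mulVec_dotProduct_mulVec_self {n : Type} [Fintype n] [DecidableEq n] {A : Matrix n n ℝ}
    (hA : Aᵀ * A = 1) (u : n → ℝ) : A *ᵥ u ⬝ᵥ A *ᵥ u = u ⬝ᵥ u := by
  rw [dotProduct_mulVec, ← mulVec_transpose, mulVec_mulVec, hA, one_mulVec]

theorem vec_dotProduct_self {z : T.S.ι → ℂ} (hz : ∀ i, ‖z i‖ = 1) :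
    T.vec z ⬝ᵥ T.vec z = 1 := by
  rw [vec, mulVec_dotProduct_mulVec_self (T.orthogonal z hz)]
  simp

theorem dir_dotProduct_self {z y : T.S.ι → ℂ} (hz : ∀ i, ‖z i‖ = 1) (hy : ∀ i, ‖y i‖ = 1) :
    T.dir z y ⬝ᵥ T.dir z y = 1 := by
  rw [dir, mulVec_dotProduct_mulVec_self, T.vec_dotProduct_self hy]
  rw [transpose_transpose]
  exact mul_eq_one_comm.mp (T.orthogonal z hz)

end Tower

theorem norm_le_one_of_dotProduct_self {Λ : Type} [Fintype Λ] {v : Λ → ℝ} (hv : v ⬝ᵥ v = 1) :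
    ‖v‖ ≤ 1 := by
  rw [pi_norm_le_iff_of_nonneg zero_le_one]
  intro i
  have h : v i * v i ≤ v ⬝ᵥ v := single_le_sum (f := fun i => v i * v i)
    (fun i _ => mul_self_nonneg _) (mem_univ i)
  rw [Real.norm_eq_abs, abs_le_one_iff_mul_self_le_one]
  linarith

theorem one_le_card_mul_norm {Λ : Type} [Fintype Λ] {v : Λ → ℝ} (hv : v ⬝ᵥ v = 1) :
    1 ≤ (Fintype.card Λ : ℝ) * ‖v‖ := by
  have h : v ⬝ᵥ v ≤ ∑ _i : Λ, ‖v‖ := sum_le_sum fun i _ => by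
    have h1 := norm_le_pi_norm v i
    have h2 := norm_le_one_of_dotProduct_self hv
    rw [Real.norm_eq_abs] at h1
    rw [← abs_mul_abs_self]
    nlinarith [abs_nonneg (v i)]
  rw [hv, sum_const, card_univ, nsmul_eq_mul] at h
  exact h

end

section
open Finset

/-- The equations to be solved over a tower. -/
structure Tower.Data {m : ℕ} (T : Tower m) where
  /-- The dimension of the target. -/
  N : ℕ
  /-- The number of linear equations. -/
  d : ℕ
  /-- The map whose multiplicities are sought. -/
  f : (T.Λ → ℝ) → Fin N → ℝ
  continuous_f : Continuous f
  f_neg : ∀ z, f (-z) = f z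
  /-- The bilinear equation. -/
  herm : (T.Λ → ℝ) →ₗ[ℝ] (T.Λ → ℝ) →ₗ[ℝ] Fin 2 → ℝ
  continuous_herm : Continuous fun q : (T.Λ → ℝ) × (T.Λ → ℝ) => herm q.1 q.2
  /-- The linear equations. -/
  rest : (T.Λ → ℝ) →ₗ[ℝ] Fin d → ℝ
  /-- The splitting of the coordinates. -/
  index : T.S.ι ≃ Fin N ⊕ Fin 2

namespace Tower.Data
variable {m : ℕ} {T : Tower m} (D : T.Data)

/-- The vector with given components. -/
def glue (a : Fin D.N → ℝ) (b : Fin 2 → ℝ) : T.S.ι → ℝ := fun i => Sum.elim a b (D.index i)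

theorem glue_eq_zero {a : Fin D.N → ℝ} {b : Fin 2 → ℝ} (h : D.glue a b = 0) : a = 0 ∧ b = 0 := by
  constructor
  · funext i
    simpa [glue] using congrFun h (D.index.symm (.inl i))
  · funext i
    simpa [glue] using congrFun h (D.index.symm (.inr i))

theorem glue_neg (a : Fin D.N → ℝ) (b : Fin 2 → ℝ) : D.glue (-a) (-b) = -D.glue a b := by
  funext i
  simp only [glue, Pi.neg_apply]
  cases D.index i <;> rfl

theorem continuous_glue {X : Type} [TopologicalSpace X] {a : X → Fin D.N → ℝ} {b : X → Fin 2 → ℝ}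
    (ha : Continuous a) (hb : Continuous b) : Continuous fun x => D.glue (a x) (b x) := by
  refine continuous_pi fun i => ?_
  simp only [glue]
  cases D.index i with
  | inl j => exact (continuous_apply j).comp ha
  | inr j => exact (continuous_apply j).comp hb

/-- A family of equations whose solutions are configurations of `2 ^ i` distinct points with
equal values, clustered around a given point. -/
structure Config (i : ℕ) where
  /-- The system. -/
  S : Sys
  /-- The index type of the auxiliary equations. -/
  κ : Type
  [fintypeκ : Fintype κ]
  card_κ : Fintype.card κ + D.d = 2 ^ i * D.d
  /-- The representation on the auxiliary equations. -/
  ρ : Representation ℝ S.Γ (κ → ℝ)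
  /-- The index type of the points. -/
  J : Type
  [fintypeJ : Fintype J]
  card_J : Fintype.card J = 2 ^ i
  /-- The sum of the values. -/
  sum : (T.S.ι → ℂ) → (S.ι → ℂ) → (T.Λ → ℝ) → ℝ → Fin D.N → ℝ
  /-- The main equations. -/
  main : (T.S.ι → ℂ) → (S.ι → ℂ) → (T.Λ → ℝ) → ℝ → S.ι → ℝ
  /-- The auxiliary equations. -/
  aux : (T.S.ι → ℂ) → (S.ι → ℂ) → κ → ℝ
  continuous_sum : Continuous fun q : (T.S.ι → ℂ) × (S.ι → ℂ) × (T.Λ → ℝ) × ℝ =>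
    sum q.1 q.2.1 q.2.2.1 q.2.2.2
  continuous_main : Continuous fun q : (T.S.ι → ℂ) × (S.ι → ℂ) × (T.Λ → ℝ) × ℝ =>
    main q.1 q.2.1 q.2.2.1 q.2.2.2
  continuous_aux : Continuous fun q : (T.S.ι → ℂ) × (S.ι → ℂ) => aux q.1 q.2
  sum_act : ∀ γ ξ ω z δ, sum ξ (S.cube.act γ ω) z δ = sum ξ ω z δ
  main_act : ∀ γ ξ ω z δ, main ξ (S.cube.act γ ω) z δ = S.rep γ (main ξ ω z δ)
  aux_act : ∀ γ ξ ω, aux ξ (S.cube.act γ ω) = ρ γ (aux ξ ω)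
  sum_base : ∀ γ ξ ω z δ, sum (T.S.cube.act γ ξ) ω ((((T.χ γ : ℤˣ) : ℤ) : ℝ) • z) δ = sum ξ ω z δ
  main_base : ∀ γ ξ ω z δ,
    main (T.S.cube.act γ ξ) ω ((((T.χ γ : ℤˣ) : ℤ) : ℝ) • z) δ = main ξ ω z δ
  aux_base : ∀ γ ξ ω, aux (T.S.cube.act γ ξ) ω = (((T.χ γ : ℤˣ) : ℤ) : ℝ) • aux ξ ω
  exists_points : ∀ ξ ω z δ, (∀ i, ‖ξ i‖ = 1) → (∀ i, ‖ω i‖ = 1) → 0 < δ → main ξ ω z δ = 0 →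
    aux ξ ω = 0 → ∃ (P : J → T.Λ → ℝ) (c : Fin D.N → ℝ), Function.Injective P ∧
      (∀ l, D.f (P l) = c) ∧ sum ξ ω z δ = (2 : ℝ) ^ i • c ∧
      ∀ l, D.rest (P l - z) = 0 ∧ D.herm (T.vec ξ) (P l - z) = 0 ∧ ‖P l - z‖ ≤ 2 * δ

attribute [instance] Config.fintypeκ Config.fintypeJ

theorem f_units_smul (a : ℤˣ) (z : T.Λ → ℝ) : D.f (((a : ℤ) : ℝ) • z) = D.f z := by
  rcases Int.units_eq_one_or a with rfl | rfl <;> simp [D.f_neg]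

namespace Config

/-- The configurations consisting of one point. -/
def zero : D.Config 0 where
  S := Sys.point
  κ := Empty
  card_κ := by simp
  ρ := 1
  J := Unit
  card_J := rfl
  sum _ _ z _ := D.f z
  main _ _ _ _ := 0
  aux _ _ := 0
  continuous_sum := D.continuous_f.comp (by fun_prop)
  continuous_main := continuous_const
  continuous_aux := continuous_const
  sum_act _ _ _ _ _ := rfl
  main_act _ _ _ _ _ := (map_zero _).symm
  aux_act _ _ _ := (map_zero _).symm
  sum_base _ _ _ _ _ := D.f_units_smul _ _
  main_base _ _ _ _ _ := rfl
  aux_base _ _ _ := (smul_zero _).symm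
  exists_points ξ ω z δ _ _ hδ _ _ := by
    refine ⟨fun _ => z, D.f z, fun _ _ _ => rfl, fun _ => rfl, by simp, fun _ => ?_⟩
    simp [hδ.le]

variable {D} {i : ℕ} (C : D.Config i)

/-- The scale of the next configurations. -/
noncomputable def scale (T : Tower m) : ℝ := 1 / (4 * Fintype.card T.Λ)

/-- The first value sum of the next configurations. -/
noncomputable def sumFst (ξ y : T.S.ι → ℂ) (ω : C.S.ι → ℂ) (z : T.Λ → ℝ) (δ : ℝ) :
    Fin D.N → ℝ := C.sum ξ ω (z + δ • T.dir ξ y) (δ * scale T)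

/-- The second value sum of the next configurations. -/
noncomputable def sumSnd (ξ y : T.S.ι → ℂ) (ω : C.S.ι → ℂ) (z : T.Λ → ℝ) (δ : ℝ) :
    Fin D.N → ℝ := C.sum ξ ω (z - δ • T.dir ξ y) (δ * scale T)

/-- The main equations of the next configurations. -/
noncomputable def stepMain (ξ y : T.S.ι → ℂ) (ω ω' : C.S.ι → ℂ) (z : T.Λ → ℝ) (δ : ℝ) :
    T.S.ι ⊕ (C.S.ι ⊕ C.S.ι) → ℝ :=
  Sum.elim (D.glue (C.sumFst ξ y ω z δ - C.sumSnd ξ y ω' z δ) (D.herm (T.vec ξ) (T.dir ξ y)))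
    (Sum.elim (C.main ξ ω (z + δ • T.dir ξ y) (δ * scale T))
      (C.main ξ ω' (z - δ • T.dir ξ y) (δ * scale T)))

/-- The auxiliary equations of the next configurations. -/
def stepAux (ξ y : T.S.ι → ℂ) (ω ω' : C.S.ι → ℂ) : Fin D.d ⊕ (C.κ ⊕ C.κ) → ℝ :=
  Sum.elim (D.rest (T.dir ξ y)) (Sum.elim (C.aux ξ ω) (C.aux ξ ω'))

theorem step_points {ξ y : T.S.ι → ℂ} {ω ω' : C.S.ι → ℂ} {z : T.Λ → ℝ} {δ : ℝ}
    (hξ : ∀ i, ‖ξ i‖ = 1) (hy : ∀ i, ‖y i‖ = 1) (hω : ∀ i, ‖ω i‖ = 1) (hω' : ∀ i, ‖ω' i‖ = 1)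
    (hδ : 0 < δ) (hmain : C.stepMain ξ y ω ω' z δ = 0) (haux : C.stepAux ξ y ω ω' = 0) :
    ∃ (P : C.J ⊕ C.J → T.Λ → ℝ) (c : Fin D.N → ℝ), Function.Injective P ∧
      (∀ l, D.f (P l) = c) ∧
      C.sumFst ξ y ω z δ + C.sumSnd ξ y ω' z δ = (2 : ℝ) ^ (i + 1) • c ∧
      ∀ l, D.rest (P l - z) = 0 ∧ D.herm (T.vec ξ) (P l - z) = 0 ∧ ‖P l - z‖ ≤ 2 * δ := by
  have hv := T.dir_dotProduct_self hξ hy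
  have hv1 := norm_le_one_of_dotProduct_self hv
  have hv2 := one_le_card_mul_norm hv
  have hM : (1 : ℝ) ≤ Fintype.card T.Λ := by
    exact_mod_cast Fintype.card_pos_iff.mpr ⟨T.origin⟩
  have hs : 0 < scale T := by unfold scale; positivity
  have hs1 : scale T ≤ 1 / 4 := by
    unfold scale
    rw [div_le_div_iff₀ (by positivity) (by norm_num)]
    linarith
  have hs2 : 4 * scale T ≤ ‖T.dir ξ y‖ := by
    unfold scale
    rw [mul_one_div, div_le_iff₀ (by positivity)]
    nlinarith
  have hδ' : 0 < δ * scale T := mul_pos hδ hs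
  obtain ⟨hsum, hherm⟩ := D.glue_eq_zero (funext fun j => congrFun hmain (.inl j))
  have hrest : D.rest (T.dir ξ y) = 0 := funext fun j => congrFun haux (.inl j)
  obtain ⟨P, c, hP, hPc, hc, hPz⟩ := C.exists_points ξ ω _ _ hξ hω hδ'
    (funext fun j => congrFun hmain (.inr (.inl j))) (funext fun j => congrFun haux (.inr (.inl j)))
  obtain ⟨Q, c', hQ, hQc, hc', hQz⟩ := C.exists_points ξ ω' _ _ hξ hω' hδ'
    (funext fun j => congrFun hmain (.inr (.inr j))) (funext fun j => congrFun haux (.inr (.inr j)))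
  change C.sumFst ξ y ω z δ = _ at hc
  change C.sumSnd ξ y ω' z δ = _ at hc'
  have hcc : c = c' := by
    rw [hc, hc', ← smul_sub, smul_eq_zero, sub_eq_zero] at hsum
    exact hsum.resolve_left (by positivity)
  subst hcc
  have hnd : ‖δ • T.dir ξ y‖ = δ * ‖T.dir ξ y‖ := by rw [norm_smul, Real.norm_of_nonneg hδ.le]
  refine ⟨Sum.elim P Q, c, hP.sumElim hQ fun l l' h => ?_, ?_, ?_, ?_⟩
  · have h1 : (2 : ℝ) • δ • T.dir ξ y = (Q l' - (z - δ • T.dir ξ y)) - (P l - (z + δ • T.dir ξ y)) := by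
      rw [h, two_smul]
      abel
    have h2 : 2 * (δ * ‖T.dir ξ y‖) ≤ 2 * (δ * scale T) + 2 * (δ * scale T) := by
      rw [← hnd, ← Real.norm_of_nonneg (zero_le_two (α := ℝ)), ← norm_smul, h1,
        Real.norm_of_nonneg (zero_le_two (α := ℝ))]
      exact (norm_sub_le _ _).trans (add_le_add (hQz l').2.2 (hPz l).2.2)
    nlinarith
  · rintro (l | l)
    exacts [hPc l, hQc l]
  · rw [hc, hc', ← two_smul ℝ, smul_smul, pow_succ']
  · rintro (l | l)
    · obtain ⟨h1, h2, h3⟩ := hPz l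
      have h4 : P l - z = (P l - (z + δ • T.dir ξ y)) + δ • T.dir ξ y := by abel
      rw [Sum.elim_inl, h4, map_add, map_add, h1, h2, map_smul, map_smul, hrest, hherm]
      refine ⟨by simp, by simp, (norm_add_le _ _).trans ?_⟩
      nlinarith
    · obtain ⟨h1, h2, h3⟩ := hQz l
      have h4 : Q l - z = (Q l - (z - δ • T.dir ξ y)) - δ • T.dir ξ y := by abel
      rw [Sum.elim_inr, h4, map_sub D.rest (Q l - _), map_sub (D.herm (T.vec ξ)) (Q l - _), h1, h2, map_smul, map_smul, hrest, hherm]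
      refine ⟨by simp, by simp, (norm_sub_le _ _).trans ?_⟩
      nlinarith

end Config
end Tower.Data
end

section
open Finset

namespace Tower.Data.Config
variable {m : ℕ} {T : Tower m} {D : T.Data} {i : ℕ} (C : D.Config i)

theorem continuous_sumFst {X : Type} [TopologicalSpace X] {ξ y : X → T.S.ι → ℂ}
    {ω : X → C.S.ι → ℂ} {z : X → T.Λ → ℝ} {δ : X → ℝ} (hξ : Continuous ξ) (hy : Continuous y)
    (hω : Continuous ω) (hz : Continuous z) (hδ : Continuous δ) :
    Continuous fun x => C.sumFst (ξ x) (y x) (ω x) (z x) (δ x) :=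
  C.continuous_sum.comp (hξ.prodMk (hω.prodMk
    ((hz.add (hδ.smul (T.continuous_dir.comp (hξ.prodMk hy)))).prodMk (hδ.mul continuous_const))))

theorem continuous_sumSnd {X : Type} [TopologicalSpace X] {ξ y : X → T.S.ι → ℂ}
    {ω : X → C.S.ι → ℂ} {z : X → T.Λ → ℝ} {δ : X → ℝ} (hξ : Continuous ξ) (hy : Continuous y)
    (hω : Continuous ω) (hz : Continuous z) (hδ : Continuous δ) :
    Continuous fun x => C.sumSnd (ξ x) (y x) (ω x) (z x) (δ x) :=
  C.continuous_sum.comp (hξ.prodMk (hω.prodMk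
    ((hz.sub (hδ.smul (T.continuous_dir.comp (hξ.prodMk hy)))).prodMk (hδ.mul continuous_const))))

theorem continuous_sumElim {X α β : Type} [TopologicalSpace X] {f : X → α → ℝ} {g : X → β → ℝ}
    (hf : Continuous f) (hg : Continuous g) :
    Continuous fun x => (Sum.elim (f x) (g x) : α ⊕ β → ℝ) := by
  refine continuous_pi fun j => ?_
  rcases j with j | j
  exacts [(continuous_apply j).comp hf, (continuous_apply j).comp hg]

theorem continuous_stepMain {X : Type} [TopologicalSpace X] {ξ y : X → T.S.ι → ℂ}
    {ω ω' : X → C.S.ι → ℂ} {z : X → T.Λ → ℝ} {δ : X → ℝ} (hξ : Continuous ξ) (hy : Continuous y)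
    (hω : Continuous ω) (hω' : Continuous ω') (hz : Continuous z) (hδ : Continuous δ) :
    Continuous fun x => C.stepMain (ξ x) (y x) (ω x) (ω' x) (z x) (δ x) := by
  refine continuous_sumElim (D.continuous_glue ((C.continuous_sumFst hξ hy hω hz hδ).sub
    (C.continuous_sumSnd hξ hy hω' hz hδ)) ?_) (continuous_sumElim ?_ ?_)
  · exact D.continuous_herm.comp ((T.continuous_vec.comp hξ).prodMk
      (T.continuous_dir.comp (hξ.prodMk hy)))
  · exact C.continuous_main.comp (hξ.prodMk (hω.prodMk
      ((hz.add (hδ.smul (T.continuous_dir.comp (hξ.prodMk hy)))).prodMk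
        (hδ.mul continuous_const))))
  · exact C.continuous_main.comp (hξ.prodMk (hω'.prodMk
      ((hz.sub (hδ.smul (T.continuous_dir.comp (hξ.prodMk hy)))).prodMk
        (hδ.mul continuous_const))))

theorem continuous_stepAux {X : Type} [TopologicalSpace X] {ξ y : X → T.S.ι → ℂ}
    {ω ω' : X → C.S.ι → ℂ} (hξ : Continuous ξ) (hy : Continuous y)
    (hω : Continuous ω) (hω' : Continuous ω') :
    Continuous fun x => C.stepAux (ξ x) (y x) (ω x) (ω' x) :=
  continuous_sumElim
    (D.rest.continuous_of_finiteDimensional.comp (T.continuous_dir.comp (hξ.prodMk hy)))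
    (continuous_sumElim (C.continuous_aux.comp (hξ.prodMk hω))
      (C.continuous_aux.comp (hξ.prodMk hω')))

section
variable {γ : T.S.Γ} (ξ y : T.S.ι → ℂ) (ω ω' : C.S.ι → ℂ) (z : T.Λ → ℝ) (δ : ℝ) (γ₁ γ₂ : C.S.Γ)

theorem dir_act_right_of_one (h : T.χ γ = 1) : T.dir ξ (T.S.cube.act γ y) = T.dir ξ y := by
  rw [T.dir_act_right, h]
  simp

theorem dir_act_right_of_neg (h : T.χ γ = -1) : T.dir ξ (T.S.cube.act γ y) = -T.dir ξ y := by
  rw [T.dir_act_right, h]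
  simp

theorem sumFst_of_one (h : T.χ γ = 1) :
    C.sumFst ξ (T.S.cube.act γ y) (C.S.cube.act γ₁ ω) z δ = C.sumFst ξ y ω z δ := by
  rw [sumFst, dir_act_right_of_one _ _ h, C.sum_act, sumFst]

theorem sumSnd_of_one (h : T.χ γ = 1) :
    C.sumSnd ξ (T.S.cube.act γ y) (C.S.cube.act γ₁ ω) z δ = C.sumSnd ξ y ω z δ := by
  rw [sumSnd, dir_act_right_of_one _ _ h, C.sum_act, sumSnd]

theorem sumFst_of_neg (h : T.χ γ = -1) :
    C.sumFst ξ (T.S.cube.act γ y) (C.S.cube.act γ₁ ω) z δ = C.sumSnd ξ y ω z δ := by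
  rw [sumFst, dir_act_right_of_neg _ _ h, C.sum_act, sumSnd, smul_neg, sub_eq_add_neg]

theorem sumSnd_of_neg (h : T.χ γ = -1) :
    C.sumSnd ξ (T.S.cube.act γ y) (C.S.cube.act γ₁ ω) z δ = C.sumFst ξ y ω z δ := by
  rw [sumSnd, dir_act_right_of_neg _ _ h, C.sum_act, sumFst, smul_neg, sub_neg_eq_add]

theorem rep_of_one (h : T.χ γ = 1) (w : T.S.ι → ℝ) : T.S.rep γ w = w := by
  rw [T.rep_apply, h]
  simp

theorem rep_of_neg (h : T.χ γ = -1) (w : T.S.ι → ℝ) : T.S.rep γ w = -w := by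
  rw [T.rep_apply, h]
  simp

theorem stepMain_of_one (h : T.χ γ = 1) :
    C.stepMain ξ (T.S.cube.act γ y) (C.S.cube.act γ₁ ω) (C.S.cube.act γ₂ ω') z δ =
      Sum.elim (T.S.rep γ fun j => C.stepMain ξ y ω ω' z δ (.inl j))
        (Sum.elim (C.S.rep γ₁ fun j => C.stepMain ξ y ω ω' z δ (.inr (.inl j)))
          (C.S.rep γ₂ fun j => C.stepMain ξ y ω ω' z δ (.inr (.inr j)))) := by
  rw [rep_of_one h, stepMain, C.sumFst_of_one _ _ _ _ _ _ h, C.sumSnd_of_one _ _ _ _ _ _ h,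
    dir_act_right_of_one _ _ h, C.main_act, C.main_act]
  rfl

theorem stepMain_of_neg (h : T.χ γ = -1) :
    C.stepMain ξ (T.S.cube.act γ y) (C.S.cube.act γ₁ ω') (C.S.cube.act γ₂ ω) z δ =
      Sum.elim (T.S.rep γ fun j => C.stepMain ξ y ω ω' z δ (.inl j))
        (Sum.elim (C.S.rep γ₁ fun j => C.stepMain ξ y ω ω' z δ (.inr (.inr j)))
          (C.S.rep γ₂ fun j => C.stepMain ξ y ω ω' z δ (.inr (.inl j)))) := by
  rw [rep_of_neg h, stepMain, C.sumFst_of_neg _ _ _ _ _ _ h, C.sumSnd_of_neg _ _ _ _ _ _ h,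
    dir_act_right_of_neg _ _ h, C.main_act, C.main_act, smul_neg, sub_neg_eq_add, ← sub_eq_add_neg,
    map_neg, ← neg_sub (C.sumFst ξ y ω z δ), D.glue_neg]
  rfl

theorem sumFst_base : C.sumFst (T.S.cube.act γ ξ) y ω ((((T.χ γ : ℤˣ) : ℤ) : ℝ) • z) δ =
    C.sumFst ξ y ω z δ := by
  rw [sumFst, T.dir_act_left, smul_comm, ← smul_add, C.sum_base, sumFst]

theorem sumSnd_base : C.sumSnd (T.S.cube.act γ ξ) y ω ((((T.χ γ : ℤˣ) : ℤ) : ℝ) • z) δ =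
    C.sumSnd ξ y ω z δ := by
  rw [sumSnd, T.dir_act_left, smul_comm, ← smul_sub, C.sum_base, sumSnd]

theorem stepMain_base :
    C.stepMain (T.S.cube.act γ ξ) y ω ω' ((((T.χ γ : ℤˣ) : ℤ) : ℝ) • z) δ =
      C.stepMain ξ y ω ω' z δ := by
  rw [stepMain, C.sumFst_base, C.sumSnd_base, T.vec_act, T.dir_act_left, smul_comm δ, ← smul_add,
    ← smul_sub, C.main_base, C.main_base, map_smul, map_smul, LinearMap.smul_apply, smul_smul,
    Sys.units_mul_self, one_smul, stepMain]

theorem stepAux_base : C.stepAux (T.S.cube.act γ ξ) y ω ω' =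
    (((T.χ γ : ℤˣ) : ℤ) : ℝ) • C.stepAux ξ y ω ω' := by
  rw [stepAux, T.dir_act_left, C.aux_base, C.aux_base, map_smul]
  funext j
  rcases j with j | j | j <;> rfl

theorem stepAux_of_one (h : T.χ γ = 1) :
    C.stepAux ξ (T.S.cube.act γ y) (C.S.cube.act γ₁ ω) (C.S.cube.act γ₂ ω') =
      Sum.elim (D.rest (T.dir ξ y))
        (Sum.elim (C.ρ γ₁ (C.aux ξ ω)) (C.ρ γ₂ (C.aux ξ ω'))) := by
  rw [stepAux, dir_act_right_of_one _ _ h, C.aux_act, C.aux_act]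

theorem stepAux_of_neg (h : T.χ γ = -1) :
    C.stepAux ξ (T.S.cube.act γ y) (C.S.cube.act γ₁ ω') (C.S.cube.act γ₂ ω) =
      Sum.elim (-D.rest (T.dir ξ y))
        (Sum.elim (C.ρ γ₁ (C.aux ξ ω')) (C.ρ γ₂ (C.aux ξ ω))) := by
  rw [stepAux, dir_act_right_of_neg _ _ h, C.aux_act, C.aux_act, map_neg]

end

/-- A function of three vectors as a function of their concatenation. -/
def uncurryElim {α β M : Type} (F : (α → ℂ) → (β → ℂ) → (β → ℂ) → M) (w : α ⊕ (β ⊕ β) → ℂ) : M :=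
  F (fun j => w (.inl j)) (fun j => w (.inr (.inl j))) fun j => w (.inr (.inr j))

/-- The configurations with twice as many points. -/
noncomputable def step : D.Config (i + 1) where
  S := Sys.twistedSquare T.S T.χ C.S
  κ := Fin D.d ⊕ (C.κ ⊕ C.κ)
  card_κ := by
    have := C.card_κ
    simp only [Fintype.card_sum, Fintype.card_fin, pow_succ]
    linarith
  ρ := Sys.twRho T.S T.χ C.S C.ρ (Fin D.d)
  J := C.J ⊕ C.J
  card_J := by
    rw [Fintype.card_sum, C.card_J, pow_succ]
    ring
  sum ξ ω z δ := uncurryElim (fun y w w' => C.sumFst ξ y w z δ + C.sumSnd ξ y w' z δ) ω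
  main ξ ω z δ := uncurryElim (fun y w w' => C.stepMain ξ y w w' z δ) ω
  aux ξ ω := uncurryElim (fun y w w' => C.stepAux ξ y w w') ω
  continuous_sum := by
    refine (C.continuous_sumFst ?_ ?_ ?_ ?_ ?_).add (C.continuous_sumSnd ?_ ?_ ?_ ?_ ?_) <;> fun_prop
  continuous_main := by
    refine C.continuous_stepMain ?_ ?_ ?_ ?_ ?_ ?_ <;> fun_prop
  continuous_aux := by
    refine C.continuous_stepAux ?_ ?_ ?_ ?_ <;> fun_prop
  sum_act γ ξ ω z δ := by
    obtain ⟨y, w, w', rfl⟩ : ∃ (y : T.S.ι → ℂ) (w w' : C.S.ι → ℂ),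
        ω = Sum.elim y (Sum.elim w w') :=
      ⟨fun j => ω (.inl j), fun j => ω (.inr (.inl j)), fun j => ω (.inr (.inr j)), by
        funext j; rcases j with j | j | j <;> rfl⟩
    rcases Int.units_eq_one_or (T.χ (T.S.twBase T.χ C.S γ)) with h | h
    · refine (congrArg (uncurryElim (fun y w w' => C.sumFst ξ y w z δ + C.sumSnd ξ y w' z δ))
        (Sys.twistedSquare_act_one T.S T.χ C.S γ h y w w')).trans ?_
      exact congrArg₂ (· + ·) (C.sumFst_of_one _ _ _ _ _ _ h) (C.sumSnd_of_one _ _ _ _ _ _ h)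
    · refine (congrArg (uncurryElim (fun y w w' => C.sumFst ξ y w z δ + C.sumSnd ξ y w' z δ))
        (Sys.twistedSquare_act_neg T.S T.χ C.S γ h y w w')).trans ?_
      exact (congrArg₂ (· + ·) (C.sumFst_of_neg _ _ _ _ _ _ h)
        (C.sumSnd_of_neg _ _ _ _ _ _ h)).trans (add_comm _ _)
  main_act γ ξ ω z δ := by
    obtain ⟨y, w, w', rfl⟩ : ∃ (y : T.S.ι → ℂ) (w w' : C.S.ι → ℂ),
        ω = Sum.elim y (Sum.elim w w') :=
      ⟨fun j => ω (.inl j), fun j => ω (.inr (.inl j)), fun j => ω (.inr (.inr j)), by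
        funext j; rcases j with j | j | j <;> rfl⟩
    rcases Int.units_eq_one_or (T.χ (T.S.twBase T.χ C.S γ)) with h | h
    · refine (congrArg (uncurryElim (fun y w w' => C.stepMain ξ y w w' z δ))
        (Sys.twistedSquare_act_one T.S T.χ C.S γ h y w w')).trans ?_
      exact (C.stepMain_of_one _ _ _ _ _ _ _ _ h).trans
        (Sys.twistedSquare_rep_one T.S T.χ C.S γ h _ _ _).symm
    · refine (congrArg (uncurryElim (fun y w w' => C.stepMain ξ y w w' z δ))
        (Sys.twistedSquare_act_neg T.S T.χ C.S γ h y w w')).trans ?_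
      exact (C.stepMain_of_neg _ _ _ _ _ _ _ _ h).trans
        (Sys.twistedSquare_rep_neg T.S T.χ C.S γ h _ _ _).symm
  aux_act γ ξ ω := by
    obtain ⟨y, w, w', rfl⟩ : ∃ (y : T.S.ι → ℂ) (w w' : C.S.ι → ℂ),
        ω = Sum.elim y (Sum.elim w w') :=
      ⟨fun j => ω (.inl j), fun j => ω (.inr (.inl j)), fun j => ω (.inr (.inr j)), by
        funext j; rcases j with j | j | j <;> rfl⟩
    rcases Int.units_eq_one_or (T.χ (T.S.twBase T.χ C.S γ)) with h | h
    · refine (congrArg (uncurryElim (fun y w w' => C.stepAux ξ y w w'))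
        (Sys.twistedSquare_act_one T.S T.χ C.S γ h y w w')).trans ?_
      exact (C.stepAux_of_one _ _ _ _ _ _ h).trans (Sys.twRho_one T.S T.χ C.S C.ρ γ _ h _ _ _).symm
    · refine (congrArg (uncurryElim (fun y w w' => C.stepAux ξ y w w'))
        (Sys.twistedSquare_act_neg T.S T.χ C.S γ h y w w')).trans ?_
      exact (C.stepAux_of_neg _ _ _ _ _ _ h).trans (Sys.twRho_neg T.S T.χ C.S C.ρ γ _ h _ _ _).symm
  sum_base γ ξ ω z δ := congrArg₂ (· + ·) (C.sumFst_base _ _ _ _ _) (C.sumSnd_base _ _ _ _ _)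
  main_base γ ξ ω z δ := C.stepMain_base _ _ _ _ _ _
  aux_base γ ξ ω := C.stepAux_base _ _ _ _
  exists_points ξ ω z δ hξ hω hδ hm ha :=
    C.step_points hξ (fun _ => hω _) (fun _ => hω _) (fun _ => hω _) hδ hm ha

/-- The configurations of `2 ^ i` points. -/
noncomputable def ofLevel (D : T.Data) : (i : ℕ) → D.Config i
  | 0 => zero D
  | i + 1 => (ofLevel D i).step

end Tower.Data.Config
end

section
open Finset Matrix

/-- Extension of a representation on a part of the coordinates by the trivial representation. -/
def Representation.extend {Γ ι κ μ : Type} [Group Γ] (ρ : Representation ℝ Γ (κ → ℝ))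
    (e : ι ≃ κ ⊕ μ) : Representation ℝ Γ (ι → ℝ) where
  toFun γ :=
    { toFun w j := Sum.elim (ρ γ fun x => w (e.symm (.inl x))) (fun x => w (e.symm (.inr x))) (e j)
      map_add' v w := by
        funext j
        have h : (fun x => v (e.symm (.inl x)) + w (e.symm (.inl x))) =
          (fun x => v (e.symm (.inl x))) + fun x => w (e.symm (.inl x)) := rfl
        simp only [Pi.add_apply, h, map_add]
        cases e j <;> rfl
      map_smul' c w := by
        funext j
        have h : (fun x => c • w (e.symm (.inl x))) = c • fun x => w (e.symm (.inl x)) := rfl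
        simp only [Pi.smul_apply, h, map_smul, RingHom.id_apply]
        cases e j <;> rfl }
  map_one' := by
    refine LinearMap.ext fun w => funext fun j => ?_
    obtain ⟨j, rfl⟩ := e.symm.surjective j
    rcases j with j | j <;> simp
  map_mul' γ γ' := by
    refine LinearMap.ext fun w => funext fun j => ?_
    obtain ⟨j, rfl⟩ := e.symm.surjective j
    rcases j with j | j <;> simp

theorem Representation.extend_apply {Γ ι κ μ : Type} [Group Γ] (ρ : Representation ℝ Γ (κ → ℝ))
    (e : ι ≃ κ ⊕ μ) (γ : Γ) (a : κ → ℝ) (b : μ → ℝ) :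
    ρ.extend e γ (fun j => Sum.elim a b (e j)) = fun j => Sum.elim (ρ γ a) b (e j) := by
  funext j
  simp [Representation.extend]

namespace Tower.Data
variable {m : ℕ} {T : Tower m} (D : T.Data)

/-- There are `2 ^ i` distinct points with equal values close to some point of the unit sphere. -/
theorem exists_points {i : ℕ} (hi : 2 ^ i * D.d ≤ Fintype.card T.S.ι) {δ : ℝ} (hδ : 0 < δ) :
    ∃ (x : T.Λ → ℝ) (P : Fin (2 ^ i) → T.Λ → ℝ), x ⬝ᵥ x = 1 ∧ D.rest x = 0 ∧
      Function.Injective P ∧ (∀ l l', D.f (P l) = D.f (P l')) ∧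
      ∀ l, D.rest (P l) = 0 ∧ D.herm x (P l - x) = 0 ∧ ‖P l - x‖ ≤ 2 * δ := by
  let C := Config.ofLevel D i
  have hcard : Fintype.card T.S.ι =
      Fintype.card (C.κ ⊕ (Fin D.d ⊕ Fin (Fintype.card T.S.ι - 2 ^ i * D.d))) := by
    have := C.card_κ
    simp only [Fintype.card_sum, Fintype.card_fin]
    omega
  let e := Fintype.equivOfCardEq hcard
  let S := Sys.fib C.S T.S 1 (CubeAction.trivial _ _) (C.ρ.extend e) (fun _ _ _ => rfl)
    (fun g n w => by simp only [T.rep_apply, map_smul]; rfl)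
  let Φ : (C.S.ι ⊕ T.S.ι → ℂ) → C.S.ι ⊕ T.S.ι → ℝ := fun w =>
    Sum.elim (C.main (fun j => w (.inr j)) (fun j => w (.inl j)) (T.vec fun j => w (.inr j)) δ)
      fun j => Sum.elim (C.aux (fun j => w (.inr j)) (fun j => w (.inl j)))
        (Sum.elim (D.rest (T.vec fun j => w (.inr j))) 0) (e j)
  have hl : Continuous fun w : C.S.ι ⊕ T.S.ι → ℂ => fun j => w (Sum.inl j) := by fun_prop
  have hr : Continuous fun w : C.S.ι ⊕ T.S.ι → ℂ => fun j => w (Sum.inr j) := by fun_prop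
  have hΦ : Continuous Φ := by
    refine Config.continuous_sumElim (C.continuous_main.comp (hr.prodMk (hl.prodMk
      ((T.continuous_vec.comp hr).prodMk continuous_const)))) ?_
    have : Continuous fun w : C.S.ι ⊕ T.S.ι → ℂ =>
        (Sum.elim (C.aux (fun j => w (.inr j)) (fun j => w (.inl j)))
        (Sum.elim (D.rest (T.vec fun j => w (.inr j))) 0) :
        C.κ ⊕ (Fin D.d ⊕ Fin (Fintype.card T.S.ι - 2 ^ i * D.d)) → ℝ) :=
      Config.continuous_sumElim (C.continuous_aux.comp (hr.prodMk hl))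
        (Config.continuous_sumElim (D.rest.continuous_of_finiteDimensional.comp
          (T.continuous_vec.comp hr)) continuous_const)
    exact continuous_pi fun j => (continuous_apply (e j)).comp this
  have heq : ∀ γ z, Φ (S.cube.act γ z) = S.rep γ (Φ z) := by
    intro γ z
    obtain ⟨ω, ξ, rfl⟩ : ∃ (ω : C.S.ι → ℂ) (ξ : T.S.ι → ℂ), z = Sum.elim ω ξ :=
      ⟨_, _, (Sum.elim_comp_inl_inr z).symm⟩
    have h1 : C.main (T.S.cube.act γ.left ξ) (C.S.cube.act γ.right ω)
        (T.vec (T.S.cube.act γ.left ξ)) δ = C.S.rep γ.right (C.main ξ ω (T.vec ξ) δ) := by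
      rw [T.vec_act, C.main_base, C.main_act]
    have h2 : (fun j => Sum.elim (C.aux (T.S.cube.act γ.left ξ) (C.S.cube.act γ.right ω))
        (Sum.elim (D.rest (T.vec (T.S.cube.act γ.left ξ))) 0) (e j)) =
        T.S.rep γ.left (C.ρ.extend e γ.right fun j => Sum.elim (C.aux ξ ω)
          (Sum.elim (D.rest (T.vec ξ)) 0) (e j)) := by
      rw [Representation.extend_apply, T.rep_apply, C.aux_base, C.aux_act, T.vec_act, map_smul]
      funext j
      simp only [Pi.smul_apply]
      rcases e j with j | j | j <;> simp
    exact congrArg₂ Sum.elim h1 h2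
  obtain ⟨z, hz, hzero⟩ := S.exists_torus_zero Φ hΦ fun γ z _ => heq γ z
  have hmain := congrArg (fun (w : C.S.ι ⊕ T.S.ι → ℝ) j => w (.inl j)) hzero
  have haux : ∀ j, _ = (0 : ℝ) := fun j => congrFun hzero (.inr (e.symm j))
  simp only [Φ, Sum.elim_inr, Equiv.apply_symm_apply] at haux
  have hx : D.rest (T.vec fun j => z (.inr j)) = 0 := funext fun j => haux (.inr (.inl j))
  obtain ⟨P, c, hP, hc, -, hpt⟩ := C.exists_points (fun j => z (.inr j)) (fun j => z (.inl j))
    (T.vec fun j => z (.inr j)) δ (fun j => hz _) (fun j => hz _) hδ hmain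
    (funext fun j => haux (.inl j))
  let r := Fintype.equivOfCardEq ((Fintype.card_fin (2 ^ i)).trans C.card_J.symm)
  refine ⟨T.vec fun j => z (.inr j), P ∘ r, T.vec_dotProduct_self fun j => hz _, hx,
    hP.comp r.injective, fun l l' => (hc _).trans (hc _).symm, fun l => ?_⟩
  obtain ⟨h1, h2⟩ := hpt (r l)
  rw [map_sub, hx, sub_zero] at h1
  exact ⟨h1, h2⟩

end Tower.Data
end

section
open Topology Filter

namespace Projectivization

theorem continuous_mk' (K V : Type*) [DivisionRing K] [AddCommGroup V] [Module K V]
    [TopologicalSpace V] : Continuous (Projectivization.mk' K : {v : V // v ≠ 0} → _) :=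
  continuous_quotient_mk'

variable {V W : Type*} [NormedAddCommGroup V] [NormedSpace ℂ V] [NormedAddCommGroup W]

theorem exists_norm_le [FiniteDimensional ℂ V] {f : Projectivization ℂ V → W}
    (hf : Continuous f) : ∃ C, ∀ p, ‖f p‖ ≤ C := by
  have : ProperSpace V := FiniteDimensional.proper ℂ V
  let g : Metric.sphere (0 : V) 1 → W := fun v => f (mk' ℂ ⟨v, fun h => by simpa [h] using v.2⟩)
  have hg : Continuous g := hf.comp ((continuous_mk' ℂ V).comp (by fun_prop))
  obtain ⟨C, hC⟩ := (isCompact_range hg).isBounded.exists_norm_le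
  refine ⟨C, fun p => ?_⟩
  induction p using Projectivization.ind with
  | h v hv =>
    have hv' : ‖v‖ ≠ 0 := norm_ne_zero_iff.mpr hv
    have hu : ((‖v‖ : ℂ)⁻¹ • v) ∈ Metric.sphere (0 : V) 1 := by
      simp [norm_smul, hv']
    refine (hC _ ⟨⟨_, hu⟩, rfl⟩).trans' (le_of_eq ?_)
    simp only [g]
    congr 2
    rw [mk'_eq_mk, mk_eq_mk_iff']
    exact ⟨(‖v‖ : ℂ), by simp [smul_smul, hv']⟩

variable [NormedSpace ℝ W] (f : Projectivization ℂ V → W)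

open Classical in
/-- The extension of a map on a projective space to the vector space. -/
noncomputable def radial (v : V) : W :=
  if h : v = 0 then 0 else min 1 (2 * ‖v‖) • f (mk ℂ v h)

theorem radial_of_ne {v : V} (h : v ≠ 0) : radial f v = min 1 (2 * ‖v‖) • f (mk ℂ v h) :=
  dif_neg h

theorem radial_of_norm {v : V} (h : v ≠ 0) (h2 : 1 / 2 ≤ ‖v‖) : radial f v = f (mk ℂ v h) := by
  rw [radial_of_ne f h, min_eq_left (by linarith), one_smul]

theorem radial_neg (v : V) : radial f (-v) = radial f v := by
  by_cases h : v = 0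
  · simp [h]
  · rw [radial_of_ne f h, radial_of_ne f (neg_ne_zero.mpr h), norm_neg]
    congr 2
    rw [mk_eq_mk_iff']
    exact ⟨-1, by simp⟩

theorem continuous_radial [FiniteDimensional ℂ V] {f : Projectivization ℂ V → W}
    (hf : Continuous f) : Continuous (radial f) := by
  refine continuous_iff_continuousAt.mpr fun v => ?_
  by_cases h : v = 0
  · subst h
    obtain ⟨C, hC⟩ := exists_norm_le hf
    have h0 : radial f 0 = 0 := dif_pos rfl
    rw [ContinuousAt, h0]
    have hlim : Tendsto (fun v : V => 2 * ‖v‖ * C) (𝓝 0) (𝓝 0) := by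
      have : Continuous fun v : V => 2 * ‖v‖ * C := by fun_prop
      simpa using this.tendsto 0
    refine squeeze_zero_norm (fun v => ?_) hlim
    by_cases h : v = 0
    · simp [h, h0]
    · rw [radial_of_ne f h, norm_smul, Real.norm_of_nonneg (by positivity)]
      exact mul_le_mul (min_le_right _ _) (hC _) (norm_nonneg _) (by positivity)
  · have ho : IsOpen {v : V | v ≠ 0} := isOpen_ne
    have hc : ContinuousOn (radial f) {v : V | v ≠ 0} := by
      rw [continuousOn_iff_continuous_domRestrict]
      have : Set.domRestrict {v : V | v ≠ 0} (radial f) =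
          fun v : {v : V | v ≠ 0} => min 1 (2 * ‖(v : V)‖) • f (mk' ℂ ⟨v.1, v.2⟩) := by
        funext v
        exact radial_of_ne f v.2
      rw [this]
      exact (by fun_prop : Continuous fun v : {v : V | v ≠ 0} => min 1 (2 * ‖(v : V)‖)).smul
        (hf.comp ((continuous_mk' ℂ V).comp (by fun_prop)))
    exact hc.continuousAt (ho.mem_nhds h)

end Projectivization

section
variable {Λ ν μ : Type} [Fintype ν] (e : Λ ≃ (ν × Fin 2) ⊕ μ)

/-- The complex components of a real vector. -/
noncomputable def complexPart : (Λ → ℝ) →ₗ[ℝ] EuclideanSpace ℂ ν where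
  toFun z := WithLp.toLp 2 fun j => ⟨z (e.symm (.inl (j, 0))), z (e.symm (.inl (j, 1)))⟩
  map_add' z w := by
    ext j
    apply Complex.ext <;> simp
  map_smul' c z := by
    ext j
    apply Complex.ext <;> simp

/-- The remaining components of a real vector. -/
def restPart : (Λ → ℝ) →ₗ[ℝ] μ → ℝ where
  toFun z j := z (e.symm (.inr j))
  map_add' _ _ := rfl
  map_smul' _ _ := rfl

theorem norm_complexPart [Fintype Λ] [Fintype μ] {z : Λ → ℝ} (h : restPart e z = 0) :
    ‖complexPart e z‖ ^ 2 = z ⬝ᵥ z := by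
  have hr : ∀ j, z (e.symm (.inr j)) = 0 := congrFun h
  rw [EuclideanSpace.norm_sq_eq, dotProduct, ← e.symm.sum_comp, Fintype.sum_sum_type,
    Fintype.sum_prod_type]
  simp [hr, complexPart, Complex.sq_norm, Complex.normSq_apply]

theorem eq_of_complexPart_eq [Fintype Λ] [Fintype μ] {z w : Λ → ℝ} (hz : restPart e z = 0) (hw : restPart e w = 0)
    (h : complexPart e z = complexPart e w) : z = w := by
  have h0 : restPart e (z - w) = 0 := by rw [map_sub, hz, hw, sub_zero]
  have := norm_complexPart e h0
  rw [map_sub, h, sub_self, norm_zero] at this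
  exact sub_eq_zero.mp (dotProduct_self_eq_zero.mp (by simpa using this.symm))

/-- The hermitian product of the complex components. -/
noncomputable def hermPart : (Λ → ℝ) →ₗ[ℝ] (Λ → ℝ) →ₗ[ℝ] Fin 2 → ℝ :=
  LinearMap.mk₂ ℝ (fun x v => ![(inner ℂ (complexPart e x) (complexPart e v)).re,
      (inner ℂ (complexPart e x) (complexPart e v)).im])
    (fun x y v => by simp)
    (fun c x v => by
      rw [map_smul, ← Complex.coe_smul c, inner_smul_left]
      simp)
    (fun x v w => by simp)
    (fun c x v => by
      rw [map_smul, ← Complex.coe_smul c, inner_smul_right]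
      simp)

theorem inner_complexPart_of_hermPart {x v : Λ → ℝ} (h : hermPart e x v = 0) :
    inner ℂ (complexPart e x) (complexPart e v) = 0 :=
  Complex.ext (congrFun h 0) (congrFun h 1)

theorem continuous_complexPart [Fintype Λ] : Continuous (complexPart e) :=
  (complexPart e).continuous_of_finiteDimensional

theorem continuous_hermPart [Fintype Λ] :
    Continuous fun q : (Λ → ℝ) × (Λ → ℝ) => hermPart e q.1 q.2 := by
  have h : Continuous fun q : (Λ → ℝ) × (Λ → ℝ) =>
      inner ℂ (complexPart e q.1) (complexPart e q.2) :=
    ((continuous_complexPart e).comp continuous_fst).inner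
      ((continuous_complexPart e).comp continuous_snd)
  refine continuous_pi fun j => ?_
  fin_cases j
  exacts [Complex.continuous_re.comp h, Complex.continuous_im.comp h]

end
end

section
open Topology Filter

namespace Projectivization
variable {V W : Type*} [NormedAddCommGroup V] [InnerProductSpace ℂ V]

theorem eq_of_mk_eq_mk {u v w : V} (hu : u ≠ 0) (hv : v ≠ 0) (hw : w ≠ 0)
    (huv : inner ℂ u (v - u) = 0) (huw : inner ℂ u (w - u) = 0) (h : mk ℂ v hv = mk ℂ w hw) :
    v = w := by
  obtain ⟨c, rfl⟩ := (mk_eq_mk_iff' ℂ v w hv hw).mp h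
  rw [inner_sub_right, sub_eq_zero] at huv huw
  rw [inner_smul_right, huw, mul_eq_right₀ (inner_self_ne_zero.mpr hu)] at huv
  rw [huv, one_smul]

theorem exists_localMultiplicity_of_affine [FiniteDimensional ℂ V] [NormedAddCommGroup W]
    [NormedSpace ℝ W] {f : Projectivization ℂ V → W} {k : ℕ}
    (h : ∀ δ > 0, ∃ (u : V) (Q : Fin k → V), ‖u‖ = 1 ∧ Function.Injective Q ∧
      (∀ l l', radial f (Q l) = radial f (Q l')) ∧
      ∀ l, inner ℂ u (Q l - u) = 0 ∧ ‖Q l - u‖ ≤ δ) : AdmitsLocalMultiplicity f k := by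
  have : ProperSpace V := FiniteDimensional.proper ℂ V
  choose u Q hu hQ hf hclose using fun n : ℕ => h (1 / ((n : ℝ) + 1 + 1)) (by positivity)
  obtain ⟨u₀, hu₀, φ, hφ, hlim⟩ := (isCompact_sphere (0 : V) 1).tendsto_subseq
    (x := u) fun n => mem_sphere_zero_iff_norm.mpr (hu n)
  have hne : ∀ {v : V}, ‖v‖ = 1 → v ≠ 0 := fun h h0 => by simp [h0] at h
  have hu₀ne : u₀ ≠ 0 := hne (mem_sphere_zero_iff_norm.mp hu₀)
  have hhalf : ∀ n l, 1 / 2 ≤ ‖Q n l‖ := by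
    intro n l
    have h1 : 1 / ((n : ℝ) + 1 + 1) ≤ 1 / 2 :=
      one_div_le_one_div_of_le (by norm_num) (by linarith [n.cast_nonneg (α := ℝ)])
    have h2 := norm_sub_norm_le (u n) (Q n l)
    rw [norm_sub_rev, hu] at h2
    linarith [(hclose n l).2]
  have hQne : ∀ n l, Q n l ≠ 0 := fun n l h0 => by
    have := hhalf n l
    rw [h0, norm_zero] at this
    norm_num at this
  refine ⟨mk ℂ u₀ hu₀ne, fun U hU => ?_⟩
  have hpre : (mk' ℂ : {v : V // v ≠ 0} → _) ⁻¹' U ∈ 𝓝 (⟨u₀, hu₀ne⟩ : {v : V // v ≠ 0}) :=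
    (continuous_mk' ℂ V).continuousAt.preimage_mem_nhds hU
  obtain ⟨ε, hε, hball⟩ := Metric.mem_nhds_iff.mp hpre
  have hδ : Tendsto (fun n => 1 / ((φ n : ℝ) + 1 + 1)) atTop (𝓝 0) := by
    have := (tendsto_one_div_add_atTop_nhds_zero_nat (𝕜 := ℝ)).comp
      ((tendsto_add_atTop_nat 1).comp hφ.tendsto_atTop)
    simpa [Function.comp_def] using this
  obtain ⟨n, hn1, hn2⟩ := ((hδ.eventually (gt_mem_nhds (half_pos hε))).and
    (hlim.eventually (Metric.ball_mem_nhds u₀ (half_pos hε)))).exists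
  refine ⟨fun l => mk ℂ (Q (φ n) l) (hQne _ l), fun l l' hl => hQ (φ n) ?_, fun l => ?_,
    fun l l' => ?_⟩
  · exact eq_of_mk_eq_mk (hne (hu (φ n))) _ _ (hclose (φ n) l).1 (hclose (φ n) l').1 hl
  · refine hball (a := ⟨Q (φ n) l, hQne _ l⟩) ?_
    change dist (Q (φ n) l) u₀ < ε
    have h1 := dist_triangle (Q (φ n) l) (u (φ n)) u₀
    have h2 := (hclose (φ n) l).2
    rw [← dist_eq_norm] at h2
    have h3 : dist (u (φ n)) u₀ < ε / 2 := hn2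
    linarith
  · rw [← radial_of_norm f _ (hhalf _ l), ← radial_of_norm f _ (hhalf _ l'), hf]

end Projectivization

/-- The equations for the multiplicities of a map on a projective space. -/
noncomputable def Tower.projectiveData {m : ℕ} (T : Tower m) {ν : Type} [Fintype ν] {N d : ℕ}
    {f : Projectivization ℂ (EuclideanSpace ℂ ν) → Fin N → ℝ} (hf : Continuous f)
    (e : T.Λ ≃ (ν × Fin 2) ⊕ Fin d) (index : T.S.ι ≃ Fin N ⊕ Fin 2) : T.Data where
  N := N
  d := d
  f z := Projectivization.radial f (complexPart e z)
  continuous_f := (Projectivization.continuous_radial hf).comp (continuous_complexPart e)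
  f_neg z := by rw [map_neg, Projectivization.radial_neg]
  herm := hermPart e
  continuous_herm := continuous_hermPart e
  rest := restPart e
  index := index

theorem Tower.exists_localMultiplicity {m : ℕ} (T : Tower m) {ν : Type} [Fintype ν] {N d i : ℕ}
    {f : Projectivization ℂ (EuclideanSpace ℂ ν) → Fin N → ℝ} (hf : Continuous f)
    (e : T.Λ ≃ (ν × Fin 2) ⊕ Fin d) (index : T.S.ι ≃ Fin N ⊕ Fin 2)
    (hi : 2 ^ i * d ≤ Fintype.card T.S.ι) : AdmitsLocalMultiplicity f (2 ^ i) := by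
  refine Projectivization.exists_localMultiplicity_of_affine fun δ hδ => ?_
  let L := LinearMap.toContinuousLinearMap (complexPart e)
  have hpos : 0 < 2 * (‖L‖ + 1) := by positivity
  obtain ⟨x, P, hx, hr, hP, hc, hpt⟩ := (T.projectiveData hf e index).exists_points hi
    (div_pos hδ hpos)
  refine ⟨complexPart e x, fun l => complexPart e (P l), ?_, fun l l' h => hP ?_, hc, fun l => ?_⟩
  · have := norm_complexPart e hr
    rw [hx] at this
    exact (pow_eq_one_iff_of_nonneg (norm_nonneg _) two_ne_zero).mp this
  · exact eq_of_complexPart_eq e (hpt l).1 (hpt l').1 h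
  · obtain ⟨-, h2, h3⟩ := hpt l
    rw [← map_sub]
    refine ⟨inner_complexPart_of_hermPart e h2, (L.le_opNorm _).trans ?_⟩
    calc ‖L‖ * ‖P l - x‖ ≤ (‖L‖ + 1) * (2 * (δ / (2 * (‖L‖ + 1)))) := by
          gcongr
          linarith
      _ = δ := by field_simp

end

/-- Every continuous map `ℂP^{2^ℓ-a} → ℝ^{2^{ℓ+1}-3}` admits a local `k`-multiplicity,
whenever `k ≥ 2` is a power of `2` and `k(a-1) ≤ 2^ℓ - 1`. -/
theorem localMultiplicity_of_continuous_complexProjective_to_euclidean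
    (a ℓ k : ℕ) (ha : 1 ≤ a) (hℓ : 1 ≤ ℓ) (hk : 2 ≤ k) (hk2 : ∃ i : ℕ, k = 2 ^ i)
    (hka : k * (a - 1) ≤ 2 ^ ℓ - 1)
    (f : Projectivization ℂ (EuclideanSpace ℂ (Fin (2 ^ ℓ - a + 1))) →
      EuclideanSpace ℝ (Fin (2 ^ (ℓ + 1) - 3)))
    (hf : Continuous f) :
    AdmitsLocalMultiplicity f k := by
  obtain ⟨i, rfl⟩ := hk2
  let T := Tower.ofHeight (ℓ + 1)
  have h2 : 2 ≤ 2 ^ ℓ := Nat.le_self_pow (by omega) 2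
  have ha2 : 2 * (a - 1) ≤ 2 ^ ℓ - 1 := (Nat.mul_le_mul_right _ hk).trans hka
  have hΛ : Fintype.card T.Λ = 2 * 2 ^ ℓ := T.card_index.trans (pow_succ' 2 ℓ)
  have hι := T.card_succ
  have he : Fintype.card T.Λ =
      Fintype.card ((Fin (2 ^ ℓ - a + 1) × Fin 2) ⊕ Fin (2 * (a - 1))) := by
    simp only [Fintype.card_sum, Fintype.card_prod, Fintype.card_fin]
    omega
  have hindex : Fintype.card T.S.ι = Fintype.card (Fin (2 ^ (ℓ + 1) - 3) ⊕ Fin 2) := by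
    simp only [Fintype.card_sum, Fintype.card_fin, pow_succ']
    omega
  obtain ⟨p, hp⟩ := T.exists_localMultiplicity (i := i)
    ((PiLp.continuous_ofLp 2 _).comp hf) (Fintype.equivOfCardEq he)
    (Fintype.equivOfCardEq hindex) (by rw [mul_left_comm]; omega)
  refine ⟨p, fun U hU => ?_⟩
  obtain ⟨x, hx, hxU, hfx⟩ := hp U hU
  exact ⟨x, hx, hxU, fun l l' => WithLp.ofLp_injective 2 (hfx l l')⟩
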